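/- (Khan–Ngo) For every ε > 0 there exists Q such that for every prime q ≥ Q, the number of Dirichlet characters χ modulo q with L(χ, 1/2) ≠ 0 is at least (3/8 − ε)(q − 1); that is, at least a proportion 3/8 − o(1) of the Dirichlet L-functions modulo q do not vanish at the central point s = 1/2. -/

import Mathlib

namespace DirichletNonvanishing

open Polynomial

section Stepanov

variable {F : Type*} [Field F]

/-- The polynomial `T` with `(f ^ e * r)^(k) = f ^ (e - k) * T`. -/
noncomputable def twistedDeriv (f : F[X]) (e : ℕ) : ℕ → F[X] →ₗ[F] F[X]
  | 0 => LinearMap.id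
  | k + 1 => LinearMap.mulLeft F f ∘ₗ derivative ∘ₗ twistedDeriv f e k
      + ((e : F) - k) • (LinearMap.mulLeft F (derivative f) ∘ₗ twistedDeriv f e k)

lemma twistedDeriv_succ_apply (f : F[X]) (e k : ℕ) (r : F[X]) :
    twistedDeriv f e (k + 1) r = f * derivative (twistedDeriv f e k r)
      + C ((e : F) - k) * (derivative f * twistedDeriv f e k r) := by
  simp [twistedDeriv, smul_eq_C_mul]

lemma iterate_derivative_pow_mul (f : F[X]) (e k : ℕ) (hk : k ≤ e) (r : F[X]) :
    derivative^[k] (f ^ e * r) = f ^ (e - k) * twistedDeriv f e k r := by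
  induction k with
  | zero => simp [twistedDeriv]
  | succ k ih =>
    rw [Function.iterate_succ_apply', ih (by omega), twistedDeriv_succ_apply, derivative_mul,
      derivative_pow]
    obtain ⟨n, rfl⟩ : ∃ n, e = n + k + 1 := ⟨e - k - 1, by omega⟩
    have h1 : n + k + 1 - k = n + 1 := by omega
    have h2 : n + k + 1 - (k + 1) = n := by omega
    rw [h1, h2]
    simp only [Nat.add_sub_cancel]
    have h3 : (((n + k + 1 : ℕ) : F) - k) = ((n + 1 : ℕ) : F) := by push_cast; ring
    rw [h3]
    ring

lemma natDegree_twistedDeriv_le (f : F[X]) (e k m n : ℕ) (hf : f.natDegree ≤ m) (r : F[X])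
    (hr : r.natDegree ≤ n) : (twistedDeriv f e k r).natDegree ≤ n + k * m := by
  induction k with
  | zero => simpa [twistedDeriv]
  | succ k ih =>
    rw [twistedDeriv_succ_apply]
    refine natDegree_add_le_of_degree_le ?_ ?_
    · refine natDegree_mul_le.trans ?_
      have := natDegree_derivative_le (twistedDeriv f e k r)
      rw [add_mul]; omega
    · refine (natDegree_C_mul_le _ _).trans (natDegree_mul_le.trans ?_)
      have := natDegree_derivative_le f
      rw [add_mul]; omega

lemma iterate_derivative_mul_of_derivative_eq_zero (P Y : F[X]) (hY : derivative Y = 0) (k : ℕ) :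
    derivative^[k] (P * Y) = derivative^[k] P * Y := by
  induction k with
  | zero => rfl
  | succ k ih => rw [Function.iterate_succ_apply', ih, derivative_mul, hY, mul_zero, add_zero,
      Function.iterate_succ_apply']

lemma exists_eq_C_mul_sq {f r s : F[X]} {c : F} (hc : c ≠ 0) (hs : s ≠ 0)
    (h : f * r ^ 2 = C c * s ^ 2) : ∃ h : F[X], f = C c * h ^ 2 := by
  have hr : r ≠ 0 := by
    rintro rfl
    simp [hc, hs] at h
  have hd : r ^ 2 ∣ s ^ 2 := by
    have : r ^ 2 ∣ C c * s ^ 2 := ⟨f, by rw [← h]; ring⟩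
    have hu : IsUnit (C c : F[X]) := isUnit_C.2 (isUnit_iff_ne_zero.2 hc)
    exact (hu.dvd_mul_left).1 this
  obtain ⟨t, rfl⟩ := (UniqueFactorizationMonoid.pow_dvd_pow_iff_dvd two_ne_zero).1 hd
  refine ⟨t, ?_⟩
  have : r ^ 2 ≠ 0 := pow_ne_zero _ hr
  apply mul_right_cancel₀ this
  rw [h]; ring

end Stepanov

section StepanovPrime

variable {p : ℕ} [hp : Fact p.Prime]

local notation "F" => ZMod p

/-- Independence of the two families in the Stepanov auxiliary polynomial. -/
lemma stepanov_independent (h2 : p ≠ 2) {f : F[X]} (h0 : f.eval 0 ≠ 0)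
    (hsq : ∀ (c : F) (h : F[X]), f ≠ C c * h ^ 2) {J : ℕ} (r s : ℕ → F[X])
    (hr : ∀ j, f.natDegree + 2 * (r j).natDegree < p) (hs : ∀ j, 2 * (s j).natDegree < p)
    (h : ∑ j ∈ Finset.range J, (r j + f ^ ((p - 1) / 2) * s j) * X ^ (j * p) = 0) :
    ∀ j < J, r j = 0 ∧ s j = 0 := by
  intro j
  induction j using Nat.strong_induction_on with
  | _ k ih =>
  intro hk
  have hodd : 2 * ((p - 1) / 2) + 1 = p := by
    have := hp.out.two_le
    have := (hp.out.eq_two_or_odd).resolve_left h2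
    omega
  have hdiv : (X : F[X]) ^ p ∣ r k + f ^ ((p - 1) / 2) * s k := by
    have hX : (X : F[X]) ^ (k * p) ≠ 0 := pow_ne_zero _ X_ne_zero
    have : (X : F[X]) ^ (k * p) * X ^ p ∣ X ^ (k * p) * (r k + f ^ ((p - 1) / 2) * s k) := by
      have e : X ^ (k * p) * (r k + f ^ ((p - 1) / 2) * s k)
          = - ∑ j ∈ (Finset.range J).erase k, (r j + f ^ ((p - 1) / 2) * s j) * X ^ (j * p) := by
        rw [← Finset.add_sum_erase _ _ (Finset.mem_range.2 hk)] at h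
        linear_combination h
      rw [e, dvd_neg]
      refine Finset.dvd_sum fun j hj => ?_
      rw [Finset.mem_erase, Finset.mem_range] at hj
      rcases lt_or_gt_of_ne hj.1 with hlt | hgt
      · obtain ⟨h1, h2⟩ := ih j hlt hj.2
        simp [h1, h2]
      · rw [← pow_add]
        refine Dvd.dvd.mul_left (pow_dvd_pow _ ?_) _
        calc k * p + p = (k + 1) * p := by ring
          _ ≤ j * p := Nat.mul_le_mul_right _ hgt
    exact (mul_dvd_mul_iff_left hX).1 this
  have hfp : (X : F[X]) ^ p ∣ f ^ p - C (f.eval 0) := by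
    have e : f ^ p - C (f.eval 0) = (f - C (f.eval 0)) ^ p := by
      rw [sub_pow_char, ← C_pow, ZMod.pow_card]
    rw [e, ← coeff_zero_eq_eval_zero]
    exact pow_dvd_pow_of_dvd X_dvd_sub_C p
  have hdiv2 : (X : F[X]) ^ p ∣ f * r k ^ 2 - C (f.eval 0) * s k ^ 2 := by
    have e : f * r k ^ 2 - C (f.eval 0) * s k ^ 2
        = (r k + f ^ ((p - 1) / 2) * s k) * (f * (r k - f ^ ((p - 1) / 2) * s k))
          + (f ^ p - C (f.eval 0)) * s k ^ 2 := by
      have : f ^ p = f * (f ^ ((p - 1) / 2)) ^ 2 := by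
        calc f ^ p = f ^ (2 * ((p - 1) / 2) + 1) := by rw [hodd]
          _ = _ := by ring
      rw [this]; ring
    rw [e]
    exact dvd_add (hdiv.mul_right _) (hfp.mul_right _)
  have hzero : f * r k ^ 2 - C (f.eval 0) * s k ^ 2 = 0 := by
    apply eq_zero_of_dvd_of_natDegree_lt hdiv2
    rw [natDegree_X_pow]
    refine (natDegree_sub_le _ _).trans_lt (max_lt ?_ ?_)
    · refine natDegree_mul_le.trans_lt ?_
      have := natDegree_pow_le (p := r k) (n := 2)
      have := hr k
      omega
    · refine (natDegree_C_mul_le _ _).trans_lt ?_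
      have := natDegree_pow_le (p := s k) (n := 2)
      have := hs k
      omega
  have heq := sub_eq_zero.1 hzero
  have hf0 : f ≠ 0 := by rintro rfl; simp at h0
  by_cases hsk : s k = 0
  · refine ⟨?_, hsk⟩
    rw [hsk] at heq
    simpa [hf0] using heq
  · obtain ⟨t, ht⟩ := exists_eq_C_mul_sq h0 hsk heq
    exact absurd ht (hsq _ _)

end StepanovPrime

open Polynomial

section StepanovPrime

variable {p : ℕ} [hp : Fact p.Prime]

local notation "F" => ZMod p

/-- The polynomial with a given vector of `D` coefficients. -/
noncomputable def polyOfCoeffs (p D : ℕ) [Fact p.Prime] : (Fin D → ZMod p) →ₗ[ZMod p] (ZMod p)[X] :=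
  (degreeLT (ZMod p) D).subtype ∘ₗ (degreeLTEquiv (ZMod p) D).symm.toLinearMap

lemma polyOfCoeffs_injective (D : ℕ) : Function.Injective (polyOfCoeffs p D) :=
  Subtype.val_injective.comp (degreeLTEquiv (ZMod p) D).symm.injective

lemma natDegree_polyOfCoeffs_lt {D : ℕ} (hD : 0 < D) (c : Fin D → F) :
    (polyOfCoeffs p D c).natDegree < D := by
  have h := ((degreeLTEquiv (ZMod p) D).symm c).2
  rw [mem_degreeLT] at h
  by_cases h0 : polyOfCoeffs p D c = 0
  · rw [h0]; simpa
  · exact (natDegree_lt_iff_degree_lt h0).2 h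

lemma sum_le_natDegree_of_dvd {A : F[X]} (hA : A ≠ 0) (S : Finset F) (l : ℕ)
    (h : ∀ x ∈ S, (X - C x) ^ l ∣ A) : l * S.card ≤ A.natDegree := by
  classical
  calc l * S.card = ∑ x ∈ S, l := by simp [mul_comm]
    _ ≤ ∑ x ∈ S, A.roots.count x := by
        refine Finset.sum_le_sum fun x hx => ?_
        rw [count_roots]
        exact (le_rootMultiplicity_iff hA).2 (h x hx)
    _ ≤ ∑ x ∈ S ∪ A.roots.toFinset, A.roots.count x :=
        Finset.sum_le_sum_of_subset Finset.subset_union_left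
    _ = A.roots.card := Multiset.sum_count_eq_card (fun a ha => by simp [ha])
    _ ≤ A.natDegree := card_roots' A

lemma dvd_of_iterate_derivative {A : F[X]} (hA : A ≠ 0) (x : F) {l : ℕ} (hl : l ≤ p)
    (h : ∀ k < l, (derivative^[k] A).eval x = 0) : (X - C x) ^ l ∣ A := by
  rcases Nat.eq_zero_or_pos l with rfl | hl0
  · simp
  rw [← le_rootMultiplicity_iff hA]
  have := lt_rootMultiplicity_of_isRoot_iterate_derivative_of_mem_nonZeroDivisors
    (p := A) (t := x) (n := l - 1) hA (fun m hm => h m (by omega)) ?_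
  · omega
  · rw [mem_nonZeroDivisors_iff_ne_zero, Ne, ZMod.natCast_eq_zero_iff, hp.out.dvd_factorial]
    omega

/-- The coefficients of the polynomials whose vanishing makes the Stepanov auxiliary polynomial
vanish to order `l`. -/
noncomputable def stepanovMap (f : F[X]) (a : F) (e l J D N : ℕ) :
    ((Fin J → Fin D → F) × (Fin J → Fin D → F)) →ₗ[F] (Fin l → Fin N → F) where
  toFun v := fun k i => (∑ j : Fin J, (twistedDeriv f l k (polyOfCoeffs p D (v.1 j))
      + C a * twistedDeriv f (l + e) k (polyOfCoeffs p D (v.2 j))) * X ^ (j : ℕ)).coeff i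
  map_add' v w := by
    ext k i
    simp only [Prod.fst_add, Prod.snd_add, Pi.add_apply, map_add, ← coeff_add,
      ← Finset.sum_add_distrib]
    congr 1
    refine Finset.sum_congr rfl fun j _ => ?_
    ring
  map_smul' c v := by
    ext k i
    simp only [Prod.smul_fst, Prod.smul_snd, Pi.smul_apply, map_smul, ← coeff_smul, RingHom.id_apply,
      Finset.smul_sum]
    congr 1
    refine Finset.sum_congr rfl fun j _ => ?_
    simp only [smul_eq_C_mul]
    ring

lemma stepanov_card_le (h2 : p ≠ 2) {f : F[X]} (hdeg : f.natDegree ≤ 4) (h0 : f.eval 0 ≠ 0)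
    (hsq : ∀ (c : F) (h : F[X]), f ≠ C c * h ^ 2) (a : F) {l J D : ℕ} (hD0 : 0 < D)
    (hD : 2 * D + 2 < p) (hl : l ≤ p) (hcount : l * (D + 4 * l + J) < 2 * J * D)
    (S : Finset F) (hS : ∀ x ∈ S, f.eval x = 0 ∨ f.eval x ^ ((p - 1) / 2) = a) :
    l * S.card ≤ 4 * l + D + (J + 1) * p := by
  set e := (p - 1) / 2 with he
  set N := D + 4 * l + J with hN
  have hker : (stepanovMap f a e l J D N).ker ≠ ⊥ := by
    apply LinearMap.ker_ne_bot_of_finrank_lt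
    simp only [Module.finrank_prod, Module.finrank_pi_fintype, Module.finrank_self,
      Finset.sum_const, Finset.card_univ, Fintype.card_fin, smul_eq_mul, mul_one]
    linarith
  obtain ⟨v, hv, hv0⟩ := (Submodule.ne_bot_iff _).1 hker
  rw [LinearMap.mem_ker] at hv
  set r : ℕ → F[X] := fun j => if h : j < J then polyOfCoeffs p D (v.1 ⟨j, h⟩) else 0 with hr
  set s : ℕ → F[X] := fun j => if h : j < J then polyOfCoeffs p D (v.2 ⟨j, h⟩) else 0 with hs
  have hrd : ∀ j, (r j).natDegree < D := fun j => by
    simp only [hr]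
    split_ifs
    · exact natDegree_polyOfCoeffs_lt hD0 _
    · simpa
  have hsd : ∀ j, (s j).natDegree < D := fun j => by
    simp only [hs]
    split_ifs
    · exact natDegree_polyOfCoeffs_lt hD0 _
    · simpa
  have hf0 : f ≠ 0 := by rintro rfl; simp at h0
  set B : F[X] := ∑ j ∈ Finset.range J, (r j + f ^ e * s j) * X ^ (j * p) with hB
  have hBne : B ≠ 0 := by
    intro hB0
    have := stepanov_independent h2 h0 hsq r s (fun j => by have := hrd j; omega)
      (fun j => by have := hsd j; omega) hB0
    apply hv0
    refine Prod.ext ?_ ?_ <;> funext j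
    · have := (this j j.2).1
      simp only [hr, j.2, dite_true] at this
      exact polyOfCoeffs_injective D (by simpa using this)
    · have := (this j j.2).2
      simp only [hs, j.2, dite_true] at this
      exact polyOfCoeffs_injective D (by simpa using this)
  have hAne : f ^ l * B ≠ 0 := mul_ne_zero (pow_ne_zero _ hf0) hBne
  have hσ : ∀ k < l, ∑ j ∈ Finset.range J, (twistedDeriv f l k (r j)
      + C a * twistedDeriv f (l + e) k (s j)) * X ^ j = 0 := by
    intro k hk
    have hc := congrFun hv ⟨k, hk⟩
    have hsum : ∑ j ∈ Finset.range J, (twistedDeriv f l k (r j)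
      + C a * twistedDeriv f (l + e) k (s j)) * X ^ j = ∑ j : Fin J, (twistedDeriv f l k
      (polyOfCoeffs p D (v.1 j)) + C a * twistedDeriv f (l + e) k (polyOfCoeffs p D (v.2 j)))
        * X ^ (j : ℕ) := by
      rw [Finset.sum_range]
      refine Finset.sum_congr rfl fun j _ => ?_
      simp [hr, hs]
    ext i
    by_cases hi : i < N
    · rw [hsum]
      exact congrFun hc ⟨i, hi⟩
    · rw [coeff_zero]
      apply coeff_eq_zero_of_natDegree_lt
      refine (natDegree_sum_le_of_forall_le (n := D - 1 + k * 4 + (J - 1)) _ _ fun j hj => ?_).trans_lt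
        (by omega)
      rw [Finset.mem_range] at hj
      refine natDegree_mul_le.trans (add_le_add ?_ ?_)
      · refine natDegree_add_le_of_degree_le ?_ ((natDegree_C_mul_le _ _).trans ?_)
        · exact natDegree_twistedDeriv_le f l k 4 _ hdeg _ (by have := hrd j; omega)
        · exact natDegree_twistedDeriv_le f _ k 4 _ hdeg _ (by have := hsd j; omega)
      · rw [natDegree_X_pow]; omega
  have hdvd : ∀ x ∈ S, (X - C x) ^ l ∣ f ^ l * B := by
    intro x hx
    by_cases hfx : f.eval x = 0
    · exact Dvd.dvd.mul_right (pow_dvd_pow_of_dvd (dvd_iff_isRoot.2 hfx) l) B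
    have ha : f.eval x ^ e = a := (hS x hx).resolve_left hfx
    refine dvd_of_iterate_derivative hAne x hl fun k hk => ?_
    have hform : derivative^[k] (f ^ l * B) = f ^ (l - k) * ∑ j ∈ Finset.range J,
        (twistedDeriv f l k (r j) + f ^ e * twistedDeriv f (l + e) k (s j)) * X ^ (j * p) := by
      rw [hB, Finset.mul_sum, Finset.mul_sum, iterate_derivative_sum]
      refine Finset.sum_congr rfl fun j _ => ?_
      have e1 : f ^ l * ((r j + f ^ e * s j) * X ^ (j * p))
          = (f ^ l * r j + f ^ (l + e) * s j) * X ^ (j * p) := by rw [pow_add]; ring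
      have hd : derivative ((X : F[X]) ^ (j * p)) = 0 := by
        rw [derivative_X_pow]; simp
      rw [e1, iterate_derivative_mul_of_derivative_eq_zero _ _ hd, iterate_map_add,
        iterate_derivative_pow_mul _ _ _ hk.le, iterate_derivative_pow_mul _ _ _ (by omega)]
      have : l + e - k = (l - k) + e := by omega
      rw [this, pow_add]; ring
    have h3 := congrArg (eval x) (hσ k hk)
    rw [hform, eval_mul]
    simp only [eval_finsetSum, eval_mul, eval_add, eval_pow, eval_X, eval_C, eval_zero] at h3 ⊢
    rw [ha]
    have : ∀ j : ℕ, x ^ (j * p) = x ^ j := fun j => by rw [pow_mul, ZMod.pow_card]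
    simp only [this, h3, mul_zero]
  refine (sum_le_natDegree_of_dvd hAne S l hdvd).trans ?_
  refine natDegree_mul_le.trans ?_
  have hd1 : (f ^ l).natDegree ≤ 4 * l := natDegree_pow_le.trans (by nlinarith)
  have hd2 : B.natDegree ≤ 2 * p + D + (J - 1) * p := by
    refine natDegree_sum_le_of_forall_le _ _ fun j hj => ?_
    rw [Finset.mem_range] at hj
    refine natDegree_mul_le.trans (add_le_add ?_ ?_)
    · refine natDegree_add_le_of_degree_le ((hrd j).le.trans (by omega)) ?_
      refine natDegree_mul_le.trans (add_le_add ?_ (hsd j).le)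
      refine natDegree_pow_le.trans ?_
      calc e * f.natDegree ≤ e * 4 := Nat.mul_le_mul_left _ hdeg
        _ ≤ 2 * p := by omega
    · rw [natDegree_X_pow]
      exact Nat.mul_le_mul_right _ (by omega)
  have hJ : 0 < J := by
    rcases Nat.eq_zero_or_pos J with rfl | h
    · simp at hcount
    · exact h
  obtain ⟨j, rfl⟩ : ∃ j, J = j + 1 := ⟨J - 1, by omega⟩
  simp only [Nat.add_sub_cancel] at hd2
  nlinarith

end StepanovPrime

open Polynomial

section QuadraticCharSum

variable {p : ℕ} [hp : Fact p.Prime]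

local notation "F" => ZMod p

lemma eval_pow_eq_of_quadraticChar (h2 : p ≠ 2) {f : F[X]} {x : F} {σ : ℤ} 
    (h : quadraticChar F (f.eval x) = σ) : f.eval x ^ ((p - 1) / 2) = (σ : F) := by
  have h1 : ringChar F ≠ 2 := by rwa [ZMod.ringChar_zmod_n]
  have h3 := quadraticChar_eq_pow_of_char_ne_two' h1 (f.eval x)
  rw [h, ZMod.card] at h3
  have : p / 2 = (p - 1) / 2 := by
    have := hp.out.eq_two_or_odd; omega
  rw [h3, this]

lemma sum_quadraticChar_aux (h2 : 121 ≤ p) {f : F[X]} (hdeg : f.natDegree ≤ 4)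
    (h0 : f.eval 0 ≠ 0) (hsq : ∀ (c : F) (h : F[X]), f ≠ C c * h ^ 2) {σ : ℤ}
    (hσ : σ = 1 ∨ σ = -1) :
    σ * ∑ x : F, quadraticChar F (f.eval x) ≤ 40 * Nat.sqrt p := by
  classical
  set s := Nat.sqrt p with hs
  have hs1 : s * s ≤ p := Nat.sqrt_le p
  have hs2 : p < (s + 1) * (s + 1) := Nat.lt_succ_sqrt p
  have hs3 : 11 ≤ s := by rw [hs, Nat.le_sqrt]; omega
  have hodd := hp.out.eq_two_or_odd
  set S : Finset F := Finset.univ.filter (fun x => f.eval x = 0 ∨ quadraticChar F (f.eval x) = σ)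
  have hD : 2 * ((p - 3) / 2) = p - 3 := by omega
  have hcard := stepanov_card_le (by omega) hdeg h0 hsq (σ : F) (l := 2 * s) (J := s + 23)
    (D := (p - 3) / 2) (by omega) (by omega) (by nlinarith)
    (by
      obtain ⟨m, hm⟩ : ∃ m, (p - 3) / 2 = m := ⟨_, rfl⟩
      rw [hm] at hD ⊢
      have : s * s ≤ 2 * m + 3 := by omega
      nlinarith) S
    (by
      intro x hx
      simp only [S, Finset.mem_filter, Finset.mem_univ, true_and] at hx
      exact hx.imp id fun h => eval_pow_eq_of_quadraticChar (by omega) h)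
  have hle : σ * ∑ x : F, quadraticChar F (f.eval x) ≤ 2 * (S.card : ℤ) - p := by
    have : (2 * (S.card : ℤ) - p) = ∑ x : F, (2 * (if x ∈ S then 1 else 0) - 1) := by
      rw [Finset.sum_sub_distrib, ← Finset.mul_sum]
      simp [ZMod.card]
    rw [this, Finset.mul_sum]
    refine Finset.sum_le_sum fun x _ => ?_
    simp only [S, Finset.mem_filter, Finset.mem_univ, true_and]
    by_cases hx : f.eval x = 0
    · simp [hx]
    · rcases quadraticChar_dichotomy hx with h | h <;> rcases hσ with rfl | rfl <;> simp [hx, h]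
  refine hle.trans ?_
  have : 2 * s * S.card ≤ 8 * s + p + (s + 24) * p := by
    calc _ ≤ _ := hcard
      _ ≤ _ := by
        have : (p - 3) / 2 ≤ p := by omega
        nlinarith
  zify at this hs2 hs1 hs3
  have hs4 : (p : ℤ) * 25 ≤ 32 * s * s := by nlinarith
  have : (s : ℤ) * (2 * (S.card : ℤ) - p) ≤ s * (40 * s) := by nlinarith
  exact le_of_mul_le_mul_left this (by omega)

theorem abs_sum_quadraticChar_le {f : F[X]} (hdeg : f.natDegree ≤ 4)
    (hsq : ∀ (c : F) (h : F[X]), f ≠ C c * h ^ 2) :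
    |(∑ x : F, (quadraticChar F (f.eval x) : ℝ))| ≤ 40 * √p := by
  classical
  rcases lt_or_ge p 121 with hlt | hge
  · calc |(∑ x : F, (quadraticChar F (f.eval x) : ℝ))|
        ≤ ∑ x : F, |(quadraticChar F (f.eval x) : ℝ)| := Finset.abs_sum_le_sum_abs _ _
      _ ≤ ∑ x : F, 1 := by
        refine Finset.sum_le_sum fun x _ => ?_
        by_cases hx : f.eval x = 0
        · simp [hx]
        · rcases quadraticChar_dichotomy hx with h | h <;> simp [h]
      _ = p := by simp [ZMod.card]
      _ = √p * √p := by simp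
      _ ≤ 40 * √p := by
        gcongr
        rw [Real.sqrt_le_left (by norm_num)]
        have : (p : ℝ) ≤ 121 := by exact_mod_cast hlt.le
        norm_num; linarith
  · have hf0 : f ≠ 0 := by simpa using hsq 0 0
    obtain ⟨t, ht⟩ : ∃ t, f.eval t ≠ 0 := by
      by_contra! h
      have := Polynomial.card_le_degree_of_subset_roots (p := f) (Z := Finset.univ)
        (fun x _ => by simp [hf0, h x])
      rw [Finset.card_univ, ZMod.card] at this
      omega
    set g := f.comp (X + C t) with hg
    have hsum : ∑ x : F, quadraticChar F (f.eval x) = ∑ x : F, quadraticChar F (g.eval x) := by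
      rw [← Equiv.sum_comp (Equiv.addRight t)]
      simp [hg]
    have key : ∀ σ : ℤ, (σ = 1 ∨ σ = -1) →
        σ * ∑ x : F, quadraticChar F (g.eval x) ≤ 40 * Nat.sqrt p := by
      intro σ hσ
      refine sum_quadraticChar_aux hge ?_ ?_ ?_ hσ
      · rw [hg, natDegree_comp]; simpa
      · simpa [hg]
      · intro c h hgc
        apply hsq c (h.comp (X - C t))
        have := congrArg (fun u => u.comp (X - C t)) hgc
        simpa [hg, comp_assoc] using this
    have h1 := key 1 (Or.inl rfl)
    have h2 := key (-1) (Or.inr rfl)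
    rw [← hsum] at h1 h2
    have h3 : (Nat.sqrt p : ℝ) ≤ √p := Real.nat_sqrt_le_real_sqrt
    have h1' : ((1 * ∑ x : F, quadraticChar F (f.eval x) : ℤ) : ℝ) ≤ ((40 * Nat.sqrt p : ℤ) : ℝ) := by
      exact_mod_cast h1
    have h2' : ((-1 * ∑ x : F, quadraticChar F (f.eval x) : ℤ) : ℝ) ≤ ((40 * Nat.sqrt p : ℤ) : ℝ) := by
      exact_mod_cast h2
    push_cast at h1' h2'
    rw [abs_le]
    constructor <;> linarith

end QuadraticCharSum

open Polynomial

section RationalCount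

variable {p : ℕ} [hp : Fact p.Prime]

local notation "F" => ZMod p
local notation "U" => (ZMod p)ˣ

/-- The number of solutions in nonzero `x, y` of `x + y = s`, `a / x + b / y = w`. -/
noncomputable def pairCount (a b : U) (s w : F) : ℕ := by
  classical exact
  (Finset.univ.filter fun z : U × U => (z.1 : F) + z.2 = s ∧
    (a : F) / (z.1 : F) + (b : F) / (z.2 : F) = w).card

/-- The discriminant of `v x² + (b - a - v) x + a` as a polynomial in `v`. -/
noncomputable def discPoly (a b : U) : F[X] := (X - C ((a : F) + b)) ^ 2 - C (4 * (a : F) * b)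

lemma pairCount_scale (a b s : U) (w : F) : pairCount a b s w = pairCount a b 1 (s * w) := by
  classical
  unfold pairCount
  refine Finset.card_bij' (fun z _ => (s⁻¹ * z.1, s⁻¹ * z.2)) (fun z _ => (s * z.1, s * z.2))
    ?_ ?_ ?_ ?_
  · intro z hz
    simp only [Finset.mem_filter, Finset.mem_univ, true_and] at hz ⊢
    obtain ⟨h1, h2⟩ := hz
    have hs := s.ne_zero
    have hz1 := z.1.ne_zero
    have hz2 := z.2.ne_zero
    rw [← h2]
    simp only [Units.val_mul, Units.val_inv_eq_inv_val]
    constructor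
    · rw [← mul_add, h1, inv_mul_cancel₀ hs]
    · field_simp
  · intro z hz
    simp only [Finset.mem_filter, Finset.mem_univ, true_and] at hz ⊢
    obtain ⟨h1, h2⟩ := hz
    have hs := s.ne_zero
    have hz1 := z.1.ne_zero
    have hz2 := z.2.ne_zero
    simp only [Units.val_mul]
    constructor
    · rw [← mul_add, h1, mul_one]
    · apply mul_left_cancel₀ hs
      rw [← h2]
      field_simp
  · intro z _; simp
  · intro z _; simp

lemma pairCount_one_zero_le (a b : U) : pairCount a b 1 0 ≤ 1 := by
  classical
  unfold pairCount
  rw [Finset.card_le_one]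
  rintro ⟨x, y⟩ hz ⟨x', y'⟩ hz'
  simp only [Finset.mem_filter, Finset.mem_univ, true_and] at hz hz'
  have key : ∀ x y : U, (x : F) + y = 1 → (a : F) / (x : F) + (b : F) / (y : F) = 0 →
      (x : F) * (a - b) = a ∧ (y : F) = 1 - x := by
    intro x y h1 h2
    have hy : (y : F) = 1 - x := by rw [← h1]; ring
    refine ⟨?_, hy⟩
    have hx0 := x.ne_zero
    have hy0 := y.ne_zero
    field_simp at h2
    rw [hy] at h2
    linear_combination -h2
  obtain ⟨h1, h2⟩ := key x y hz.1 hz.2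
  obtain ⟨h1', h2'⟩ := key x' y' hz'.1 hz'.2
  have hab : (a : F) - b ≠ 0 := by
    intro h; rw [h, mul_zero] at h1; exact a.ne_zero h1.symm
  have hx : (x : F) = x' := mul_right_cancel₀ hab (h1.trans h1'.symm)
  have hy : (y : F) = y' := by rw [h2, h2', hx]
  exact Prod.ext (Units.ext hx) (Units.ext hy)

lemma two_ne_zero_zmod (h2 : p ≠ 2) : (2 : F) ≠ 0 := by
  intro h
  have : (p : ℕ) ∣ 2 := (ZMod.natCast_eq_zero_iff 2 p).1 (by exact_mod_cast h)
  exact h2 ((Nat.prime_dvd_prime_iff_eq hp.out Nat.prime_two).1 this)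

lemma pairCount_one (h2 : p ≠ 2) (a b : U) {v : F} (hv : v ≠ 0) :
    (pairCount a b 1 v : ℤ) = quadraticChar F ((discPoly a b).eval v) + 1 := by
  classical
  have h1 : ringChar F ≠ 2 := by rwa [ZMod.ringChar_zmod_n]
  rw [← quadraticChar_card_sqrts h1]
  unfold pairCount
  refine congrArg _ ?_
  have h20 := two_ne_zero_zmod h2
  have hΔ : (discPoly a b).eval v = (v + a - b) ^ 2 - 4 * a * v := by
    simp [discPoly]; ring
  rw [hΔ]
  have ha := a.ne_zero
  have hb := b.ne_zero
  have key : ∀ y : F, y ^ 2 = (v + a - b) ^ 2 - 4 * a * v →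
      (y + v + a - b) / (2 * v) ≠ 0 ∧ 1 - (y + v + a - b) / (2 * v) ≠ 0 := by
    intro y hy
    constructor
    · intro h
      rw [div_eq_zero_iff] at h
      have h := h.resolve_right (mul_ne_zero h20 hv)
      have : y = -(v + a - b) := by linear_combination h
      rw [this] at hy
      have : (2 : F) * 2 * a * v = 0 := by linear_combination hy
      simp [h20, hv] at this
    · intro h
      field_simp at h
      have : y = v - a + b := by linear_combination -h
      rw [this] at hy
      have : (2 : F) * 2 * b * v = 0 := by linear_combination hy
      simp [h20, hv] at this
  refine Finset.card_bij' (fun z _ => 2 * v * z.1 - (v + a - b))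
    (fun y hy => (Units.mk0 _ (key y (by simpa using hy)).1, Units.mk0 _ (key y (by simpa using hy)).2))
    ?_ ?_ ?_ ?_
  · rintro ⟨x, y⟩ hz
    simp only [Finset.mem_filter, Finset.mem_univ, true_and, Set.mem_toFinset, Set.mem_ofPred_eq]
      at hz ⊢
    obtain ⟨h3, h4⟩ := hz
    have hx := x.ne_zero
    have hy := y.ne_zero
    field_simp at h4
    have hy' : (y : F) = 1 - x := by rw [← h3]; ring
    rw [hy'] at h4
    linear_combination (4 * v) * h4
  · intro y hy
    have hy' := hy
    simp only [Finset.mem_filter, Finset.mem_univ, true_and, Set.mem_toFinset, Set.mem_ofPred_eq]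
      at hy' ⊢
    obtain ⟨k1, k2⟩ := key y hy'
    simp only [Units.val_mk0]
    constructor
    · ring
    · generalize hx : (y + v + a - b) / (2 * v) = x at k1 k2
      have : y = 2 * v * x - (v + a - b) := by rw [← hx]; field_simp; ring
      rw [this] at hy'
      field_simp
      have h8 : (2 * 2 * v) * (a * (1 - x) + b * x) = (2 * 2 * v) * (v * x * (1 - x)) := by
        linear_combination hy'
      have := mul_left_cancel₀ (mul_ne_zero (mul_ne_zero h20 h20) hv) h8
      linear_combination this
  · rintro ⟨x, y⟩ hz
    simp only [Finset.mem_filter, Finset.mem_univ, true_and] at hz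
    have hy' : (y : F) = 1 - x := by rw [← hz.1]; ring
    have e : (2 * v * (x : F) - (v + a - b) + v + a - b) / (2 * v) = x := by field_simp; ring
    apply Prod.ext <;> apply Units.ext <;> simp only [Units.val_mk0, e, hy']
  · intro y hy
    simp only [Units.val_mk0]
    field_simp
    ring

lemma discPoly_monic (a b : U) : (discPoly a b).Monic := by
  unfold discPoly; monicity!

lemma discPoly_natDegree (a b : U) : (discPoly a b).natDegree = 2 := by
  unfold discPoly; compute_degree!

lemma discPoly_squarefree (h2 : p ≠ 2) (a b : U) : Squarefree (discPoly a b) := by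
  apply Separable.squarefree
  have h20 := two_ne_zero_zmod h2
  set w : F := 4 * (a : F) * b with hw
  have hw0 : w ≠ 0 := by
    rw [hw, show (4 : F) = 2 * 2 by norm_num]
    exact mul_ne_zero (mul_ne_zero (mul_ne_zero h20 h20) a.ne_zero) b.ne_zero
  refine ⟨-C w⁻¹, C (w⁻¹ * 2⁻¹) * (X - C ((a : F) + b)), ?_⟩
  have hd : derivative (discPoly a b) = C 2 * (X - C ((a : F) + b)) := by
    unfold discPoly; simp [derivative_pow]
  rw [hd]
  unfold discPoly
  rw [← hw]
  have h5 : C (w⁻¹) * C w = 1 := by rw [← C_mul, inv_mul_cancel₀ hw0, C_1]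
  have h6 : C ((2 : F)⁻¹) * C 2 = 1 := by rw [← C_mul, inv_mul_cancel₀ h20, C_1]
  rw [C_mul (a := w⁻¹)]
  linear_combination h5 + C w⁻¹ * (X - C ((a : F) + b)) ^ 2 * h6

lemma ne_C_mul_sq_of_squarefree {f g : F[X]} (hf : f.Monic) (hg : g.Monic)
    (hsf : Squarefree f) (hdg : g.natDegree ≤ f.natDegree) (hne : f ≠ g)
    (c : F) (h : F[X]) : f * g ≠ C c * h ^ 2 := by
  intro heq
  have hfg : f * g ≠ 0 := mul_ne_zero hf.ne_zero hg.ne_zero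
  have hc : c ≠ 0 := by rintro rfl; simp [hf.ne_zero, hg.ne_zero] at heq
  have hdvd : f ∣ h ^ 2 := by
    have : f ∣ C c * h ^ 2 := ⟨g, heq.symm⟩
    exact (IsUnit.dvd_mul_left (isUnit_C.2 hc.isUnit)).1 this
  obtain ⟨k, rfl⟩ := (hsf.dvd_pow_iff_dvd two_ne_zero).1 hdvd
  have hk : g = C c * k ^ 2 * f := by
    apply mul_left_cancel₀ hf.ne_zero
    rw [heq]; ring
  have hk0 : C c * k ^ 2 ≠ 0 := by intro h0; rw [h0, zero_mul] at hk; exact hg.ne_zero hk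
  have hdeg : (C c * k ^ 2).natDegree = 0 := by
    have := congrArg natDegree hk
    rw [natDegree_mul hk0 hf.ne_zero] at this
    omega
  rw [natDegree_eq_zero] at hdeg
  obtain ⟨d, hd⟩ := hdeg
  rw [← hd] at hk
  have h1 := congrArg leadingCoeff hk
  rw [leadingCoeff_mul, leadingCoeff_C, hf.leadingCoeff, hg.leadingCoeff, mul_one] at h1
  rw [← h1, C_1, one_mul] at hk
  exact hne hk.symm

lemma discPoly_injective {a b c d : U} (h2 : p ≠ 2) (h : discPoly a b = discPoly c d) :
    (a = c ∧ b = d) ∨ (a = d ∧ b = c) := by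
  have h20 := two_ne_zero_zmod h2
  have e0 := congrArg (eval 0) h
  have e1 := congrArg (eval 1) h
  simp only [discPoly, eval_sub, eval_pow, eval_X, eval_C] at e0 e1
  have hs : (a : F) + b = c + d := by
    apply mul_left_cancel₀ h20
    linear_combination e0 - e1
  have hp' : (a : F) * b = c * d := by
    apply mul_left_cancel₀ (mul_ne_zero h20 h20)
    linear_combination (a + b + c + d : F) * hs - e0
  have : ((a : F) - c) * (a - d) = 0 := by linear_combination (a : F) * hs - hp'
  rcases mul_eq_zero.1 this with h3 | h3
  · have : (a : F) = c := sub_eq_zero.1 h3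
    refine Or.inl ⟨Units.ext this, Units.ext ?_⟩
    linear_combination hs - this
  · have : (a : F) = d := sub_eq_zero.1 h3
    refine Or.inr ⟨Units.ext this, Units.ext ?_⟩
    linear_combination hs - this

end RationalCount

open Polynomial

section QuadrupleCount

variable {p : ℕ} [hp : Fact p.Prime]

local notation "F" => ZMod p
local notation "U" => (ZMod p)ˣ

lemma pairCount_one_le (h2 : p ≠ 2) (a b : U) (v : F) : pairCount a b 1 v ≤ 2 := by
  by_cases hv : v = 0
  · rw [hv]; exact (pairCount_one_zero_le a b).trans (by norm_num)
  · have h := pairCount_one h2 a b hv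
    by_cases h0 : (discPoly a b).eval v = 0
    · rw [h0] at h; simp at h; omega
    · rcases quadraticChar_dichotomy h0 with h' | h' <;> rw [h'] at h <;> omega

lemma sum_pairCount_zero_le (a b : U) : ∑ w : F, pairCount a b 0 w ≤ p := by
  classical
  calc ∑ w : F, pairCount a b 0 w
      = (Finset.univ.filter fun z : U × U => (z.1 : F) + z.2 = 0).card := by
        rw [Finset.card_eq_sum_card_fiberwise (f := fun z : U × U => (a : F) / (z.1 : F) + b / z.2)
          (t := Finset.univ) (fun _ _ => Finset.mem_univ _)]
        simp only [pairCount, Finset.filter_filter]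
    _ ≤ (Finset.univ : Finset F).card := by
        refine Finset.card_le_card_of_injOn (fun z => (z.1 : F)) (fun _ _ => Finset.mem_univ _) ?_
        rintro ⟨x, y⟩ hz ⟨x', y'⟩ hz' h
        simp only [Finset.coe_filter, Finset.mem_univ, true_and, Set.mem_ofPred_eq] at hz hz' h
        refine Prod.ext (Units.ext h) (Units.ext ?_)
        change (y : F) = y'
        linear_combination hz - hz' - h
    _ = p := by simp [ZMod.card]

lemma pairCount_zero_le_one {a b : U} (hab : a ≠ b) (w : F) : pairCount a b 0 w ≤ 1 := by
  classical
  unfold pairCount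
  rw [Finset.card_le_one]
  rintro ⟨x, y⟩ hz ⟨x', y'⟩ hz'
  simp only [Finset.mem_filter, Finset.mem_univ, true_and] at hz hz'
  have key : ∀ x y : U, (x : F) + y = 0 → (a : F) / (x : F) + b / y = w →
      (a : F) - b = w * x ∧ (y : F) = -x := by
    intro x y h1 h2
    have hy : (y : F) = -x := by linear_combination h1
    refine ⟨?_, hy⟩
    have hx := x.ne_zero
    rw [hy] at h2
    rw [← h2]; field_simp; ring
  obtain ⟨h1, h2⟩ := key x y hz.1 hz.2
  obtain ⟨h1', h2'⟩ := key x' y' hz'.1 hz'.2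
  have hw : w ≠ 0 := by
    rintro rfl
    rw [zero_mul] at h1
    exact hab (Units.ext (sub_eq_zero.1 h1))
  have hx : (x : F) = x' := mul_left_cancel₀ hw (h1.symm.trans h1')
  exact Prod.ext (Units.ext hx) (Units.ext (by change (y : F) = y'; rw [h2, h2', hx]))

/-- The number of nonzero solutions of `x₁ + x₂ = x₃ + x₄`, `a/x₁ + b/x₂ = c/x₃ + d/x₄`. -/
noncomputable def quadCount (a b c d : U) : ℕ := ∑ s : F, ∑ w : F, pairCount a b s w * pairCount c d s w

lemma quadCount_eq (a b c d : U) : quadCount a b c d =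
    ∑ w : F, pairCount a b 0 w * pairCount c d 0 w +
      (p - 1) * ∑ v : F, pairCount a b 1 v * pairCount c d 1 v := by
  classical
  unfold quadCount
  rw [← Finset.add_sum_erase _ _ (Finset.mem_univ (0 : F))]
  congr 1
  have : ∀ s ∈ Finset.univ.erase (0 : F), ∑ w : F, pairCount a b s w * pairCount c d s w
      = ∑ v : F, pairCount a b 1 v * pairCount c d 1 v := by
    intro s hs
    have hs0 : s ≠ 0 := Finset.ne_of_mem_erase hs
    rw [← Equiv.sum_comp (Equiv.mulLeft₀ s hs0) fun v => pairCount a b 1 v * pairCount c d 1 v]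
    refine Finset.sum_congr rfl fun w _ => ?_
    have h1 := pairCount_scale a b (Units.mk0 s hs0) w
    have h2 := pairCount_scale c d (Units.mk0 s hs0) w
    simp only [Units.val_mk0] at h1 h2
    simp [h1, h2]
  rw [Finset.sum_congr rfl this, Finset.sum_const, Finset.card_erase_of_mem (Finset.mem_univ _),
    Finset.card_univ, ZMod.card, smul_eq_mul]

lemma sum_pairCount_mul_le (h2 : p ≠ 2) (a b c d : U) :
    ∑ v : F, pairCount a b 1 v * pairCount c d 1 v ≤ 4 * p := by
  calc _ ≤ ∑ v : F, 2 * 2 := Finset.sum_le_sum fun v _ =>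
        Nat.mul_le_mul (pairCount_one_le h2 a b v) (pairCount_one_le h2 c d v)
    _ = 4 * p := by simp [ZMod.card, mul_comm]

lemma quadCount_le (h2 : p ≠ 2) (a b c d : U) : quadCount a b c d ≤ 5 * p ^ 2 := by
  rw [quadCount_eq]
  have h3 : ∑ w : F, pairCount a b 0 w * pairCount c d 0 w ≤ p ^ 2 := by
    calc _ ≤ ∑ w : F, p * pairCount c d 0 w := Finset.sum_le_sum fun w _ =>
          Nat.mul_le_mul_right _ ((Finset.single_le_sum (f := fun w => pairCount a b 0 w)
            (fun _ _ => Nat.zero_le _) (Finset.mem_univ w)).trans (sum_pairCount_zero_le a b))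
      _ = p * ∑ w : F, pairCount c d 0 w := by rw [Finset.mul_sum]
      _ ≤ p * p := Nat.mul_le_mul_left _ (sum_pairCount_zero_le c d)
      _ = p ^ 2 := by ring
  have h4 := sum_pairCount_mul_le h2 a b c d
  have h5 : (p - 1) * ∑ v : F, pairCount a b 1 v * pairCount c d 1 v ≤ p * (4 * p) :=
    Nat.mul_le_mul (by omega) h4
  nlinarith

lemma abs_sum_pairCount_sub_le (h2 : p ≠ 2) {a b c d : U} (h : discPoly a b ≠ discPoly c d) :
    |((∑ v : F, pairCount a b 1 v * pairCount c d 1 v : ℕ) : ℝ) - p| ≤ 120 * √p + 4 := by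
  classical
  set X : F → ℝ := fun v => quadraticChar F ((discPoly a b).eval v)
  set Y : F → ℝ := fun v => quadraticChar F ((discPoly c d).eval v)
  have hX : |∑ v, X v| ≤ 40 * √p := by
    refine abs_sum_quadraticChar_le (by rw [discPoly_natDegree]; norm_num) fun e k => ?_
    have := ne_C_mul_sq_of_squarefree (discPoly_monic a b) monic_one (discPoly_squarefree h2 a b)
      (by simp) (by intro h; have := congrArg natDegree h; rw [discPoly_natDegree] at this; simp at this)
      e k
    rwa [mul_one] at this
  have hY : |∑ v, Y v| ≤ 40 * √p := by
    refine abs_sum_quadraticChar_le (by rw [discPoly_natDegree]; norm_num) fun e k => ?_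
    have := ne_C_mul_sq_of_squarefree (discPoly_monic c d) monic_one (discPoly_squarefree h2 c d)
      (by simp) (by intro h; have := congrArg natDegree h; rw [discPoly_natDegree] at this; simp at this)
      e k
    rwa [mul_one] at this
  have hXY : |∑ v, X v * Y v| ≤ 40 * √p := by
    have := abs_sum_quadraticChar_le (p := p) (f := discPoly a b * discPoly c d)
      (natDegree_mul_le.trans (by rw [discPoly_natDegree, discPoly_natDegree])) fun e k =>
      ne_C_mul_sq_of_squarefree (discPoly_monic a b) (discPoly_monic c d) (discPoly_squarefree h2 a b)
      (by rw [discPoly_natDegree, discPoly_natDegree]) h e k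
    simpa only [eval_mul, map_mul, Int.cast_mul] using this
  have hb : ∀ z : F, |((quadraticChar F z : ℤ) : ℝ)| ≤ 1 := by
    intro z
    by_cases hz : z = 0
    · simp [hz]
    · rcases quadraticChar_dichotomy hz with h | h <;> simp [h]
  have hsum : ((∑ v : F, pairCount a b 1 v * pairCount c d 1 v : ℕ) : ℝ) =
      ∑ v, (1 + X v) * (1 + Y v) +
        (pairCount a b 1 0 * pairCount c d 1 0 - (1 + X 0) * (1 + Y 0)) := by
    push_cast
    rw [← Finset.add_sum_erase _ _ (Finset.mem_univ (0 : F)),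
      ← Finset.add_sum_erase _ (fun v => (1 + X v) * (1 + Y v)) (Finset.mem_univ (0 : F))]
    have : ∑ v ∈ Finset.univ.erase (0 : F), (pairCount a b 1 v : ℝ) * pairCount c d 1 v
        = ∑ v ∈ Finset.univ.erase (0 : F), (1 + X v) * (1 + Y v) := by
      refine Finset.sum_congr rfl fun v hv => ?_
      have hv0 := Finset.ne_of_mem_erase hv
      have h3 : (pairCount a b 1 v : ℝ) = X v + 1 := by
        have h5 := congrArg (Int.cast : ℤ → ℝ) (pairCount_one h2 a b hv0)
        push_cast at h5
        exact h5
      have h4 : (pairCount c d 1 v : ℝ) = Y v + 1 := by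
        have h5 := congrArg (Int.cast : ℤ → ℝ) (pairCount_one h2 c d hv0)
        push_cast at h5
        exact h5
      rw [h3, h4]; ring
    rw [this]; ring
  have hexp : ∑ v, (1 + X v) * (1 + Y v) = p + ∑ v, X v + ∑ v, Y v + ∑ v, X v * Y v := by
    have : ∀ v, (1 + X v) * (1 + Y v) = 1 + X v + Y v + X v * Y v := fun v => by ring
    simp only [this, Finset.sum_add_distrib]
    simp [ZMod.card]
  have hX0 := abs_le.1 (hb ((discPoly a b).eval 0))
  have hY0 := abs_le.1 (hb ((discPoly c d).eval 0))
  change -1 ≤ X 0 ∧ X 0 ≤ 1 at hX0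
  change -1 ≤ Y 0 ∧ Y 0 ≤ 1 at hY0
  have hn1 : (pairCount a b 1 0 : ℝ) ≤ 1 := by exact_mod_cast pairCount_one_zero_le a b
  have hn2 : (pairCount c d 1 0 : ℝ) ≤ 1 := by exact_mod_cast pairCount_one_zero_le c d
  have hn1' : (0 : ℝ) ≤ pairCount a b 1 0 := Nat.cast_nonneg _
  have hn2' : (0 : ℝ) ≤ pairCount c d 1 0 := Nat.cast_nonneg _
  have hm1 : (pairCount a b 1 0 : ℝ) * pairCount c d 1 0 ≤ 4 := by nlinarith
  have hm2 : 0 ≤ (1 + X 0) * (1 + Y 0) := mul_nonneg (by linarith) (by linarith)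
  have hm3 : (1 + X 0) * (1 + Y 0) ≤ 4 := by nlinarith
  have hm4 : 0 ≤ (pairCount a b 1 0 : ℝ) * pairCount c d 1 0 := by positivity
  rw [hsum, hexp]
  rw [abs_le] at hX hY hXY ⊢
  constructor <;> linarith

lemma sum_pairCount_zero_mul_le {a b c d : U} (h : ¬(a = b ∧ c = d)) :
    ∑ w : F, pairCount a b 0 w * pairCount c d 0 w ≤ p := by
  rw [not_and_or] at h
  rcases h with h | h
  · calc _ ≤ ∑ w : F, 1 * pairCount c d 0 w := Finset.sum_le_sum fun w _ =>
          Nat.mul_le_mul_right _ (pairCount_zero_le_one h w)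
      _ ≤ p := by simpa using sum_pairCount_zero_le c d
  · calc _ ≤ ∑ w : F, pairCount a b 0 w * 1 := Finset.sum_le_sum fun w _ =>
          Nat.mul_le_mul_left _ (pairCount_zero_le_one h w)
      _ ≤ p := by simpa using sum_pairCount_zero_le a b

lemma abs_quadCount_sub_le (h2 : p ≠ 2) {a b c d : U} (h : ¬(a = b ∧ c = d))
    (h' : ¬(a = c ∧ b = d)) (h'' : ¬(a = d ∧ b = c)) :
    |(quadCount a b c d : ℝ) - (p - 1) * p| ≤ (p - 1) * (126 * √p) := by
  have h3 := abs_sum_pairCount_sub_le h2 (a := a) (b := b) (c := c) (d := d)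
    (fun he => by rcases discPoly_injective h2 he with h | h <;> tauto)
  have h4 : ((∑ w : F, pairCount a b 0 w * pairCount c d 0 w : ℕ) : ℝ) ≤ p := by
    exact_mod_cast sum_pairCount_zero_mul_le h
  have h5 : (0 : ℝ) ≤ ((∑ w : F, pairCount a b 0 w * pairCount c d 0 w : ℕ) : ℝ) := Nat.cast_nonneg _
  have hp2 : (2 : ℝ) ≤ p := by exact_mod_cast hp.out.two_le
  have hs : 1 ≤ √(p : ℝ) := by rw [Real.one_le_sqrt]; linarith
  rw [quadCount_eq]
  set Z := ((∑ w : F, pairCount a b 0 w * pairCount c d 0 w : ℕ) : ℝ)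
  set T := ((∑ v : F, pairCount a b 1 v * pairCount c d 1 v : ℕ) : ℝ)
  rw [Nat.cast_add, Nat.cast_mul, Nat.cast_sub hp.out.one_le, Nat.cast_one]
  rw [abs_le] at h3 ⊢
  have h6 : (p : ℝ) ≤ (p - 1) * 2 := by linarith
  constructor <;> nlinarith [h3.1, h3.2]

end QuadrupleCount

open Polynomial

section KloostermanMoment

variable {p : ℕ} [hp : Fact p.Prime]

local notation "F" => ZMod p
local notation "U" => (ZMod p)ˣ

local notation "ψ" => ZMod.stdAddChar (N := p)

/-- The Kloosterman sum `∑ e((x + u/x)/p)` over nonzero `x` modulo `p`. -/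
noncomputable def kloosterman (p : ℕ) [Fact p.Prime] (u : ZMod p) : ℂ := ∑ x : (ZMod p)ˣ, ZMod.stdAddChar ((x : ZMod p) + u / (x : ZMod p))

lemma sum_units_add_zero (f : F → ℂ) : ∑ t : U, f t + f 0 = ∑ t : F, f t := by
  classical
  rw [← Finset.sum_erase_add _ _ (Finset.mem_univ (0 : F))]
  congr 1
  refine Finset.sum_bij (fun t _ => (t : F)) (fun t _ => by simp) (fun t _ t' _ h => Units.ext h)
    (fun t ht => ⟨Units.mk0 t (Finset.ne_of_mem_erase ht), Finset.mem_univ _, rfl⟩) (fun _ _ => rfl)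

lemma sum_units_stdAddChar (A : F) :
    ∑ t : U, (ψ ((t : F) * A) : ℂ) = (p : ℂ) * (if A = 0 then 1 else 0) - 1 := by
  have h := sum_units_add_zero (p := p) fun t => ψ (t * A)
  rw [AddChar.sum_mulShift A (ZMod.isPrimitive_stdAddChar p)] at h
  simp only [zero_mul, AddChar.map_zero_eq_one, ZMod.card] at h
  rw [eq_sub_iff_add_eq, h]
  split_ifs <;> simp

lemma sum_units_stdAddChar_ne {A : F} (hA : A ≠ 0) :
    ∑ t : U, (ψ ((t : F) * A) : ℂ) = -1 := by
  rw [sum_units_stdAddChar]; simp [hA]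

lemma sum_units_stdAddChar_div (a : F) (ha : a ≠ 0) :
    ∑ t : U, (ψ (a / (t : F)) : ℂ) = -1 := by
  rw [← sum_units_stdAddChar_ne ha, ← Equiv.sum_comp (Equiv.inv U)]
  refine Finset.sum_congr rfl fun t _ => ?_
  rw [Equiv.inv_apply, Units.val_inv_eq_inv_val, div_inv_eq_mul, mul_comm]

lemma kloosterman_scale (a : F) (t s : U) : kloosterman p (a * (t * s)) =
    ∑ x : U, ψ ((t : F) * x + s * (a / x)) := by
  unfold kloosterman
  rw [← Equiv.sum_comp (Equiv.mulLeft t)]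
  refine Finset.sum_congr rfl fun x _ => ?_
  have ht := t.ne_zero
  have hx := x.ne_zero
  congr 1
  simp only [Equiv.coe_mulLeft, Units.val_mul]
  field_simp

lemma kloosterman_scale_neg (a : F) (t s : U) : kloosterman p (a * (t * s)) =
    ∑ x : U, ψ ((t : F) * -x + s * -(a / x)) := by
  rw [kloosterman_scale, ← Equiv.sum_comp (Equiv.neg U)]
  refine Finset.sum_congr rfl fun x _ => ?_
  congr 1
  simp [div_neg]

lemma sum_four_mul (f₁ f₂ f₃ f₄ : U → ℂ) :
    (∑ x, f₁ x) * (∑ x, f₂ x) * ((∑ x, f₃ x) * (∑ x, f₄ x)) =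
      ∑ z : (U × U) × (U × U), f₁ z.1.1 * f₂ z.1.2 * (f₃ z.2.1 * f₄ z.2.2) := by
  rw [Finset.sum_mul_sum, Finset.sum_mul_sum, ← Fintype.sum_prod_type', ← Fintype.sum_prod_type',
    Finset.sum_mul_sum, ← Fintype.sum_prod_type']

lemma quadCount_eq_sum (a b c d : U) : (quadCount a b c d : ℂ) =
    ∑ z : (U × U) × (U × U),
      (if (z.1.1 : F) + z.1.2 - z.2.1 - z.2.2 = 0 then 1 else 0) *
      (if (a : F) / z.1.1 + b / z.1.2 - c / z.2.1 - d / z.2.2 = 0 then 1 else 0) := by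
  classical
  have h1 : ∀ z : (U × U) × (U × U),
      (if (z.1.1 : F) + z.1.2 - z.2.1 - z.2.2 = 0 then (1 : ℂ) else 0) *
      (if (a : F) / z.1.1 + b / z.1.2 - c / z.2.1 - d / z.2.2 = 0 then 1 else 0) =
      ∑ s : F, ∑ w : F,
        (if (z.1.1 : F) + z.1.2 = s ∧ (a : F) / (z.1.1 : F) + b / z.1.2 = w then 1 else 0) *
        (if (z.2.1 : F) + z.2.2 = s ∧ (c : F) / (z.2.1 : F) + d / z.2.2 = w then 1 else 0) := by
    intro z
    rw [Finset.sum_eq_single ((z.1.1 : F) + z.1.2), Finset.sum_eq_single ((a : F) / (z.1.1 : F) + b / z.1.2)]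
    · simp only [true_and, if_true, sub_sub, sub_eq_zero, ← ite_and, mul_ite, mul_one,
        mul_zero]
      congr 1
      rw [eq_iff_iff]
      constructor <;> rintro ⟨h, h'⟩ <;> constructor <;> first | exact h.symm | exact h'.symm
    · intro w _ hw
      rw [if_neg (fun h => hw h.2.symm), zero_mul]
    · simp
    · intro s _ hs
      refine Finset.sum_eq_zero fun w _ => ?_
      rw [if_neg (fun h => hs h.1.symm), zero_mul]
    · simp
  simp only [h1]
  rw [Finset.sum_comm]
  unfold quadCount
  push_cast
  refine Finset.sum_congr rfl fun s _ => ?_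
  rw [Finset.sum_comm]
  refine Finset.sum_congr rfl fun w _ => ?_
  simp only [pairCount, Finset.card_filter, Nat.cast_sum, Nat.cast_ite, Nat.cast_one, Nat.cast_zero]
  rw [Finset.sum_mul_sum, ← Fintype.sum_prod_type']

lemma kloosterman_fourth_moment_eq (a b c d : U) :
    ((p : ℂ) - 1) * ∑ r : U, kloosterman p ((a : F) * r) * kloosterman p ((b : F) * r) *
      (kloosterman p ((c : F) * r) * kloosterman p ((d : F) * r)) =
    p ^ 2 * quadCount a b c d - (p - 1) ^ 4 - 2 * (p - 1) := by
  set P : U → ℂ := fun r => kloosterman p ((a : F) * r) * kloosterman p ((b : F) * r) *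
      (kloosterman p ((c : F) * r) * kloosterman p ((d : F) * r)) with hP
  set A : (U × U) × (U × U) → F := fun z => (z.1.1 : F) + z.1.2 - z.2.1 - z.2.2 with hA
  set B : (U × U) × (U × U) → F := fun z => (a : F) / z.1.1 + b / z.1.2 - c / z.2.1 - d / z.2.2 with hB
  have hcard : ((Fintype.card U : ℕ) : ℂ) = (p : ℂ) - 1 := by
    rw [ZMod.card_units, Nat.cast_sub hp.out.one_le, Nat.cast_one]
  have hts : ∀ t s : U, P (t * s) = ∑ z, ψ ((t : F) * A z) * ψ ((s : F) * B z) := by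
    intro t s
    simp only [hP, Units.val_mul]
    rw [kloosterman_scale a t s, kloosterman_scale b t s, kloosterman_scale_neg c t s,
      kloosterman_scale_neg d t s, sum_four_mul]
    refine Finset.sum_congr rfl fun z _ => ?_
    simp only [← AddChar.map_add_eq_mul, hA, hB]
    congr 1; ring
  have h1 : ((p : ℂ) - 1) * ∑ r : U, P r = ∑ t : U, ∑ s : U, P (t * s) := by
    have : ∀ t : U, ∑ s : U, P (t * s) = ∑ r : U, P r := fun t => Equiv.sum_comp (Equiv.mulLeft t) P
    simp only [this, Finset.sum_const, Finset.card_univ, nsmul_eq_mul, hcard]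
  have h2 : ∑ t : U, ∑ s : U, P (t * s) = ∑ z, (∑ t : U, ψ ((t : F) * A z)) *
      (∑ s : U, ψ ((s : F) * B z)) := by
    simp only [hts, Finset.sum_mul_sum]
    rw [Finset.sum_congr rfl fun t _ => Finset.sum_comm]
    rw [Finset.sum_comm]
  have hAsum : ∑ z, (∑ t : U, (ψ ((t : F) * A z) : ℂ)) = p - 1 := by
    rw [Finset.sum_comm]
    have : ∀ t : U, ∑ z, (ψ ((t : F) * A z) : ℂ) = 1 := by
      intro t
      have h3 := sum_four_mul (fun x : U => (ψ ((x : F) * t) : ℂ))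
        (fun x : U => (ψ ((x : F) * t) : ℂ)) (fun x : U => (ψ ((x : F) * -t) : ℂ))
        (fun x : U => (ψ ((x : F) * -t) : ℂ))
      have ht := t.ne_zero
      rw [sum_units_stdAddChar_ne ht, sum_units_stdAddChar_ne (neg_ne_zero.2 ht)] at h3
      rw [show (-1 : ℂ) * -1 * (-1 * -1) = 1 by norm_num] at h3
      rw [h3]
      refine Finset.sum_congr rfl fun z _ => ?_
      simp only [← AddChar.map_add_eq_mul, hA]
      congr 1; ring
    simp only [this, Finset.sum_const, Finset.card_univ, nsmul_eq_mul, hcard, mul_one]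
  have hBsum : ∑ z, (∑ t : U, (ψ ((t : F) * B z) : ℂ)) = p - 1 := by
    rw [Finset.sum_comm]
    have : ∀ t : U, ∑ z, (ψ ((t : F) * B z) : ℂ) = 1 := by
      intro t
      have h3 := sum_four_mul (fun x : U => (ψ ((t * a : F) / x) : ℂ))
        (fun x : U => (ψ ((t * b : F) / x) : ℂ)) (fun x : U => (ψ (-(t * c : F) / x) : ℂ))
        (fun x : U => (ψ (-(t * d : F) / x) : ℂ))
      have ht := t.ne_zero
      rw [sum_units_stdAddChar_div _ (mul_ne_zero ht a.ne_zero),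
        sum_units_stdAddChar_div _ (mul_ne_zero ht b.ne_zero),
        sum_units_stdAddChar_div _ (neg_ne_zero.2 (mul_ne_zero ht c.ne_zero)),
        sum_units_stdAddChar_div _ (neg_ne_zero.2 (mul_ne_zero ht d.ne_zero))] at h3
      rw [show (-1 : ℂ) * -1 * (-1 * -1) = 1 by norm_num] at h3
      rw [h3]
      refine Finset.sum_congr rfl fun z _ => ?_
      simp only [← AddChar.map_add_eq_mul, hB]
      congr 1; ring
    simp only [this, Finset.sum_const, Finset.card_univ, nsmul_eq_mul, hcard, mul_one]
  have hone : ∑ _z : (U × U) × (U × U), (1 : ℂ) = (p - 1) ^ 4 := by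
    simp only [Finset.sum_const, Finset.card_univ, Fintype.card_prod, nsmul_eq_mul, Nat.cast_mul, hcard]
    ring
  rw [h1, h2]
  have hq : (quadCount a b c d : ℂ) = ∑ z, (if A z = 0 then (1 : ℂ) else 0) * (if B z = 0 then 1 else 0) :=
    quadCount_eq_sum a b c d
  have hterm : ∀ z, (∑ t : U, (ψ ((t : F) * A z) : ℂ)) * (∑ s : U, ψ ((s : F) * B z))
      = p ^ 2 * ((if A z = 0 then (1 : ℂ) else 0) * (if B z = 0 then 1 else 0))
        - (∑ t : U, (ψ ((t : F) * A z) : ℂ)) - (∑ t : U, (ψ ((t : F) * B z) : ℂ)) - 1 := by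
    intro z
    simp only [sum_units_stdAddChar]
    ring
  rw [Finset.sum_congr rfl fun z _ => hterm z, Finset.sum_sub_distrib, Finset.sum_sub_distrib,
    Finset.sum_sub_distrib, ← Finset.mul_sum, ← hq, hAsum, hBsum, hone]
  ring

lemma kloosterman_fourth_moment_norm (a b c d : U) :
    ‖∑ r : U, kloosterman p ((a : F) * r) * kloosterman p ((b : F) * r) *
      (kloosterman p ((c : F) * r) * kloosterman p ((d : F) * r))‖ =
    |(p : ℝ) ^ 2 * quadCount a b c d - (p - 1) ^ 4 - 2 * (p - 1)| / (p - 1) := by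
  have hp2 : (2 : ℝ) ≤ p := by exact_mod_cast hp.out.two_le
  have h := congrArg norm (kloosterman_fourth_moment_eq a b c d)
  rw [norm_mul] at h
  have e1 : ‖(p : ℂ) - 1‖ = (p : ℝ) - 1 := by
    rw [show (p : ℂ) - 1 = (((p : ℝ) - 1 : ℝ) : ℂ) by push_cast; rfl, Complex.norm_real,
      Real.norm_of_nonneg (by linarith)]
  have e2 : ‖(p : ℂ) ^ 2 * quadCount a b c d - (p - 1) ^ 4 - 2 * (p - 1)‖ =
      |(p : ℝ) ^ 2 * quadCount a b c d - (p - 1) ^ 4 - 2 * (p - 1)| := by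
    rw [← Real.norm_eq_abs, ← Complex.norm_real]; push_cast; rfl
  rw [e1, e2] at h
  rw [eq_div_iff (by linarith), mul_comm]
  exact h

theorem kloosterman_fourth_moment_le (h2 : p ≠ 2) (a b c d : U) :
    ‖∑ r : U, kloosterman p ((a : F) * r) * kloosterman p ((b : F) * r) *
      (kloosterman p ((c : F) * r) * kloosterman p ((d : F) * r))‖ ≤ 200 * (p : ℝ) ^ 3 := by
  have hp2 : (2 : ℝ) ≤ p := by exact_mod_cast hp.out.two_le
  rw [kloosterman_fourth_moment_norm, div_le_iff₀ (by linarith)]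
  have h3 : (quadCount a b c d : ℝ) ≤ 5 * p ^ 2 := by exact_mod_cast quadCount_le h2 a b c d
  have h4 : (0 : ℝ) ≤ quadCount a b c d := Nat.cast_nonneg _
  set N : ℝ := ((quadCount a b c d : ℕ) : ℝ)
  obtain ⟨m, hm⟩ : ∃ m : ℝ, (p : ℝ) = m + 1 := ⟨p - 1, by ring⟩
  rw [hm] at hp2 h3 ⊢
  have hm1 : 1 ≤ m := by linarith
  have hN : (m + 1) ^ 2 * N ≤ (m + 1) ^ 2 * (5 * (m + 1) ^ 2) := by gcongr
  have hN0 : 0 ≤ (m + 1) ^ 2 * N := by positivity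
  have h7 : (m + 1) ^ 3 * (m + 1) ≤ (m + 1) ^ 3 * (2 * m) := by gcongr; linarith
  have h8 : (m + 1) ^ 3 * (m + 1) = (m + 1) ^ 2 * (m + 1) ^ 2 := by ring
  have h9 : m ^ 4 ≤ (m + 1) ^ 3 * m := by
    have : m ^ 3 ≤ (m + 1) ^ 3 := by gcongr; linarith
    nlinarith
  have h10 : 2 * m ≤ 2 * ((m + 1) ^ 3 * m) := by
    have : 1 ≤ (m + 1) ^ 3 := one_le_pow₀ (by linarith)
    nlinarith
  rw [show m + 1 - 1 = m by ring, abs_le]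
  constructor <;> nlinarith

theorem kloosterman_fourth_moment_generic_le (h2 : p ≠ 2) {a b c d : U} (h : ¬(a = b ∧ c = d))
    (h' : ¬(a = c ∧ b = d)) (h'' : ¬(a = d ∧ b = c)) :
    ‖∑ r : U, kloosterman p ((a : F) * r) * kloosterman p ((b : F) * r) *
      (kloosterman p ((c : F) * r) * kloosterman p ((d : F) * r))‖ ≤ 200 * ((p : ℝ) ^ 2 * √p) := by
  have hp2 : (2 : ℝ) ≤ p := by exact_mod_cast hp.out.two_le
  rw [kloosterman_fourth_moment_norm, div_le_iff₀ (by linarith)]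
  have h3 := abs_quadCount_sub_le h2 h h' h''
  set N : ℝ := ((quadCount a b c d : ℕ) : ℝ)
  have hs : 1 ≤ √(p : ℝ) := by rw [Real.one_le_sqrt]; linarith
  set t := √(p : ℝ)
  obtain ⟨m, hm⟩ : ∃ m : ℝ, (p : ℝ) = m + 1 := ⟨p - 1, by ring⟩
  rw [hm] at hp2 h3 ⊢
  have hm1 : 1 ≤ m := by linarith
  rw [show m + 1 - 1 = m by ring] at h3 ⊢
  have h5 : |(m + 1) ^ 2 * (N - m * (m + 1))| ≤ (m + 1) ^ 2 * (m * (126 * t)) := by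
    rw [abs_mul, abs_of_nonneg (by positivity : (0 : ℝ) ≤ (m + 1) ^ 2)]
    gcongr
  have h6 : (m + 1) ^ 2 * m ≤ (m + 1) ^ 2 * t * m := by
    have : 0 ≤ (m + 1) ^ 2 * m := by positivity
    nlinarith
  have h7 : m * (m + 1) ^ 3 - m ^ 4 = m * (3 * m ^ 2 + 3 * m + 1) := by ring
  have h8 : m * (3 * m ^ 2 + 3 * m + 1) ≤ 6 * ((m + 1) ^ 2 * m) := by nlinarith [mul_pos (by linarith : 0 < m) (by linarith : 0 < m)]
  have h9 : 0 ≤ m * (3 * m ^ 2 + 3 * m + 1) := by positivity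
  have h10 : 2 * m ≤ 2 * ((m + 1) ^ 2 * m) := by nlinarith [mul_pos (by linarith : 0 < m) (by linarith : 0 < m)]
  rw [abs_le] at h5 ⊢
  constructor <;> nlinarith [h5.1, h5.2]

end KloostermanMoment

section ThetaSeries

open HurwitzZeta Complex Filter Set

variable {q : ℕ} [hq : Fact q.Prime]

lemma hasSum_int_of_residues {f : ℤ → ℂ} {S : ZMod q → ℂ}
    (h : ∀ j : ZMod q, HasSum (fun m : ℤ => f (q * m + j.val)) (S j)) :
    HasSum f (∑ j, S j) := by
  classical
  have hq0 : (q : ℤ) ≠ 0 := by exact_mod_cast hq.out.ne_zero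
  have key : ∀ j ∈ (Finset.univ : Finset (ZMod q)),
      HasSum (fun n : ℤ => if (n : ZMod q) = j then f n else 0) (S j) := by
    intro j _
    have hinj : Function.Injective (fun m : ℤ => (q : ℤ) * m + (j.val : ℤ)) := by
      intro m m' hm
      exact mul_left_cancel₀ hq0 (add_right_cancel hm)
    rw [← hinj.hasSum_iff]
    · refine (h j).congr_fun ?_
      intro m
      simp
    · intro n hn
      rw [if_neg]
      rintro rfl
      apply hn
      refine ⟨n / q, ?_⟩
      simp only
      rw [ZMod.val_intCast, Int.mul_ediv_add_emod]
  refine (hasSum_sum key).congr_fun ?_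
  intro n
  simp

lemma hasSum_nat_of_even {f : ℤ → ℂ} {S : ℂ} (h : HasSum f S) (h0 : f 0 = 0)
    (heven : ∀ n, f (-n) = f n) : HasSum (fun n : ℕ => f n) (S / 2) := by
  have h1 := h.nat_add_neg
  rw [h0, add_zero] at h1
  refine (h1.div_const 2).congr_fun ?_
  intro n
  rw [heven]; ring

lemma sum_mul_stdAddChar_mul {χ : DirichletCharacter ℂ q} (hχ : χ ≠ 1) (n : ZMod q) :
    ∑ j, χ j * ZMod.stdAddChar (j * n) = χ⁻¹ n * gaussSum χ ZMod.stdAddChar := by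
  by_cases hn : n = 0
  · subst hn
    have : (∑ j : ZMod q, χ j) = 0 := MulChar.sum_eq_zero_of_ne_one hχ
    simp [this, MulChar.map_nonunit]
  · have h := gaussSum_mulShift χ (ZMod.stdAddChar (N := q)) (Units.mk0 n hn)
    have hn' : IsUnit n := isUnit_iff_ne_zero.mpr hn
    have h2 : χ⁻¹ n * χ n = 1 := by
      rw [← MulChar.mul_apply, inv_mul_cancel, MulChar.one_apply hn']
    rw [← h, ← mul_assoc, Units.val_mk0, h2, one_mul, gaussSum]
    refine Finset.sum_congr rfl fun j _ => ?_
    rw [AddChar.mulShift_apply, mul_comm n j]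

lemma exp_toAddCircle_eq (j : ZMod q) (n : ℤ) :
    cexp (2 * Real.pi * I * ((j.val : ℝ) / (q : ℝ) : ℝ) * n) = ZMod.stdAddChar (j * (n : ZMod q)) := by
  have : j * (n : ZMod q) = (((j.val : ℤ) * n : ℤ) : ZMod q) := by
    push_cast; simp
  rw [this, ZMod.stdAddChar_coe]
  congr 1
  push_cast
  ring

/-- The theta series `∑ χ(n) exp(-π n² t / q)` of an even character, written with the kernels of
the Hurwitz zeta functions. -/
noncomputable def thetaEven (χ : DirichletCharacter ℂ q) (t : ℝ) : ℂ :=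
  (∑ j : ZMod q, χ j * (evenKernel (ZMod.toAddCircle j) (q * t) : ℂ)) / 2

/-- The theta series `∑ χ(n) n exp(-π n² t / q)` of an odd character, written with the kernels of
the Hurwitz zeta functions. -/
noncomputable def thetaOdd (χ : DirichletCharacter ℂ q) (t : ℝ) : ℂ :=
  (∑ j : ZMod q, χ j * (q * (oddKernel (ZMod.toAddCircle j) (q * t) : ℂ))) / 2

lemma chi_zero (χ : DirichletCharacter ℂ q) : χ 0 = 0 := MulChar.map_zero χ

lemma hasSum_thetaEven {χ : DirichletCharacter ℂ q} (hχ : χ (-1) = 1) {t : ℝ} (ht : 0 < t) :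
    HasSum (fun n : ℕ => χ n * Real.exp (-Real.pi * n ^ 2 * (t / q))) (thetaEven χ t) := by
  have hq0 : (0 : ℝ) < q := by exact_mod_cast hq.out.pos
  have h := hasSum_int_of_residues (q := q)
    (f := fun n : ℤ => χ n * (Real.exp (-Real.pi * n ^ 2 * (t / q)) : ℂ))
    (S := fun j => χ j * (evenKernel (ZMod.toAddCircle j) (q * t) : ℂ)) ?_
  · have := hasSum_nat_of_even h (by simp [chi_zero]) ?_
    · simpa [thetaEven, thetaOdd] using this
    · intro n
      have : χ (-(n : ZMod q)) = χ n := by rw [← neg_one_mul, map_mul, hχ, one_mul]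
      push_cast
      simp [this]
  · intro j
    have h1 := hasSum_int_evenKernel ((j.val : ℝ) / (q : ℝ)) (mul_pos hq0 ht)
    rw [← Complex.hasSum_ofReal] at h1
    rw [ZMod.toAddCircle_apply]
    refine (h1.mul_left (χ j)).congr_fun ?_
    intro m
    congr 2
    · simp
    · push_cast
      have : (q : ℂ) ≠ 0 := by exact_mod_cast hq.out.ne_zero
      congr 1
      field_simp

lemma hasSum_thetaOdd {χ : DirichletCharacter ℂ q} (hχ : χ (-1) = -1) {t : ℝ} (ht : 0 < t) :
    HasSum (fun n : ℕ => χ n * (n * Real.exp (-Real.pi * n ^ 2 * (t / q)))) (thetaOdd χ t) := by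
  have hq0 : (0 : ℝ) < q := by exact_mod_cast hq.out.pos
  have h := hasSum_int_of_residues (q := q)
    (f := fun n : ℤ => χ n * (n * (Real.exp (-Real.pi * n ^ 2 * (t / q)) : ℂ)))
    (S := fun j => χ j * (q * (oddKernel (ZMod.toAddCircle j) (q * t) : ℂ))) ?_
  · have := hasSum_nat_of_even h (by simp [chi_zero]) ?_
    · simpa [thetaEven, thetaOdd] using this
    · intro n
      have : χ (-(n : ZMod q)) = -χ n := by rw [← neg_one_mul, map_mul, hχ, neg_one_mul]
      push_cast
      simp [this]
  · intro j
    have h1 := hasSum_int_oddKernel ((j.val : ℝ) / (q : ℝ)) (mul_pos hq0 ht)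
    rw [← Complex.hasSum_ofReal] at h1
    rw [ZMod.toAddCircle_apply]
    refine ((h1.mul_left (q : ℂ)).mul_left (χ j)).congr_fun ?_
    intro m
    have : (q : ℂ) ≠ 0 := by exact_mod_cast hq.out.ne_zero
    have h3 : (((q * m + j.val : ℤ) : ZMod q)) = j := by simp
    rw [h3]
    congr 1
    push_cast
    rw [← mul_assoc]
    congr 1
    · field_simp
    · congr 1
      field_simp

lemma sum_cosKernel_eq {χ : DirichletCharacter ℂ q} (hχ1 : χ ≠ 1) (hχ : χ (-1) = 1) {t : ℝ}
    (ht : 0 < t) :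
    ∑ j : ZMod q, χ j * (cosKernel (ZMod.toAddCircle j) (t / q) : ℂ) =
      gaussSum χ ZMod.stdAddChar * (2 * thetaEven χ⁻¹ t) := by
  have hq0 : (0 : ℝ) < q := by exact_mod_cast hq.out.pos
  have hinv : χ⁻¹ (-1) = 1 := by rw [MulChar.inv_apply', inv_neg_one, hχ]
  have h1 : HasSum (fun n : ℤ => χ⁻¹ (n : ZMod q) * gaussSum χ ZMod.stdAddChar *
      (Real.exp (-Real.pi * n ^ 2 * (t / q)) : ℂ))
      (∑ j : ZMod q, χ j * (cosKernel (ZMod.toAddCircle j) (t / q) : ℂ)) := by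
    have h2 : ∀ j ∈ (Finset.univ : Finset (ZMod q)), HasSum (fun n : ℤ => χ j *
        (ZMod.stdAddChar (j * (n : ZMod q)) * (Real.exp (-Real.pi * n ^ 2 * (t / q)) : ℂ)))
        (χ j * (cosKernel (ZMod.toAddCircle j) (t / q) : ℂ)) := by
      intro j _
      have := hasSum_int_cosKernel ((j.val : ℝ) / (q : ℝ)) (div_pos ht hq0)
      rw [ZMod.toAddCircle_apply]
      refine (this.mul_left (χ j)).congr_fun ?_
      intro n
      rw [exp_toAddCircle_eq]
    refine (hasSum_sum h2).congr_fun ?_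
    intro n
    simp_rw [← mul_assoc]
    rw [← Finset.sum_mul, sum_mul_stdAddChar_mul hχ1]
  have h3 := hasSum_nat_of_even h1 (by simp [chi_zero]) ?_
  · have h4 := (hasSum_thetaEven (χ := χ⁻¹) hinv ht).mul_left (gaussSum χ ZMod.stdAddChar)
    have h5 := h3.unique (h4.congr_fun (fun n => by push_cast; ring))
    linear_combination 2 * h5
  · intro n
    have : χ⁻¹ (-(n : ZMod q)) = χ⁻¹ n := by rw [← neg_one_mul, map_mul, hinv, one_mul]
    push_cast
    simp only [this]
    simp

lemma sum_sinKernel_eq {χ : DirichletCharacter ℂ q} (hχ1 : χ ≠ 1) (hχ : χ (-1) = -1) {t : ℝ}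
    (ht : 0 < t) :
    ∑ j : ZMod q, χ j * (sinKernel (ZMod.toAddCircle j) (t / q) : ℂ) =
      gaussSum χ ZMod.stdAddChar * (-I * (2 * thetaOdd χ⁻¹ t)) := by
  have hq0 : (0 : ℝ) < q := by exact_mod_cast hq.out.pos
  have hinv : χ⁻¹ (-1) = -1 := by rw [MulChar.inv_apply', inv_neg_one, hχ]
  have h1 : HasSum (fun n : ℤ => χ⁻¹ (n : ZMod q) * gaussSum χ ZMod.stdAddChar *
      (-I * n * (Real.exp (-Real.pi * n ^ 2 * (t / q)) : ℂ)))
      (∑ j : ZMod q, χ j * (sinKernel (ZMod.toAddCircle j) (t / q) : ℂ)) := by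
    have h2 : ∀ j ∈ (Finset.univ : Finset (ZMod q)), HasSum (fun n : ℤ => χ j *
        (ZMod.stdAddChar (j * (n : ZMod q)) *
          (-I * n * (Real.exp (-Real.pi * n ^ 2 * (t / q)) : ℂ))))
        (χ j * (sinKernel (ZMod.toAddCircle j) (t / q) : ℂ)) := by
      intro j _
      have := hasSum_int_sinKernel ((j.val : ℝ) / (q : ℝ)) (div_pos ht hq0)
      rw [ZMod.toAddCircle_apply]
      refine (this.mul_left (χ j)).congr_fun ?_
      intro n
      rw [exp_toAddCircle_eq]
      ring
    refine (hasSum_sum h2).congr_fun ?_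
    intro n
    simp_rw [← mul_assoc]
    simp_rw [← Finset.sum_mul]
    rw [sum_mul_stdAddChar_mul hχ1]
  have h3 := hasSum_nat_of_even h1 (by simp [chi_zero]) ?_
  · have h4 := (hasSum_thetaOdd (χ := χ⁻¹) hinv ht).mul_left (gaussSum χ ZMod.stdAddChar * (-I))
    have h5 := h3.unique (h4.congr_fun (fun n => by push_cast; ring))
    linear_combination 2 * h5
  · intro n
    have : χ⁻¹ (-(n : ZMod q)) = -χ⁻¹ n := by rw [← neg_one_mul, map_mul, hinv, neg_one_mul]
    push_cast
    simp only [this]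
    simp

end ThetaSeries

section CompletedL

open HurwitzZeta Complex Filter Set Topology Asymptotics MeasureTheory

variable {q : ℕ} [hq : Fact q.Prime]

/-- `χ` has parity `a`: it is even with `a = 0` or odd with `a = 1`. -/
def HasParity (χ : DirichletCharacter ℂ q) (a : ℕ) : Prop := a ≤ 1 ∧ χ (-1) = (-1) ^ a

/-- The theta series `∑ χ(n) n ^ a exp(-π n² t / q)` of a character of parity `a`. -/
noncomputable def theta (a : ℕ) (χ : DirichletCharacter ℂ q) (t : ℝ) : ℂ :=
  if a = 0 then thetaEven χ t else thetaOdd χ t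

/-- The root number of a character of parity `a`. -/
noncomputable def rootNumber (a : ℕ) (χ : DirichletCharacter ℂ q) : ℂ :=
  gaussSum χ ZMod.stdAddChar * (-I) ^ a / (√q : ℝ)

lemma HasParity.inv {χ : DirichletCharacter ℂ q} {a : ℕ} (h : HasParity χ a) :
    HasParity χ⁻¹ a := ⟨h.1, by rw [MulChar.inv_apply', inv_neg_one, h.2]⟩

lemma HasParity.cases {χ : DirichletCharacter ℂ q} {a : ℕ} (h : HasParity χ a) :
    (a = 0 ∧ χ (-1) = 1) ∨ (a = 1 ∧ χ (-1) = -1) := by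
  obtain ⟨h1, h2⟩ := h
  interval_cases a <;> simp_all

lemma hasSum_theta {χ : DirichletCharacter ℂ q} {a : ℕ} (h : HasParity χ a) {t : ℝ} (ht : 0 < t) :
    HasSum (fun n : ℕ => χ n * (n ^ a * Real.exp (-Real.pi * n ^ 2 * (t / q)))) (theta a χ t) := by
  rcases h.cases with ⟨rfl, h2⟩ | ⟨rfl, h2⟩
  · simpa [theta] using hasSum_thetaEven h2 ht
  · simpa [theta] using hasSum_thetaOdd h2 ht

lemma continuousOn_theta (χ : DirichletCharacter ℂ q) (a : ℕ) :
    ContinuousOn (theta a χ) (Ioi 0) := by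
  have hq0 : (0 : ℝ) < q := by exact_mod_cast hq.out.pos
  have hmaps : MapsTo (fun t : ℝ => (q : ℝ) * t) (Ioi 0) (Ioi 0) := fun t ht => mul_pos hq0 ht
  have hc : ContinuousOn (fun t : ℝ => (q : ℝ) * t) (Ioi 0) := by fun_prop
  unfold theta
  split_ifs
  · refine ContinuousOn.div_const (continuousOn_finsetSum _ fun j _ => ?_) _
    exact continuousOn_const.mul (continuous_ofReal.comp_continuousOn
      ((continuousOn_evenKernel _).comp hc hmaps))
  · refine ContinuousOn.div_const (continuousOn_finsetSum _ fun j _ => ?_) _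
    exact continuousOn_const.mul (continuousOn_const.mul (continuous_ofReal.comp_continuousOn
      ((continuousOn_oddKernel _).comp hc hmaps)))

lemma isBigO_comp_mul_left {f : ℝ → ℝ} {p : ℝ} (hp : 0 < p)
    (hf : f =O[atTop] fun x => Real.exp (-p * x)) (r : ℝ) :
    (fun t => (f (q * t) : ℂ)) =O[atTop] fun t : ℝ => t ^ r := by
  have hq0 : (0 : ℝ) < q := by exact_mod_cast hq.out.pos
  have h1 : Tendsto (fun t : ℝ => (q : ℝ) * t) atTop atTop := tendsto_id.const_mul_atTop hq0
  have h2 := hf.comp_tendsto h1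
  have h3 := (isLittleO_exp_neg_mul_rpow_atTop (mul_pos hp hq0) r).isBigO
  refine IsBigO.trans ?_ h3
  refine (isBigO_ofReal_left.mpr ?_)
  refine h2.congr_right fun t => ?_
  simp only [Function.comp_apply]
  congr 1
  ring

lemma isBigO_theta (χ : DirichletCharacter ℂ q) (a : ℕ) (r : ℝ) :
    theta a χ =O[atTop] fun t : ℝ => t ^ r := by
  unfold theta
  split_ifs
  · unfold thetaEven
    simp_rw [div_eq_inv_mul]
    refine IsBigO.const_mul_left (IsBigO.fun_sum fun j _ => ?_) _
    by_cases hj : j = 0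
    · subst hj
      simp only [chi_zero, zero_mul]
      exact isBigO_zero _ _
    · obtain ⟨p, hp, hO⟩ := isBigO_atTop_evenKernel_sub (ZMod.toAddCircle j)
      rw [if_neg (by simpa using hj)] at hO
      simp only [sub_zero] at hO
      exact IsBigO.const_mul_left (isBigO_comp_mul_left hp hO r) _
  · unfold thetaOdd
    simp_rw [div_eq_inv_mul]
    refine IsBigO.const_mul_left (IsBigO.fun_sum fun j _ => ?_) _
    obtain ⟨p, hp, hO⟩ := isBigO_atTop_oddKernel (ZMod.toAddCircle j)
    exact IsBigO.const_mul_left (IsBigO.const_mul_left (isBigO_comp_mul_left hp hO r) _) _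

lemma theta_one_div {χ : DirichletCharacter ℂ q} (hχ1 : χ ≠ 1) {a : ℕ} (h : HasParity χ a) {t : ℝ}
    (ht : 0 < t) :
    theta a χ (1 / t) = rootNumber a χ * (t ^ (1 / 2 + (a : ℝ)) : ℝ) * theta a χ⁻¹ t := by
  have hq0 : (0 : ℝ) < q := by exact_mod_cast hq.out.pos
  have hsq : (√(q : ℝ) : ℂ) * (√(q : ℝ) : ℂ) = q := by
    rw [← ofReal_mul, Real.mul_self_sqrt hq0.le]; simp
  have hs0 : (√(q : ℝ) : ℂ) ≠ 0 := by
    exact_mod_cast (Real.sqrt_pos.mpr hq0).ne'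
  have e1 : (1 : ℝ) / (q * (1 / t)) = t / q := by field_simp
  have e2 : (1 : ℝ) / ((q : ℝ) * (1 / t)) ^ (1 / 2 : ℝ) = t ^ (1 / 2 : ℝ) / √q := by
    rw [mul_one_div, Real.div_rpow hq0.le ht.le, Real.sqrt_eq_rpow, one_div_div]
  rcases h.cases with ⟨rfl, h2⟩ | ⟨rfl, h2⟩
  · have hk := sum_cosKernel_eq hχ1 h2 ht
    simp only [theta, if_true, rootNumber, pow_zero, mul_one, Nat.cast_zero, add_zero]
    rw [thetaEven]
    simp_rw [evenKernel_functional_equation _ (q * (1 / t)), e1, e2]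
    have : ∀ j : ZMod q, χ j * (((t ^ (1 / 2 : ℝ) / √q * cosKernel (ZMod.toAddCircle j) (t / q) : ℝ)) : ℂ)
        = ((t ^ (1 / 2 : ℝ) : ℝ) : ℂ) / √(q : ℝ) * (χ j * (cosKernel (ZMod.toAddCircle j) (t / q) : ℂ)) := by
      intro j; push_cast; ring
    simp_rw [this]
    rw [← Finset.mul_sum, hk]
    ring
  · have hk := sum_sinKernel_eq hχ1 h2 ht
    simp only [theta, one_ne_zero, if_false, rootNumber, pow_one, Nat.cast_one]
    rw [thetaOdd]
    have e3 : (1 : ℝ) / ((q : ℝ) * (1 / t)) ^ (3 / 2 : ℝ) = t ^ (1 / 2 + 1 : ℝ) / (√q * q) := by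
      rw [mul_one_div, Real.div_rpow hq0.le ht.le, one_div_div, Real.sqrt_eq_rpow]
      norm_num
      congr 1
      rw [← Real.rpow_add_one hq0.ne']; norm_num
    simp_rw [oddKernel_functional_equation _ (q * (1 / t)), e1, e3]
    have hqc : (q : ℂ) ≠ 0 := by exact_mod_cast hq.out.ne_zero
    have : ∀ j : ZMod q, χ j * (q * (((t ^ (1 / 2 + 1 : ℝ) / (√q * q) * sinKernel (ZMod.toAddCircle j) (t / q) : ℝ)) : ℂ))
        = ((t ^ (1 / 2 + 1 : ℝ) : ℝ) : ℂ) / √(q : ℝ) * (χ j * (sinKernel (ZMod.toAddCircle j) (t / q) : ℂ)) := by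
      intro j; push_cast; field_simp
    simp_rw [this]
    rw [← Finset.mul_sum, hk]
    ring

lemma rootNumber_mul_inv {χ : DirichletCharacter ℂ q} (hχ1 : χ ≠ 1) {a : ℕ} (h : HasParity χ a) :
    rootNumber a χ * rootNumber a χ⁻¹ = 1 := by
  have hq0 : (0 : ℝ) < q := by exact_mod_cast hq.out.pos
  have hsq : (√(q : ℝ) : ℂ) * (√(q : ℝ) : ℂ) = q := by
    rw [← ofReal_mul, Real.mul_self_sqrt hq0.le]; simp
  have hs0 : (√(q : ℝ) : ℂ) ≠ 0 := by
    exact_mod_cast (Real.sqrt_pos.mpr hq0).ne'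
  have h1 := gaussSum_mul_gaussSum_eq_card hχ1 (ZMod.isPrimitive_stdAddChar q)
  have h2 := mul_gaussSum_inv_eq_gaussSum χ⁻¹ (ZMod.stdAddChar (N := q))
  rw [ZMod.card] at h1
  have hqc : (q : ℂ) ≠ 0 := by exact_mod_cast hq.out.ne_zero
  rw [rootNumber, rootNumber, ← h2, h.inv.2]
  have h3 : (-I) ^ a * (-I) ^ a * (-1) ^ a = 1 := by
    rw [← mul_pow, ← mul_pow]; simp
  rw [div_mul_div_comm, hsq, div_eq_one_iff_eq hqc]
  linear_combination ((-I) ^ a * (-I) ^ a * (-1) ^ a) * h1 + q * h3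

lemma star_rootNumber {χ : DirichletCharacter ℂ q} {a : ℕ} (h : HasParity χ a) :
    (starRingEnd ℂ) (rootNumber a χ) = rootNumber a χ⁻¹ := by
  have h2 := mul_gaussSum_inv_eq_gaussSum χ⁻¹ (ZMod.stdAddChar (N := q))
  have h1 := star_gaussSum_eq χ (ZMod.stdAddChar (N := q))
  rw [← starRingEnd_apply] at h1
  rw [rootNumber, rootNumber, ← h2, h.inv.2, map_div₀, map_mul, h1, map_pow, map_neg, conj_I,
    conj_ofReal, neg_neg, neg_pow I]
  have : (-1 : ℂ) ^ a * (-1) ^ a = 1 := by rw [← mul_pow]; simp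
  linear_combination (-(gaussSum χ⁻¹ (ZMod.stdAddChar (N := q))⁻¹ * I ^ a / (√q : ℝ))) * this

lemma norm_rootNumber {χ : DirichletCharacter ℂ q} (hχ1 : χ ≠ 1) {a : ℕ} (h : HasParity χ a) :
    ‖rootNumber a χ‖ = 1 := by
  have h1 := rootNumber_mul_inv hχ1 h
  rw [← star_rootNumber h, mul_conj] at h1
  have h2 : normSq (rootNumber a χ) = 1 := by exact_mod_cast h1
  rw [normSq_eq_norm_sq] at h2
  nlinarith [norm_nonneg (rootNumber a χ)]

/-- The pair of theta series of `χ` and `χ⁻¹`, related by the functional equation. -/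
noncomputable def thetaPair {χ : DirichletCharacter ℂ q} (hχ1 : χ ≠ 1) {a : ℕ}
    (h : HasParity χ a) : WeakFEPair ℂ where
  f := theta a χ
  g := theta a χ⁻¹
  k := 1 / 2 + a
  ε := rootNumber a χ
  f₀ := 0
  g₀ := 0
  hf_int := (continuousOn_theta χ a).locallyIntegrableOn measurableSet_Ioi
  hg_int := (continuousOn_theta χ⁻¹ a).locallyIntegrableOn measurableSet_Ioi
  hk := by positivity
  hε := by
    intro h0
    have := rootNumber_mul_inv hχ1 h
    simp [h0] at this
  h_feq t ht := theta_one_div hχ1 h ht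
  hf_top r := by simpa using isBigO_theta χ a r
  hg_top r := by simpa using isBigO_theta χ⁻¹ a r

lemma mellin_theta_of_one_lt_re {χ : DirichletCharacter ℂ q} {a : ℕ}
    (h : HasParity χ a) {s : ℂ} (hs : 1 < s.re) :
    mellin (theta a χ) ((s + a) / 2) =
      Gammaℝ (s + a) * (√q : ℝ) ^ (s + a) * DirichletCharacter.LFunction χ s := by
  have hq0 : (0 : ℝ) < q := by exact_mod_cast hq.out.pos
  have hr0 : 0 < √(q : ℝ) := Real.sqrt_pos.mpr hq0
  have hsa : 0 < (s + a).re := by simp; positivity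
  have hterm : ∀ n : ℕ, n ≠ 0 → χ n * (n : ℂ) ^ a / (|(n : ℝ) / √(q : ℝ)| : ℝ) ^ (s + a) =
      (√q : ℝ) ^ (s + a) * LSeries.term (fun n => χ n) s n := by
    intro n hn
    have hn0 : (0 : ℝ) < n := by exact_mod_cast Nat.pos_of_ne_zero hn
    have hnc : (n : ℂ) ≠ 0 := by exact_mod_cast hn
    rw [LSeries.term_of_ne_zero hn, abs_of_pos (by positivity), div_eq_mul_inv (n : ℝ), ofReal_mul,
      mul_cpow_ofReal_nonneg hn0.le (by positivity), ofReal_inv, inv_cpow _ _ (by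
        rw [arg_ofReal_of_nonneg hr0.le]; exact Real.pi_pos.ne), ofReal_natCast,
      cpow_add _ _ hnc, cpow_natCast]
    have h1 : ((√q : ℝ) : ℂ) ^ (s + a) ≠ 0 := by
      rw [Ne, cpow_eq_zero_iff]; push Not; intro h; exfalso; exact hr0.ne' (by exact_mod_cast h)
    have h2 : (n : ℂ) ^ s ≠ 0 := by
      rw [Ne, cpow_eq_zero_iff]; push Not; intro h; exact absurd h hnc
    field_simp
  have h0 : ∀ n : ℕ, n = 0 → LSeries.term (fun n => χ n) s n = 0 := by
    rintro n rfl; simp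
  have hsum : HasSum (LSeries.term (fun n => χ n) s) (DirichletCharacter.LFunction χ s) := by
    rw [DirichletCharacter.LFunction_eq_LSeries χ hs]
    exact (DirichletCharacter.LSeriesSummable_of_one_lt_re χ hs).LSeriesHasSum
  have key := hasSum_mellin_pi_mul_sq (a := fun n : ℕ => χ n * (n : ℂ) ^ a)
    (r := fun n : ℕ => (n : ℝ) / √(q : ℝ)) (F := theta a χ) hsa ?_ ?_
  · refine key.unique ?_
    rw [mul_assoc]
    have h3 := (hsum.mul_left ((√q : ℝ) ^ (s + a) : ℂ)).mul_left (Gammaℝ (s + a))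
    refine h3.congr_fun fun n => ?_
    by_cases hn : n = 0
    · subst hn
      simp [chi_zero]
    · rw [mul_div_assoc, hterm n hn]
  · intro t ht
    refine (hasSum_theta h ht).congr_fun fun n => ?_
    by_cases hn : n = 0
    · subst hn; simp [chi_zero]
    · have hn0 : (n : ℝ) ≠ 0 := by exact_mod_cast hn
      rw [if_neg (div_ne_zero hn0 hr0.ne'), mul_assoc, div_pow, Real.sq_sqrt hq0.le]
      congr 4
      ring
  · have h4 := (hsum.mul_left ((√q : ℝ) ^ (s + a) : ℂ)).summable.norm
    refine h4.congr fun n => ?_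
    by_cases hn : n = 0
    · subst hn; simp [chi_zero]
    · rw [← hterm n hn, norm_div, norm_cpow_eq_rpow_re_of_pos (by
        have : (0 : ℝ) < n := by exact_mod_cast Nat.pos_of_ne_zero hn
        positivity)]

lemma mellin_theta {χ : DirichletCharacter ℂ q} (hχ1 : χ ≠ 1) {a : ℕ} (h : HasParity χ a) (s : ℂ) :
    mellin (theta a χ) ((s + a) / 2) * (Gammaℝ (s + a))⁻¹ =
      (√q : ℝ) ^ (s + a) * DirichletCharacter.LFunction χ s := by
  have hq0 : (0 : ℝ) < q := by exact_mod_cast hq.out.pos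
  have hr0 : 0 < √(q : ℝ) := Real.sqrt_pos.mpr hq0
  have hstrong : IsStrongFEPair (thetaPair hχ1 h) := ⟨rfl, rfl⟩
  have hd : Differentiable ℂ (mellin (theta a χ)) := by
    have := hstrong.differentiable_Λ
    rwa [hstrong.Λ_eq] at this
  have hL : Differentiable ℂ fun s : ℂ => mellin (theta a χ) ((s + a) / 2) * (Gammaℝ (s + a))⁻¹ := by
    have h1 : Differentiable ℂ fun s : ℂ => mellin (theta a χ) ((s + a) / 2) :=
      hd.comp (by fun_prop)
    have h2 : Differentiable ℂ fun s : ℂ => (Gammaℝ (s + a))⁻¹ :=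
      differentiable_Gammaℝ_inv.comp (by fun_prop : Differentiable ℂ fun s : ℂ => s + a)
    exact h1.mul h2
  have hR : Differentiable ℂ fun s : ℂ =>
      ((√q : ℝ) : ℂ) ^ (s + a) * DirichletCharacter.LFunction χ s := by
    refine Differentiable.mul ?_ (DirichletCharacter.differentiable_LFunction hχ1)
    refine Differentiable.const_cpow (by fun_prop) (Or.inl (by exact_mod_cast hr0.ne'))
  have := AnalyticOnNhd.eq_of_eventuallyEq (z₀ := (2 : ℂ))
    (analyticOnNhd_univ_iff_differentiable.mpr hL) (analyticOnNhd_univ_iff_differentiable.mpr hR) ?_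
  · exact congr_fun this s
  · have hopen : {s : ℂ | 1 < s.re} ∈ 𝓝 (2 : ℂ) :=
      (isOpen_lt continuous_const continuous_re).mem_nhds (by simp)
    filter_upwards [hopen] with s hs
    have hs1 : 1 < s.re := hs
    rw [mellin_theta_of_one_lt_re h hs1]
    have : Gammaℝ (s + a) ≠ 0 := Gammaℝ_ne_zero_of_re_pos (by simp; positivity)
    field_simp

lemma mellinConvergent_theta {χ : DirichletCharacter ℂ q} (hχ1 : χ ≠ 1) {a : ℕ}
    (h : HasParity χ a) (s : ℂ) : MellinConvergent (theta a χ) s := by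
  have hstrong : IsStrongFEPair (thetaPair hχ1 h) := ⟨rfl, rfl⟩
  exact (hstrong.hasMellin s).1

end CompletedL

section LogCoordinates

open Complex Filter Set Topology MeasureTheory

variable {q : ℕ} [hq : Fact q.Prime]

/-- The Gaussian kernel in logarithmic coordinates. -/
noncomputable def logKernel (a : ℕ) (v : ℝ) : ℝ :=
  Real.exp ((1 / 2 + a) * v) * Real.exp (-Real.pi * Real.exp (2 * v))

/-- The total mass of `logKernel`. -/
noncomputable def kernelMass (a : ℕ) : ℝ := ∫ v, logKernel a v

/-- The theta series in logarithmic coordinates. -/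
noncomputable def logTheta (a : ℕ) (χ : DirichletCharacter ℂ q) (v : ℝ) : ℂ :=
  ((√(q : ℝ) ^ (-(1 / 2 + (a : ℝ)))  : ℝ) : ℂ) * (Real.exp ((1 / 2 + a) * v) * theta a χ (Real.exp (2 * v)))

lemma image_exp_two_mul : (fun v : ℝ => Real.exp (2 * v)) '' univ = Ioi 0 := by
  rw [image_univ]
  ext t
  constructor
  · rintro ⟨v, rfl⟩; exact Real.exp_pos _
  · intro ht
    exact ⟨Real.log t / 2, by simp only; rw [mul_div_cancel₀ _ two_ne_zero, Real.exp_log ht]⟩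

lemma hasDerivWithinAt_exp_two_mul :
    ∀ v ∈ (univ : Set ℝ), HasDerivWithinAt (fun v : ℝ => Real.exp (2 * v)) (2 * Real.exp (2 * v)) univ v := by
  intro v _
  have := ((hasDerivAt_id v).const_mul 2).exp
  simp only [id, mul_one] at this
  rw [mul_comm] at this
  exact this.hasDerivWithinAt

lemma injOn_exp_two_mul : InjOn (fun v : ℝ => Real.exp (2 * v)) univ := by
  intro v _ w _ h
  have := Real.exp_injective h
  linarith

lemma exp_cpow_aux (c v : ℝ) (z : ℂ) :
    |2 * Real.exp (2 * v)| • (((Real.exp (2 * v) : ℝ) : ℂ) ^ ((c : ℂ) / 2 - 1) • z) =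
      2 * (Real.exp (c * v) * z) := by
  have h1 : ((Real.exp (2 * v) : ℝ) : ℂ) ^ ((c : ℂ) / 2 - 1) = (Real.exp (c * v - 2 * v) : ℝ) := by
    rw [show (c : ℂ) / 2 - 1 = ((c / 2 - 1 : ℝ) : ℂ) by push_cast; rfl, ← ofReal_cpow (Real.exp_pos _).le,
      ← Real.exp_mul]
    congr 2; ring
  rw [h1, abs_of_pos (by positivity), real_smul, smul_eq_mul, Real.exp_sub]
  have : ((Real.exp (2 * v) : ℝ) : ℂ) ≠ 0 := by exact_mod_cast (Real.exp_pos _).ne'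
  push_cast at this ⊢
  field_simp

lemma integral_exp_mul_comp_exp (f : ℝ → ℂ) (c : ℝ) :
    ∫ v : ℝ, (Real.exp (c * v) : ℂ) * f (Real.exp (2 * v)) = mellin f (c / 2) / 2 := by
  have h := integral_image_eq_integral_abs_deriv_smul MeasurableSet.univ hasDerivWithinAt_exp_two_mul
    injOn_exp_two_mul (fun t : ℝ => (t : ℂ) ^ ((c : ℂ) / 2 - 1) • f t)
  rw [image_exp_two_mul] at h
  simp_rw [exp_cpow_aux] at h
  rw [mellin, h, setIntegral_univ, integral_const_mul]
  ring

lemma integrable_exp_mul_comp_exp {f : ℝ → ℂ} {c : ℝ} (hf : MellinConvergent f (c / 2)) :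
    Integrable fun v : ℝ => (Real.exp (c * v) : ℂ) * f (Real.exp (2 * v)) := by
  have h := integrableOn_image_iff_integrableOn_abs_deriv_smul MeasurableSet.univ
    hasDerivWithinAt_exp_two_mul injOn_exp_two_mul (fun t : ℝ => (t : ℂ) ^ ((c : ℂ) / 2 - 1) • f t)
  rw [image_exp_two_mul] at h
  simp_rw [exp_cpow_aux] at h
  have h2 := (h.mp hf)
  rw [integrableOn_univ] at h2
  exact (h2.const_mul (1 / 2)).congr (Eventually.of_forall fun v => by simp)

lemma integrable_logTheta {χ : DirichletCharacter ℂ q} (hχ1 : χ ≠ 1) {a : ℕ} (h : HasParity χ a) :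
    Integrable (logTheta a χ) :=
  (integrable_exp_mul_comp_exp (mellinConvergent_theta hχ1 h _)).const_mul _

lemma integrable_exp_mul_gaussian {c : ℝ} (hc : 0 < c) :
    Integrable fun v : ℝ => Real.exp (c * v) * Real.exp (-Real.pi * Real.exp (2 * v)) := by
  have hm : MellinConvergent (fun t : ℝ => ((Real.exp (-Real.pi * t) : ℝ) : ℂ)) (c / 2) := by
    have h := integrableOn_rpow_mul_exp_neg_mul_rpow (s := c / 2 - 1) (p := 1) (b := Real.pi)
      (by linarith) one_pos Real.pi_pos
    have h' : IntegrableOn (fun t : ℝ => ((t ^ (c / 2 - 1) * Real.exp (-Real.pi * t ^ (1 : ℝ)) : ℝ) : ℂ))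
        (Ioi 0) := Integrable.ofReal h
    refine h'.congr_fun (fun t ht => ?_) measurableSet_Ioi
    have ht0 : 0 < t := ht
    simp only [Real.rpow_one, smul_eq_mul]
    rw [show (c : ℂ) / 2 - 1 = ((c / 2 - 1 : ℝ) : ℂ) by push_cast; rfl, ← ofReal_cpow ht0.le]
    push_cast; rfl
  have h1 := (integrable_exp_mul_comp_exp hm).re
  refine h1.congr (Eventually.of_forall fun v => ?_)
  simp only [RCLike.re_to_complex]
  rw [← ofReal_mul, ofReal_re]

lemma kernelMass_eq (a : ℕ) : (kernelMass a : ℂ) = Gammaℝ (1 / 2 + a) / 2 := by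
  have h := integral_exp_mul_comp_exp (fun t : ℝ => ((Real.exp (-Real.pi * t) : ℝ) : ℂ)) (1 / 2 + a)
  have h2 : (0 : ℝ) < 1 / 2 + a := by positivity
  rw [kernelMass, ← integral_complex_ofReal]
  simp only [logKernel, ofReal_mul]
  rw [h]
  congr 1
  have h3 := Complex.integral_cpow_mul_exp_neg_mul_Ioi (a := ((1 / 2 + a : ℝ) : ℂ) / 2) (r := Real.pi)
    (by rw [div_ofNat_re, ofReal_re]; positivity) (by simpa using Real.pi_pos)
  rw [mellin, Gammaℝ_def]
  simp only [smul_eq_mul]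
  have h4 : ∀ t : ℝ, ((Real.exp (-Real.pi * t) : ℝ) : ℂ) = cexp (-(Real.pi * t)) := by
    intro t; push_cast; ring_nf
  simp_rw [h4]
  rw [h3, one_div, inv_cpow _ _ (by rw [arg_ofReal_of_nonneg Real.pi_pos.le]; exact Real.pi_pos.ne),
    ← cpow_neg]
  push_cast
  congr 2
  ring

lemma integral_logTheta {χ : DirichletCharacter ℂ q} (hχ1 : χ ≠ 1) {a : ℕ} (h : HasParity χ a) :
    ∫ v, logTheta a χ v = kernelMass a * DirichletCharacter.LFunction χ (1 / 2) := by
  have hq0 : (0 : ℝ) < q := by exact_mod_cast hq.out.pos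
  have hr0 : 0 < √(q : ℝ) := Real.sqrt_pos.mpr hq0
  have hG : Gammaℝ (1 / 2 + a) ≠ 0 := Gammaℝ_ne_zero_of_re_pos (by simp; positivity)
  have h1 := mellin_theta hχ1 h (1 / 2)
  simp only [logTheta]
  rw [integral_const_mul]
  have h2 := integral_exp_mul_comp_exp (theta a χ) (1 / 2 + a)
  rw [h2, kernelMass_eq]
  push_cast at h1 ⊢
  rw [← div_eq_mul_inv, div_eq_iff hG] at h1
  rw [h1, ofReal_cpow hr0.le]
  push_cast
  rw [cpow_neg]
  have h3 : ((√q : ℝ) : ℂ) ^ ((1 / 2 : ℂ) + a) ≠ 0 := by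
    rw [Ne, cpow_eq_zero_iff]; push Not; intro h; exfalso; exact hr0.ne' (by exact_mod_cast h)
  generalize ((√q : ℝ) : ℂ) ^ ((1 / 2 : ℂ) + a) = X at *
  generalize Gammaℝ (1 / 2 + a) = Y at *
  field_simp

lemma logTheta_neg {χ : DirichletCharacter ℂ q} (hχ1 : χ ≠ 1) {a : ℕ} (h : HasParity χ a) (v : ℝ) :
    logTheta a χ (-v) = rootNumber a χ * logTheta a χ⁻¹ v := by
  have h1 := theta_one_div hχ1 h (Real.exp_pos (2 * v))
  have h2 : 1 / Real.exp (2 * v) = Real.exp (2 * -v) := by rw [mul_neg, Real.exp_neg, one_div]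
  rw [h2] at h1
  rw [logTheta, logTheta, h1, ← Real.exp_mul]
  have h3 : (Real.exp ((1 / 2 + a) * -v) : ℂ) * (Real.exp (2 * v * (1 / 2 + a)) : ℝ) =
      (Real.exp ((1 / 2 + a) * v) : ℂ) := by
    rw [← ofReal_mul, ← Real.exp_add]
    congr 2; ring
  linear_combination ((√(q : ℝ) ^ (-(1 / 2 + (a : ℝ)))  : ℝ) : ℂ) * rootNumber a χ *
    theta a χ⁻¹ (Real.exp (2 * v)) * h3

lemma hasSum_logTheta {χ : DirichletCharacter ℂ q} {a : ℕ} (h : HasParity χ a) (v : ℝ) :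
    HasSum (fun n : ℕ => χ n * ((n : ℝ) ^ (-(1 / 2) : ℝ) *
      logKernel a (v + Real.log n - Real.log q / 2) : ℝ)) (logTheta a χ v) := by
  have hq0 : (0 : ℝ) < q := by exact_mod_cast hq.out.pos
  have hr0 : 0 < √(q : ℝ) := Real.sqrt_pos.mpr hq0
  have h1 := ((hasSum_theta h (Real.exp_pos (2 * v))).mul_left
    (Real.exp ((1 / 2 + a) * v) : ℂ)).mul_left ((√(q : ℝ) ^ (-(1 / 2 + (a : ℝ)))  : ℝ) : ℂ)
  refine h1.congr_fun fun n => ?_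
  by_cases hn : n = 0
  · subst hn; simp [chi_zero]
  have hn0 : (0 : ℝ) < n := by exact_mod_cast Nat.pos_of_ne_zero hn
  have key : (n : ℝ) ^ (-(1 / 2) : ℝ) * logKernel a (v + Real.log n - Real.log q / 2) =
      √(q : ℝ) ^ (-(1 / 2 + (a : ℝ))) * (Real.exp ((1 / 2 + a) * v) *
        ((n : ℝ) ^ a * Real.exp (-Real.pi * n ^ 2 * (Real.exp (2 * v) / q)))) := by
    have e1 : Real.exp (2 * (v + Real.log n - Real.log q / 2)) = n ^ 2 * (Real.exp (2 * v) / q) := by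
      rw [show 2 * (v + Real.log n - Real.log q / 2) = (Real.log n + Real.log n) + (2 * v - Real.log q) by ring,
        Real.exp_add, Real.exp_add, Real.exp_sub, Real.exp_log hn0, Real.exp_log hq0]
      ring
    have e2 : (n : ℝ) ^ a = Real.exp (Real.log n * a) := by
      rw [← Real.rpow_natCast, Real.rpow_def_of_pos hn0]
    rw [logKernel, e1, e2, Real.sqrt_eq_rpow, ← Real.rpow_mul hq0.le, Real.rpow_def_of_pos hn0,
      Real.rpow_def_of_pos hq0]
    rw [show -Real.pi * (n : ℝ) ^ 2 * (Real.exp (2 * v) / q) =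
      -Real.pi * ((n : ℝ) ^ 2 * (Real.exp (2 * v) / q)) by ring]
    generalize Real.exp (-Real.pi * ((n : ℝ) ^ 2 * (Real.exp (2 * v) / q))) = Z
    rw [← mul_assoc, ← Real.exp_add, ← mul_assoc, ← mul_assoc, ← Real.exp_add, ← Real.exp_add]
    congr 2
    ring
  rw [key]
  push_cast
  ring

end LogCoordinates

section Tails

open MeasureTheory Set

variable {α : Type*} [MeasurableSpace α]

/-- The mass that the density `K` gives to the set where `s` exceeds `x`. -/
noncomputable def tail (μ : Measure α) (K s : α → ℝ) (x : ℝ) : ℝ :=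
  ∫ p, (if x < s p then K p else 0) ∂μ

variable {μ : Measure α} {K s : α → ℝ}

lemma integrable_tail (hs : Measurable s) (hK : Integrable K μ) (x : ℝ) :
    Integrable (fun p => if x < s p then K p else 0) μ :=
  hK.indicator (measurableSet_lt measurable_const hs)

lemma tail_nonneg (hK0 : ∀ p, 0 ≤ K p) (x : ℝ) : 0 ≤ tail μ K s x :=
  integral_nonneg fun p => by dsimp only; split_ifs; exacts [hK0 p, le_rfl]

lemma tail_le_integral (hs : Measurable s) (hK : Integrable K μ) (hK0 : ∀ p, 0 ≤ K p) (x : ℝ) :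
    tail μ K s x ≤ ∫ p, K p ∂μ :=
  integral_mono (integrable_tail hs hK x) hK fun p => by
    dsimp only; split_ifs; exacts [le_rfl, hK0 p]

lemma tail_le_exp (hs : Measurable s) (hK : Integrable K μ) (hK0 : ∀ p, 0 ≤ K p) {B : ℝ} (hB : 0 ≤ B)
    (hKB : Integrable (fun p => Real.exp (B * s p) * K p) μ) (x : ℝ) :
    tail μ K s x ≤ (∫ p, Real.exp (B * s p) * K p ∂μ) * Real.exp (-(B * x)) := by
  rw [← integral_mul_const]
  refine integral_mono (integrable_tail hs hK x) (hKB.mul_const _) fun p => ?_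
  dsimp only
  split_ifs with h
  · rw [mul_right_comm, ← Real.exp_add]
    refine le_mul_of_one_le_left (hK0 p) (Real.one_le_exp ?_)
    nlinarith
  · have := hK0 p
    positivity

lemma integral_sub_tail_le (hs : Measurable s) (hK : Integrable K μ) (hK0 : ∀ p, 0 ≤ K p) {b : ℝ}
    (hb : 0 ≤ b) (hKb : Integrable (fun p => Real.exp (-b * s p) * K p) μ) (x : ℝ) :
    (∫ p, K p ∂μ) - tail μ K s x ≤ (∫ p, Real.exp (-b * s p) * K p ∂μ) * Real.exp (b * x) := by
  rw [tail, ← integral_sub hK (integrable_tail hs hK x), ← integral_mul_const]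
  refine integral_mono (hK.sub (integrable_tail hs hK x)) (hKb.mul_const _) fun p => ?_
  dsimp only
  split_ifs with h
  · have := hK0 p
    rw [sub_self]
    positivity
  · rw [sub_zero, mul_right_comm, ← Real.exp_add]
    refine le_mul_of_one_le_left (hK0 p) (Real.one_le_exp ?_)
    nlinarith

end Tails

section KernelTails

open MeasureTheory Set

lemma logKernel_pos (a : ℕ) (v : ℝ) : 0 < logKernel a v := by unfold logKernel; positivity

lemma continuous_logKernel (a : ℕ) : Continuous (logKernel a) := by unfold logKernel; fun_prop

lemma integrable_exp_mul_logKernel (a : ℕ) {B : ℝ} (hB : -(1 / 2) < B) :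
    Integrable fun v => Real.exp (B * v) * logKernel a v := by
  have ha : (0 : ℝ) ≤ a := a.cast_nonneg
  refine (integrable_exp_mul_gaussian (c := B + (1 / 2 + a)) (by linarith)).congr
    (Filter.Eventually.of_forall fun v => ?_)
  simp only [logKernel]
  rw [add_mul, Real.exp_add]
  ring

lemma integrable_logKernel (a : ℕ) : Integrable (logKernel a) := by
  simpa using integrable_exp_mul_logKernel a (B := 0) (by norm_num)

lemma kernelMass_pos (a : ℕ) : 0 < kernelMass a := by
  rw [kernelMass, integral_pos_iff_support_of_nonneg (fun v => (logKernel_pos a v).le)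
    (integrable_logKernel a)]
  have : Function.support (logKernel a) = univ := by
    ext v; simp [(logKernel_pos a v).ne']
  rw [this]; simp

/-- The product kernel on the plane. -/
noncomputable def logKernel₂ (a : ℕ) (p : ℝ × ℝ) : ℝ := logKernel a p.1 * logKernel a p.2

lemma logKernel₂_nonneg (a : ℕ) (p : ℝ × ℝ) : 0 ≤ logKernel₂ a p :=
  mul_nonneg (logKernel_pos a _).le (logKernel_pos a _).le

lemma continuous_logKernel₂ (a : ℕ) : Continuous (logKernel₂ a) := by
  have := continuous_logKernel a
  unfold logKernel₂
  fun_prop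

lemma integrable_exp_mul_logKernel₂ (a : ℕ) {B : ℝ} (hB : -(1 / 2) < B) :
    Integrable fun p : ℝ × ℝ => Real.exp (B * (p.1 + p.2)) * logKernel₂ a p := by
  refine ((integrable_exp_mul_logKernel a hB).mul_prod (integrable_exp_mul_logKernel a hB)).congr
    (Filter.Eventually.of_forall fun p => ?_)
  simp only [logKernel₂]
  rw [mul_add, Real.exp_add]
  ring

lemma integrable_logKernel₂ (a : ℕ) : Integrable (logKernel₂ a) := by
  simpa using integrable_exp_mul_logKernel₂ a (B := 0) (by norm_num)

lemma integral_logKernel₂ (a : ℕ) : ∫ p, logKernel₂ a p = kernelMass a ^ 2 := by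
  rw [sq]
  exact integral_prod_mul (logKernel a) (logKernel a)

/-- The weight in the approximate functional equation for a single `L`-value. -/
noncomputable def weight (a : ℕ) (x : ℝ) : ℝ := tail volume (logKernel a) id x

/-- The weight in the approximate functional equation for a product of two `L`-values. -/
noncomputable def weight₂ (a : ℕ) (x : ℝ) : ℝ :=
  tail volume (logKernel₂ a) (fun p => p.1 + p.2) x

lemma weight_nonneg (a : ℕ) (x : ℝ) : 0 ≤ weight a x := tail_nonneg (fun v => (logKernel_pos a v).le) x

lemma weight₂_nonneg (a : ℕ) (x : ℝ) : 0 ≤ weight₂ a x := tail_nonneg (logKernel₂_nonneg a) x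

lemma weight_le (a : ℕ) (x : ℝ) : weight a x ≤ kernelMass a :=
  tail_le_integral measurable_id (integrable_logKernel a) (fun v => (logKernel_pos a v).le) x

lemma weight₂_le (a : ℕ) (x : ℝ) : weight₂ a x ≤ kernelMass a ^ 2 := by
  rw [← integral_logKernel₂]
  exact tail_le_integral (by fun_prop) (integrable_logKernel₂ a) (logKernel₂_nonneg a) x

lemma exists_weight_le_exp {B : ℝ} (hB : 0 ≤ B) :
    ∃ C : ℝ, 0 < C ∧ ∀ a ≤ 1, ∀ x, weight a x ≤ C * Real.exp (-(B * x)) := by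
  have h (a : ℕ) (x : ℝ) := tail_le_exp measurable_id (integrable_logKernel a)
    (fun v => (logKernel_pos a v).le) hB (integrable_exp_mul_logKernel a (by linarith)) x
  set D : ℕ → ℝ := fun a => ∫ v, Real.exp (B * v) * logKernel a v
  refine ⟨|D 0| + |D 1| + 1, by positivity, fun a ha x => (h a x).trans ?_⟩
  gcongr
  interval_cases a
  · exact (le_abs_self (D 0)).trans (by linarith [abs_nonneg (D 1)])
  · exact (le_abs_self (D 1)).trans (by linarith [abs_nonneg (D 0)])

lemma exists_weight₂_le_exp {B : ℝ} (hB : 0 ≤ B) :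
    ∃ C : ℝ, 0 < C ∧ ∀ a ≤ 1, ∀ x, weight₂ a x ≤ C * Real.exp (-(B * x)) := by
  have h (a : ℕ) (x : ℝ) := tail_le_exp (s := fun p : ℝ × ℝ => p.1 + p.2) (by fun_prop)
    (integrable_logKernel₂ a) (logKernel₂_nonneg a) hB
    (integrable_exp_mul_logKernel₂ a (by linarith)) x
  set D : ℕ → ℝ := fun a => ∫ p : ℝ × ℝ, Real.exp (B * (p.1 + p.2)) * logKernel₂ a p
  refine ⟨|D 0| + |D 1| + 1, by positivity, fun a ha x => (h a x).trans ?_⟩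
  gcongr
  interval_cases a
  · exact (le_abs_self (D 0)).trans (by linarith [abs_nonneg (D 1)])
  · exact (le_abs_self (D 1)).trans (by linarith [abs_nonneg (D 0)])

lemma exists_kernelMass_sub_weight_le :
    ∃ C : ℝ, 0 < C ∧ ∀ a ≤ 1, ∀ x, kernelMass a - weight a x ≤ C * Real.exp (1 / 4 * x) := by
  have h (a : ℕ) (x : ℝ) := integral_sub_tail_le measurable_id (integrable_logKernel a)
    (fun v => (logKernel_pos a v).le) (b := 1 / 4) (by norm_num)
    (integrable_exp_mul_logKernel a (by norm_num)) x
  set D : ℕ → ℝ := fun a => ∫ v, Real.exp (-(1 / 4) * v) * logKernel a v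
  refine ⟨|D 0| + |D 1| + 1, by positivity, fun a ha x => (h a x).trans ?_⟩
  gcongr
  interval_cases a
  · exact (le_abs_self (D 0)).trans (by linarith [abs_nonneg (D 1)])
  · exact (le_abs_self (D 1)).trans (by linarith [abs_nonneg (D 0)])

lemma integral_shift_logKernel (a : ℕ) (t α : ℝ) :
    ∫ v, (if t < v then logKernel a (v + α) else 0) = weight a (t + α) := by
  have h := integral_add_right_eq_self (μ := volume)
    (fun v => if t + α < id v then logKernel a v else 0) α
  rw [weight, tail, ← h]
  simp

lemma integral_shift_logKernel₂ (a : ℕ) (t α β : ℝ) :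
    ∫ p : ℝ × ℝ, (if t < p.1 + p.2 then logKernel a (p.1 + α) * logKernel a (p.2 + β) else 0) =
      weight₂ a (t + α + β) := by
  have h := integral_add_right_eq_self (μ := volume)
    (fun p : ℝ × ℝ => if t + α + β < p.1 + p.2 then logKernel₂ a p else 0) (α, β)
  rw [weight₂, tail, ← h]
  refine integral_congr_ae (Filter.Eventually.of_forall fun p => ?_)
  simp only [logKernel₂, Prod.fst_add, Prod.snd_add]
  refine if_congr ?_ rfl rfl
  constructor <;> intro h <;> linarith

end KernelTails

section ApproximateFunctionalEquation

open MeasureTheory Set Filter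

variable {q : ℕ} [hq : Fact q.Prime]

lemma summable_rpow_mul_rpow {ρ : ℝ} (hρ : 1 < ρ) :
    Summable fun p : ℕ × ℕ => ((p.1 : ℝ) * p.2) ^ (-ρ) := by
  have h : Summable fun n : ℕ => (n : ℝ) ^ (-ρ) := Real.summable_nat_rpow.mpr (by linarith)
  refine (h.mul_of_nonneg h (fun n => by positivity) (fun n => by positivity)).congr fun p => ?_
  rw [Real.mul_rpow (by positivity) (by positivity)]

lemma norm_chi_le (χ : DirichletCharacter ℂ q) (n : ℕ) : ‖χ n‖ ≤ 1 := χ.norm_le_one _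

lemma integrable_logTheta_prod {χ₁ χ₂ : DirichletCharacter ℂ q} (h1 : χ₁ ≠ 1) (h2 : χ₂ ≠ 1) {a : ℕ}
    (hp1 : HasParity χ₁ a) (hp2 : HasParity χ₂ a) :
    Integrable fun p : ℝ × ℝ => logTheta a χ₁ p.1 * logTheta a χ₂ p.2 :=
  (integrable_logTheta h1 hp1).mul_prod (integrable_logTheta h2 hp2)

lemma volume_line (t : ℝ) : volume {p : ℝ × ℝ | p.1 + p.2 = t} = 0 := by
  rw [Measure.volume_eq_prod, Measure.measure_prod_null (measurableSet_eq_fun (by fun_prop) (by fun_prop))]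
  refine Eventually.of_forall fun u => ?_
  have : Prod.mk u ⁻¹' {p : ℝ × ℝ | p.1 + p.2 = t} = {t - u} := by
    ext v; simp only [mem_preimage, mem_ofPred_eq, mem_singleton_iff]
    constructor <;> intro h <;> linarith
  change volume _ = 0
  rw [this]; simp

lemma product_eq_add {χ₁ χ₂ : DirichletCharacter ℂ q} (h1 : χ₁ ≠ 1) (h2 : χ₂ ≠ 1) {a : ℕ}
    (hp1 : HasParity χ₁ a) (hp2 : HasParity χ₂ a) (t : ℝ) :
    (kernelMass a : ℂ) ^ 2 * (χ₁.LFunction (1 / 2) * χ₂.LFunction (1 / 2)) =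
      (∫ p : ℝ × ℝ, if t < p.1 + p.2 then logTheta a χ₁ p.1 * logTheta a χ₂ p.2 else 0) +
      rootNumber a χ₁ * rootNumber a χ₂ *
        ∫ p : ℝ × ℝ, if -t < p.1 + p.2 then logTheta a χ₁⁻¹ p.1 * logTheta a χ₂⁻¹ p.2 else 0 := by
  have hI := integrable_logTheta_prod h1 h2 hp1 hp2
  have hfull : (kernelMass a : ℂ) ^ 2 * (χ₁.LFunction (1 / 2) * χ₂.LFunction (1 / 2)) =
      ∫ p : ℝ × ℝ, logTheta a χ₁ p.1 * logTheta a χ₂ p.2 := by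
    have := integral_prod_mul (μ := volume) (ν := volume) (logTheta a χ₁) (logTheta a χ₂)
    rw [Measure.volume_eq_prod, this, integral_logTheta h1 hp1, integral_logTheta h2 hp2]
    ring
  have hmeas : MeasurableSet {p : ℝ × ℝ | t < p.1 + p.2} :=
    measurableSet_lt measurable_const (by fun_prop)
  have hsplit := integral_add_compl hmeas hI
  rw [← integral_indicator hmeas, ← integral_indicator hmeas.compl] at hsplit
  rw [hfull, ← hsplit]
  congr 1
  rw [← integral_neg_eq_self, ← integral_const_mul]
  refine integral_congr_ae ?_
  have hnull : ∀ᵐ p : ℝ × ℝ, p.1 + p.2 ≠ -t := by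
    rw [ae_iff]; simpa using volume_line (-t)
  filter_upwards [hnull] with p hp
  simp only [indicator, mem_compl_iff, mem_ofPred_eq, Prod.fst_neg, Prod.snd_neg, not_lt]
  have hiff : (-p.1 + -p.2 ≤ t) ↔ -t < p.1 + p.2 :=
    ⟨fun h => lt_of_le_of_ne (by linarith) (Ne.symm hp), fun h => by linarith⟩
  rw [if_congr hiff rfl rfl]
  split_ifs
  · rw [logTheta_neg h1 hp1, logTheta_neg h2 hp2]; ring
  · simp

lemma single_eq_add {χ : DirichletCharacter ℂ q} (h1 : χ ≠ 1) {a : ℕ} (hp : HasParity χ a) (t : ℝ) :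
    (kernelMass a : ℂ) * χ.LFunction (1 / 2) =
      (∫ v : ℝ, if t < v then logTheta a χ v else 0) +
      rootNumber a χ * ∫ v : ℝ, if -t < v then logTheta a χ⁻¹ v else 0 := by
  have hI := integrable_logTheta h1 hp
  have hmeas : MeasurableSet {v : ℝ | t < v} := measurableSet_lt measurable_const (by fun_prop)
  have hsplit := integral_add_compl hmeas hI
  rw [← integral_indicator hmeas, ← integral_indicator hmeas.compl] at hsplit
  rw [← integral_logTheta h1 hp, ← hsplit]
  congr 1
  rw [← integral_neg_eq_self, ← integral_const_mul]
  refine integral_congr_ae ?_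
  have hnull : ∀ᵐ v : ℝ, v ≠ -t := by
    rw [ae_iff]; simp
  filter_upwards [hnull] with v hv
  simp only [indicator, mem_compl_iff, mem_ofPred_eq, not_lt]
  have hiff : (-v ≤ t) ↔ -t < v :=
    ⟨fun h => lt_of_le_of_ne (by linarith) (Ne.symm hv), fun h => by linarith⟩
  rw [if_congr hiff rfl rfl]
  split_ifs
  · rw [logTheta_neg h1 hp]
  · simp

lemma exp_neg_mul_log {B x c : ℝ} (hx : 0 < x) : Real.exp (-(B * (c + Real.log x))) =
    Real.exp (-(B * c)) * x ^ (-B) := by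
  rw [Real.rpow_def_of_pos hx, ← Real.exp_add]; congr 1; ring

lemma hasSum_single {χ : DirichletCharacter ℂ q} {a : ℕ} (hp : HasParity χ a) (t : ℝ) :
    HasSum (fun n : ℕ => χ n * (((n : ℝ) ^ (-(1 / 2) : ℝ) *
      weight a (t + (Real.log n - Real.log q / 2)) : ℝ) : ℂ))
      (∫ v : ℝ, if t < v then logTheta a χ v else 0) := by
  set β : ℕ → ℝ := fun n => Real.log n - Real.log q / 2
  set F : ℕ → ℝ → ℂ := fun n v => χ n * (((n : ℝ) ^ (-(1 / 2) : ℝ) *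
    (if t < v then logKernel a (v + β n) else 0) : ℝ) : ℂ)
  have hshift : ∀ n, Integrable fun v => if t < v then logKernel a (v + β n) else 0 := fun n =>
    integrable_tail (s := id) measurable_id ((integrable_logKernel a).comp_add_right (β n)) t
  have hF : ∀ n, Integrable (F n) := fun n => (((hshift n).const_mul _).ofReal).const_mul _
  have hval : ∀ n, ∫ v, F n v = χ n * (((n : ℝ) ^ (-(1 / 2) : ℝ) * weight a (t + β n) : ℝ) : ℂ) := by
    intro n
    simp only [F]
    rw [integral_const_mul, integral_complex_ofReal, integral_const_mul, integral_shift_logKernel]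
  obtain ⟨C, hC, hw⟩ := exists_weight_le_exp (B := 1) zero_le_one
  have hsum : Summable fun n => ∫ v, ‖F n v‖ := by
    refine Summable.of_nonneg_of_le (fun n => integral_nonneg fun v => norm_nonneg _)
      (g := fun n => ∫ v, ‖F n v‖) (f := fun n : ℕ => C * Real.exp (-(1 * (t - Real.log q / 2))) *
        (n : ℝ) ^ (-(3 / 2) : ℝ)) (fun n => ?_) ((Real.summable_nat_rpow.mpr (by norm_num)).mul_left _)
    rcases Nat.eq_zero_or_pos n with rfl | hn
    · simp [F, chi_zero]
    have hn0 : (0 : ℝ) < n := by exact_mod_cast hn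
    calc ∫ v, ‖F n v‖ ≤ ∫ v, (n : ℝ) ^ (-(1 / 2) : ℝ) * (if t < v then logKernel a (v + β n) else 0) := by
          refine integral_mono (hF n).norm ((hshift n).const_mul _) fun v => ?_
          simp only [F, norm_mul, Complex.norm_real]
          refine (mul_le_of_le_one_left (by positivity) (norm_chi_le χ n)).trans (le_of_eq ?_)
          rw [Real.norm_of_nonneg (by positivity), Real.norm_of_nonneg]
          split_ifs; exacts [(logKernel_pos _ _).le, le_rfl]
      _ = (n : ℝ) ^ (-(1 / 2) : ℝ) * weight a (t + β n) := by
          rw [integral_const_mul, integral_shift_logKernel]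
      _ ≤ (n : ℝ) ^ (-(1 / 2) : ℝ) * (C * Real.exp (-(1 * (t + β n)))) := by
          gcongr; exact hw a hp.1 _
      _ = _ := by
          rw [show t + β n = (t - Real.log q / 2) + Real.log n by simp only [β]; ring, exp_neg_mul_log hn0,
            show (-(3 / 2) : ℝ) = -(1 / 2) + -1 by norm_num, Real.rpow_add hn0]
          ring
  have key := hasSum_integral_of_summable_integral_norm hF hsum
  have hpt : ∀ v, ∑' n, F n v = if t < v then logTheta a χ v else 0 := by
    intro v
    have h := hasSum_logTheta hp v
    split_ifs with htv
    · rw [← h.tsum_eq]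
      refine tsum_congr fun n => ?_
      simp only [F, β, if_pos htv, add_sub_assoc]
    · simp [F, htv]
  simp_rw [hpt] at key
  exact key.congr_fun fun n => (hval n).symm

lemma hasSum_mul_pair {f g : ℕ → ℂ} {A B : ℂ} (hf : HasSum f A) (hg : HasSum g B) :
    HasSum (fun n : ℕ × ℕ => f n.1 * g n.2) (A * B) :=
  hf.mul hg (summable_mul_of_summable_norm hf.summable.norm hg.summable.norm)

lemma hasSum_logTheta_mul {χ₁ χ₂ : DirichletCharacter ℂ q} {a : ℕ} (hp1 : HasParity χ₁ a)
    (hp2 : HasParity χ₂ a) (p : ℝ × ℝ) :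
    HasSum (fun n : ℕ × ℕ => χ₁ n.1 * χ₂ n.2 * ((((n.1 : ℝ) * n.2) ^ (-(1 / 2) : ℝ) *
      (logKernel a (p.1 + Real.log n.1 - Real.log q / 2) *
        logKernel a (p.2 + Real.log n.2 - Real.log q / 2)) : ℝ) : ℂ))
      (logTheta a χ₁ p.1 * logTheta a χ₂ p.2) := by
  refine (hasSum_mul_pair (hasSum_logTheta hp1 p.1) (hasSum_logTheta hp2 p.2)).congr_fun fun n => ?_
  rw [Real.mul_rpow (by positivity) (by positivity)]
  push_cast
  ring

lemma hasSum_product {χ₁ χ₂ : DirichletCharacter ℂ q} {a : ℕ} (hp1 : HasParity χ₁ a)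
    (hp2 : HasParity χ₂ a) (t : ℝ) :
    HasSum (fun n : ℕ × ℕ => χ₁ n.1 * χ₂ n.2 * ((((n.1 : ℝ) * n.2) ^ (-(1 / 2) : ℝ) *
      weight₂ a (t + Real.log ((n.1 * n.2 : ℕ)) - Real.log q) : ℝ) : ℂ))
      (∫ p : ℝ × ℝ, if t < p.1 + p.2 then logTheta a χ₁ p.1 * logTheta a χ₂ p.2 else 0) := by
  set β : ℕ → ℝ := fun n => Real.log n - Real.log q / 2
  set H : ℕ × ℕ → ℝ × ℝ → ℝ := fun n p =>
    if t < p.1 + p.2 then logKernel a (p.1 + β n.1) * logKernel a (p.2 + β n.2) else 0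
  set F : ℕ × ℕ → ℝ × ℝ → ℂ := fun n p => χ₁ n.1 * χ₂ n.2 *
    ((((n.1 : ℝ) * n.2) ^ (-(1 / 2) : ℝ) * H n p : ℝ) : ℂ)
  have hH0 : ∀ n p, 0 ≤ H n p := fun n p => by
    simp only [H]; split_ifs
    exacts [mul_nonneg (logKernel_pos _ _).le (logKernel_pos _ _).le, le_rfl]
  have hshift : ∀ n, Integrable (H n) := fun n =>
    integrable_tail (s := fun p : ℝ × ℝ => p.1 + p.2) (by fun_prop)
      (((integrable_logKernel a).comp_add_right (β n.1)).mul_prod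
        ((integrable_logKernel a).comp_add_right (β n.2))) t
  have hH_int : ∀ n, ∫ p, H n p = weight₂ a (t + β n.1 + β n.2) := fun n =>
    integral_shift_logKernel₂ a t _ _
  have hF : ∀ n, Integrable (F n) := fun n => (((hshift n).const_mul _).ofReal).const_mul _
  have hβ : ∀ n : ℕ × ℕ, n.1 ≠ 0 → n.2 ≠ 0 →
      t + β n.1 + β n.2 = t + Real.log ((n.1 * n.2 : ℕ)) - Real.log q := by
    intro n h1 h2
    rw [Nat.cast_mul, Real.log_mul (by exact_mod_cast h1) (by exact_mod_cast h2)]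
    simp only [β]; ring
  have hval : ∀ n, ∫ p, F n p = χ₁ n.1 * χ₂ n.2 * ((((n.1 : ℝ) * n.2) ^ (-(1 / 2) : ℝ) *
      weight₂ a (t + Real.log ((n.1 * n.2 : ℕ)) - Real.log q) : ℝ) : ℂ) := by
    intro n
    by_cases h1 : n.1 = 0
    · simp [F, h1, chi_zero]
    by_cases h2 : n.2 = 0
    · simp [F, h2, chi_zero]
    simp only [F]
    rw [integral_const_mul, integral_complex_ofReal, integral_const_mul, hH_int, hβ n h1 h2]
  obtain ⟨C, hC, hw⟩ := exists_weight₂_le_exp (B := 1) zero_le_one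
  have hsum : Summable fun n => ∫ v, ‖F n v‖ := by
    refine Summable.of_nonneg_of_le (fun n => integral_nonneg fun v => norm_nonneg _)
      (g := fun n => ∫ v, ‖F n v‖) (f := fun n : ℕ × ℕ => C * Real.exp (-(1 * (t - Real.log q))) *
        ((n.1 : ℝ) * n.2) ^ (-(3 / 2) : ℝ)) (fun n => ?_)
        ((summable_rpow_mul_rpow (by norm_num)).mul_left _)
    by_cases h1 : n.1 = 0
    · simp [F, h1, chi_zero]
    by_cases h2 : n.2 = 0
    · simp [F, h2, chi_zero]
    have hn0 : (0 : ℝ) < (n.1 : ℝ) * n.2 := by positivity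
    calc ∫ v, ‖F n v‖ ≤ ∫ p, ((n.1 : ℝ) * n.2) ^ (-(1 / 2) : ℝ) * H n p := by
          refine integral_mono (hF n).norm ((hshift n).const_mul _) fun v => ?_
          simp only [F, norm_mul, Complex.norm_real]
          refine (mul_le_of_le_one_left (by positivity)
            (mul_le_one₀ (norm_chi_le χ₁ _) (norm_nonneg _) (norm_chi_le χ₂ _))).trans (le_of_eq ?_)
          rw [Real.norm_of_nonneg (by positivity), Real.norm_of_nonneg (hH0 n v)]
      _ = ((n.1 : ℝ) * n.2) ^ (-(1 / 2) : ℝ) * weight₂ a (t + β n.1 + β n.2) := by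
          rw [integral_const_mul, hH_int]
      _ ≤ ((n.1 : ℝ) * n.2) ^ (-(1 / 2) : ℝ) * (C * Real.exp (-(1 * (t + β n.1 + β n.2)))) := by
          gcongr; exact hw a hp1.1 _
      _ = _ := by
          rw [hβ n h1 h2, Nat.cast_mul, show t + Real.log (n.1 * n.2) - Real.log q =
            (t - Real.log q) + Real.log (n.1 * n.2) by ring, exp_neg_mul_log hn0,
            show (-(3 / 2) : ℝ) = -(1 / 2) + -1 by norm_num, Real.rpow_add hn0]
          ring
  have key := hasSum_integral_of_summable_integral_norm hF hsum
  have hpt : ∀ p : ℝ × ℝ, ∑' n, F n p =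
      if t < p.1 + p.2 then logTheta a χ₁ p.1 * logTheta a χ₂ p.2 else 0 := by
    intro p
    split_ifs with htv
    · refine (HasSum.congr_fun (hasSum_logTheta_mul hp1 hp2 p) fun n => ?_).tsum_eq
      simp only [F, H, β, if_pos htv, add_sub_assoc]
    · simp [F, H, htv]
  simp_rw [hpt] at key
  exact key.congr_fun fun n => (hval n).symm

end ApproximateFunctionalEquation

section DivisorBound

open Finset

lemma exists_add_one_le_rpow {η : ℝ} (hη : 0 < η) :
    ∃ K : ℝ, 1 ≤ K ∧ ∀ p e : ℕ, 2 ≤ p → ((e : ℝ) + 1) ≤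
      (if (p : ℝ) ^ η < 2 then K else 1) * ((p : ℝ) ^ e) ^ η := by
  have hl := Real.log_pos (one_lt_two : (1 : ℝ) < 2)
  refine ⟨1 + 1 / (η * Real.log 2), by have : 0 < η * Real.log 2 := by positivity
                                       have := one_div_pos.mpr this; linarith, fun p e hp => ?_⟩
  have hp0 : (0 : ℝ) < p := by positivity
  have hp2 : (2 : ℝ) ≤ p := by exact_mod_cast hp
  have hcomm : ((p : ℝ) ^ e) ^ η = ((p : ℝ) ^ η) ^ e := by
    rw [← Real.rpow_natCast, ← Real.rpow_natCast, ← Real.rpow_mul hp0.le, ← Real.rpow_mul hp0.le, mul_comm]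
  rw [hcomm]
  split_ifs with h
  · have h1 : 1 + η * Real.log 2 * e ≤ ((p : ℝ) ^ η) ^ e := by
      calc 1 + η * Real.log 2 * e ≤ Real.exp (η * Real.log 2 * e) := by
            linarith [Real.add_one_le_exp (η * Real.log 2 * e)]
        _ = ((2 : ℝ) ^ η) ^ e := by
            rw [Real.rpow_def_of_pos two_pos, ← Real.exp_nat_mul]; congr 1; ring
        _ ≤ _ := by gcongr
    have h2 : 0 < η * Real.log 2 := by positivity
    have h4 : 1 / (η * Real.log 2) * (η * Real.log 2 * e) = e := by field_simp
    have h5 : 0 < 1 / (η * Real.log 2) := by positivity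
    have h3 : (1 + 1 / (η * Real.log 2)) * (1 + η * Real.log 2 * e) ≤
      (1 + 1 / (η * Real.log 2)) * ((p : ℝ) ^ η) ^ e := by gcongr
    refine le_trans ?_ h3
    have h6 : 0 ≤ η * Real.log 2 * e := by positivity
    linear_combination h5.le + h6 - h4
  · rw [one_mul]
    push Not at h
    have h1 : (e : ℝ) + 1 ≤ 2 ^ e := by
      have := one_add_mul_le_pow (a := (1 : ℝ)) (by norm_num) e
      norm_num at this; linarith
    exact h1.trans (by gcongr)

lemma exists_card_divisors_le {η : ℝ} (hη : 0 < η) :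
    ∃ C : ℝ, 1 ≤ C ∧ ∀ n : ℕ, (n.divisors.card : ℝ) ≤ C * (n : ℝ) ^ η := by
  obtain ⟨K, hK, h⟩ := exists_add_one_le_rpow hη
  set P : ℕ := ⌈(2 : ℝ) ^ (1 / η)⌉₊
  have hK0 : 0 ≤ K := by linarith
  refine ⟨K ^ P, one_le_pow₀ hK, fun n => ?_⟩
  rcases eq_or_ne n 0 with rfl | hn
  · simp; positivity
  have hn' : (n : ℝ) ^ η = ∏ p ∈ n.primeFactors, ((p : ℝ) ^ n.factorization p) ^ η := by
    rw [Real.finsetProd_rpow _ _ fun i _ => by positivity]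
    congr 1
    conv_lhs => rw [← Nat.prod_factorization_pow_eq_self hn]
    rw [Finsupp.prod]
    push_cast
    rfl
  rw [Nat.card_divisors hn, hn']
  push_cast
  have h1 : ∏ p ∈ n.primeFactors, ((n.factorization p : ℝ) + 1) ≤
      ∏ p ∈ n.primeFactors, ((if (p : ℝ) ^ η < 2 then K else 1) * ((p : ℝ) ^ n.factorization p) ^ η) :=
    prod_le_prod (fun p _ => by positivity) fun p hp => h p _ (Nat.prime_of_mem_primeFactors hp).two_le
  rw [prod_mul_distrib] at h1
  refine h1.trans ?_
  gcongr
  rw [prod_ite, prod_const_one, mul_one, prod_const]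
  refine pow_le_pow_right₀ hK ?_
  have hsub : (n.primeFactors.filter fun p : ℕ => (p : ℝ) ^ η < 2) ⊆ range P := by
    intro p hp
    rw [mem_filter] at hp
    rw [mem_range, Nat.lt_ceil]
    have := Real.rpow_lt_rpow (by positivity) hp.2 (by positivity : 0 < 1 / η)
    rwa [← Real.rpow_mul (by positivity), mul_one_div_cancel hη.ne', Real.rpow_one] at this
  simpa using card_le_card hsub

end DivisorBound

section Regrouping

open Finset

lemma hasSum_divisorsAntidiagonal {F : ℕ × ℕ → ℂ} {A : ℂ} (h : HasSum F A)
    (h0 : ∀ p : ℕ × ℕ, p.1 * p.2 = 0 → F p = 0) :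
    HasSum (fun c : ℕ => ∑ p ∈ c.divisorsAntidiagonal, F p) A := by
  have h1 := h.tsum_fiberwise (fun p : ℕ × ℕ => p.1 * p.2)
  refine h1.congr_fun fun c => ?_
  rcases eq_or_ne c 0 with rfl | hc
  · simp only [Nat.divisorsAntidiagonal_zero, sum_empty]
    have : ∀ p : ((fun p : ℕ × ℕ => p.1 * p.2) ⁻¹' {0} : Set (ℕ × ℕ)), F p = 0 := fun p => h0 p.1 p.2
    simp only [this, tsum_zero]
  · have hset : (fun p : ℕ × ℕ => p.1 * p.2) ⁻¹' {c} = (c.divisorsAntidiagonal : Set (ℕ × ℕ)) := by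
      ext p; simp [hc]
    rw [hset, Finset.tsum_subtype']

lemma hasSum_product_regroup {f : ℕ → ℂ} {A : ℂ}
    (h : HasSum (fun p : ℕ × ℕ => f (p.1 * p.2)) A) (h0 : f 0 = 0) :
    HasSum (fun c : ℕ => (c.divisors.card : ℂ) * f c) A := by
  refine (hasSum_divisorsAntidiagonal h fun p hp => by rw [hp, h0]).congr_fun fun c => ?_
  rw [sum_congr rfl (g := fun _ => f c) fun p hp => by rw [(Nat.mem_divisorsAntidiagonal.mp hp).1],
    sum_const, nsmul_eq_mul, ← Nat.map_div_right_divisors, card_map]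

/-- Reindexing a sum along multiplication by `m`. -/
lemma hasSum_mul_left_iff {f : ℕ → ℂ} {A : ℂ} {m : ℕ} (hm : m ≠ 0) :
    HasSum (fun u : ℕ => if m ∣ u then f (u / m) else 0) A ↔ HasSum f A := by
  have hinj : Function.Injective fun n : ℕ => m * n := fun a b h => Nat.eq_of_mul_eq_mul_left (Nat.pos_of_ne_zero hm) h
  rw [← hinj.hasSum_iff (f := fun u : ℕ => if m ∣ u then f (u / m) else 0)]
  · refine iff_of_eq (congrArg (fun g => HasSum g A) (funext fun n => ?_))
    simp [Nat.mul_div_cancel_left n (Nat.pos_of_ne_zero hm)]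
  · intro u hu
    rw [if_neg]
    rintro ⟨k, rfl⟩
    exact hu ⟨k, rfl⟩

lemma hasSum_mul_left_prod_iff {f : ℕ × ℕ → ℂ} {A : ℂ} {m m' : ℕ} (hm : m ≠ 0) (hm' : m' ≠ 0) :
    HasSum (fun u : ℕ × ℕ => if m ∣ u.1 ∧ m' ∣ u.2 then f (u.1 / m, u.2 / m') else 0) A ↔ HasSum f A := by
  have hinj : Function.Injective fun n : ℕ × ℕ => (m * n.1, m' * n.2) := by
    rintro ⟨a, b⟩ ⟨c, d⟩ h
    rw [Prod.mk.injEq] at h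
    exact Prod.ext (Nat.eq_of_mul_eq_mul_left (Nat.pos_of_ne_zero hm) h.1)
      (Nat.eq_of_mul_eq_mul_left (Nat.pos_of_ne_zero hm') h.2)
  rw [← hinj.hasSum_iff (f := fun u : ℕ × ℕ => if m ∣ u.1 ∧ m' ∣ u.2 then f (u.1 / m, u.2 / m') else 0)]
  · refine iff_of_eq (congrArg (fun g => HasSum g A) (funext fun n => ?_))
    simp [Nat.mul_div_cancel_left _ (Nat.pos_of_ne_zero hm), Nat.mul_div_cancel_left _ (Nat.pos_of_ne_zero hm')]
  · rintro ⟨u, v⟩ hu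
    rw [if_neg]
    rintro ⟨⟨k, hk⟩, ⟨l, hl⟩⟩
    exact hu ⟨(k, l), Prod.ext hk.symm hl.symm⟩

end Regrouping

section Average

open Finset

variable {q : ℕ} [hq : Fact q.Prime]

open Classical in
/-- The nontrivial characters modulo `q` of parity `a`. -/
noncomputable def parityFamily (q : ℕ) (a : ℕ) : Finset (DirichletCharacter ℂ q) :=
  univ.filter fun χ => χ ≠ 1 ∧ χ (-1) = (-1) ^ a

/-- The average over the nontrivial characters of parity `a`, normalised by `(q - 1) / 2`. -/
noncomputable def average (a : ℕ) (f : DirichletCharacter ℂ q → ℂ) : ℂ :=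
  2 / ((q : ℂ) - 1) * ∑ χ ∈ parityFamily q a, f χ

lemma mem_parityFamily {a : ℕ} (ha : a ≤ 1) {χ : DirichletCharacter ℂ q} :
    χ ∈ parityFamily q a ↔ χ ≠ 1 ∧ HasParity χ a := by
  simp [parityFamily, HasParity, ha]

lemma chi_neg_one_sq (χ : DirichletCharacter ℂ q) : χ (-1) = 1 ∨ χ (-1) = -1 := by
  have : χ (-1) * χ (-1) = 1 := by rw [← map_mul]; simp
  exact mul_self_eq_one_iff.mp this

lemma two_lt_cast (h2 : q ≠ 2) : (2 : ℝ) < q := by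
  exact_mod_cast lt_of_le_of_ne hq.out.two_le (Ne.symm h2)

lemma sum_parityFamily {a : ℕ} (ha : a ≤ 1) (f : DirichletCharacter ℂ q → ℂ) :
    ∑ χ ∈ parityFamily q a, f χ =
      1 / 2 * (∑ χ, f χ + (-1) ^ a * ∑ χ, χ (-1) * f χ) - if a = 0 then f 1 else 0 := by
  classical
  have h1 : ∑ χ ∈ parityFamily q a, f χ =
      ∑ χ, (1 / 2 * (f χ + (-1) ^ a * (χ (-1) * f χ)) - if χ = 1 then (if a = 0 then f 1 else 0) else 0) := by
    rw [parityFamily, sum_filter]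
    refine sum_congr rfl fun χ _ => ?_
    by_cases hχ : χ = 1
    · subst hχ
      interval_cases a
      · simp [MulChar.one_apply (isUnit_one.neg)]; ring
      · simp [MulChar.one_apply (isUnit_one.neg)]
    · rcases chi_neg_one_sq χ with h | h <;> interval_cases a <;> simp [hχ, h] <;> norm_num <;> ring
  rw [h1, sum_sub_distrib, ← mul_sum, sum_add_distrib, mul_sum]
  simp

lemma average_char {a : ℕ} (ha : a ≤ 1) (z : ZMod q) :
    average a (fun χ => χ z) = (if z = 1 then 1 else 0) + (-1) ^ a * (if z = -1 then 1 else 0) -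
      (if a = 0 ∧ z ≠ 0 then 2 / ((q : ℂ) - 1) else 0) := by
  have hq1 : ((q : ℂ) - 1) ≠ 0 := by
    rw [sub_ne_zero]; exact_mod_cast hq.out.one_lt.ne'
  have htot : ((q.totient : ℕ) : ℂ) = (q : ℂ) - 1 := by
    rw [Nat.totient_prime hq.out, Nat.cast_sub hq.out.one_le, Nat.cast_one]
  rw [average, sum_parityFamily ha]
  simp_rw [← map_mul]
  rw [DirichletCharacter.sum_characters_eq, DirichletCharacter.sum_characters_eq, htot]
  have h3 : (-1 * z = 1) ↔ z = -1 := by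
    rw [neg_one_mul, neg_eq_iff_eq_neg]
  rw [if_congr h3 rfl rfl]
  have h4 : (1 : DirichletCharacter ℂ q) z = if z ≠ 0 then 1 else 0 := by
    split_ifs with h
    · exact MulChar.one_apply (isUnit_iff_ne_zero.mpr h)
    · push Not at h; subst h; exact MulChar.map_zero _
  rw [h4]
  have h5 : (2 : ℂ) / ((q : ℂ) - 1) * ((q : ℂ) - 1) = 2 := div_mul_cancel₀ _ hq1
  have h6 : ∀ P : Prop, ∀ [Decidable P], (if P then (q : ℂ) - 1 else 0) = ((q : ℂ) - 1) * if P then 1 else 0 :=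
    fun P _ => by split_ifs <;> simp
  have h7 : (if a = 0 ∧ z ≠ 0 then 2 / ((q : ℂ) - 1) else 0) =
      2 / ((q : ℂ) - 1) * if a = 0 then (if z ≠ 0 then 1 else 0) else 0 := by
    by_cases ha0 : a = 0 <;> by_cases hz : z = 0 <;> simp [ha0, hz]
  rw [h6, h6, h7]
  linear_combination (1 / 2 * ((if z = 1 then 1 else 0) + (-1) ^ a * if z = -1 then 1 else 0)) * h5

lemma norm_average_char_le {a : ℕ} (ha : a ≤ 1) (z : ZMod q) :
    ‖average a (fun χ => χ z)‖ ≤ (if z = 1 then 1 else 0) + (if z = -1 then 1 else 0) + 2 / ((q : ℝ) - 1) := by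
  have hq1 : (1 : ℝ) < q := by exact_mod_cast hq.out.one_lt
  have hq2 : ‖(2 : ℂ) / ((q : ℂ) - 1)‖ = 2 / ((q : ℝ) - 1) := by
    rw [norm_div, show ((q : ℂ) - 1) = (((q : ℝ) - 1 : ℝ) : ℂ) by push_cast; rfl, Complex.norm_real,
      Real.norm_of_nonneg (by linarith)]
    simp
  have hpos : 0 ≤ 2 / ((q : ℝ) - 1) := by apply div_nonneg <;> linarith
  rw [average_char ha]
  refine (norm_sub_le _ _).trans (add_le_add ((norm_add_le _ _).trans (add_le_add ?_ ?_)) ?_)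
  · split_ifs <;> simp
  · rw [norm_mul]; split_ifs <;> simp
  · split_ifs
    · exact hq2.le
    · simpa using hpos

end Average

section OffDiagonal

open Finset

variable {q : ℕ} [hq : Fact q.Prime]

lemma exists_sum_class_le {ρ : ℝ} (hρ : 1 < ρ) : ∃ C : ℝ, 0 < C ∧ ∀ (q : ℕ), 0 < q → ∀ (r : ZMod q)
    (s : Finset ℕ), ∑ u ∈ s, (if q ≤ 2 * u ∧ (u : ZMod q) = r then (u : ℝ) ^ (-ρ) else 0) ≤
      C * (q : ℝ) ^ (-ρ) := by
  have hsum : Summable fun j : ℕ => ((j : ℝ) + 1) ^ (-ρ) := by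
    have := (summable_nat_add_iff 1).mpr (Real.summable_nat_rpow.mpr (show -ρ < -1 by linarith))
    simpa using this
  have hS : 0 < ∑' j : ℕ, ((j : ℝ) + 1) ^ (-ρ) := hsum.tsum_pos (fun j => by positivity) 0 (by simp)
  refine ⟨(4 : ℝ) ^ ρ * ∑' j : ℕ, ((j : ℝ) + 1) ^ (-ρ), by positivity, fun q hq r s => ?_⟩
  have hq0 : (0 : ℝ) < q := by exact_mod_cast hq
  rw [← sum_filter]
  set P := s.filter fun u => q ≤ 2 * u ∧ (u : ZMod q) = r
  have hinj : Set.InjOn (fun u : ℕ => u / q) P := by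
    intro u hu v hv huv
    have hu' := (mem_filter.mp hu).2.2
    have hv' := (mem_filter.mp hv).2.2
    have h1 : u % q = v % q := (ZMod.natCast_eq_natCast_iff' u v q).mp (hu'.trans hv'.symm)
    rw [← Nat.div_add_mod u q, ← Nat.div_add_mod v q, h1, show u / q = v / q from huv]
  calc ∑ u ∈ P, (u : ℝ) ^ (-ρ) ≤ ∑ u ∈ P, (4 : ℝ) ^ ρ * (q : ℝ) ^ (-ρ) * (((u / q : ℕ) : ℝ) + 1) ^ (-ρ) := by
        refine sum_le_sum fun u hu => ?_
        have hu' := (mem_filter.mp hu).2.1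
        have hle : (q : ℝ) / 4 * (((u / q : ℕ) : ℝ) + 1) ≤ u := by
          have e1 : (q : ℝ) * ((u / q : ℕ) : ℝ) ≤ u := by exact_mod_cast Nat.mul_div_le u q
          have e2 : (q : ℝ) ≤ 2 * u := by exact_mod_cast hu'
          nlinarith
        have h4 : (4 : ℝ) ^ ρ * (q : ℝ) ^ (-ρ) = ((q : ℝ) / 4) ^ (-ρ) := by
          rw [Real.div_rpow hq0.le (by norm_num), Real.rpow_neg (by norm_num : (0 : ℝ) ≤ 4)]
          field_simp
        rw [h4, ← Real.mul_rpow (by positivity) (by positivity)]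
        exact Real.rpow_le_rpow_of_nonpos (by positivity) hle (by linarith)
    _ = (4 : ℝ) ^ ρ * (q : ℝ) ^ (-ρ) * ∑ j ∈ P.image fun u => u / q, ((j : ℝ) + 1) ^ (-ρ) := by
        rw [← mul_sum, sum_image hinj]
    _ ≤ (4 : ℝ) ^ ρ * (q : ℝ) ^ (-ρ) * ∑' j : ℕ, ((j : ℝ) + 1) ^ (-ρ) := by
        gcongr
        exact hsum.sum_le_tsum _ fun j _ => by positivity
    _ = _ := by ring

open Classical in
lemma exists_sum_offDiagonal_le {ρ : ℝ} (hρ : 1 < ρ) : ∃ C : ℝ, 0 < C ∧ ∀ (q : ℕ), 0 < q →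
    ∀ (s : Finset (ℕ × ℕ)), ∑ p ∈ s, (if p.1 ≠ p.2 ∧ ((p.1 : ZMod q) = p.2 ∨ (p.1 : ZMod q) = -p.2) then
      ((p.1 : ℝ) * p.2) ^ (-ρ) else 0) ≤ C * (q : ℝ) ^ (-ρ) := by
  obtain ⟨C, hC, h⟩ := exists_sum_class_le hρ
  have hsum : Summable fun n : ℕ => (n : ℝ) ^ (-ρ) := Real.summable_nat_rpow.mpr (by linarith)
  have hS : 0 < ∑' n : ℕ, (n : ℝ) ^ (-ρ) := hsum.tsum_pos (fun j => by positivity) 1 (by simp)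
  refine ⟨4 * C * ∑' n : ℕ, (n : ℝ) ^ (-ρ), by positivity, fun q hq s => ?_⟩
  set g : ℕ → ℕ → ℝ := fun u v => (v : ℝ) ^ (-ρ) *
    ((if q ≤ 2 * u ∧ (u : ZMod q) = v then (u : ℝ) ^ (-ρ) else 0) +
     (if q ≤ 2 * u ∧ (u : ZMod q) = -v then (u : ℝ) ^ (-ρ) else 0))
  have hg0 : ∀ u v, 0 ≤ g u v := fun u v => by simp only [g]; split_ifs <;> positivity
  have hbig : ∀ u v : ℕ, v < u → ((u : ZMod q) = v ∨ (u : ZMod q) = -v) → q ≤ 2 * u := by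
    rintro u v huv (h1 | h1)
    · have : q ∣ u - v := (Nat.modEq_iff_dvd' huv.le).mp ((ZMod.natCast_eq_natCast_iff _ _ _).mp h1.symm)
      have := Nat.le_of_dvd (by omega) this
      omega
    · have : ((u + v : ℕ) : ZMod q) = 0 := by push_cast; rw [h1]; ring
      have := Nat.le_of_dvd (by omega) ((ZMod.natCast_eq_zero_iff _ _).mp this)
      omega
  have hkey : ∀ u v : ℕ, v < u → ((u : ZMod q) = v ∨ (u : ZMod q) = -v) →
      ((u : ℝ) * v) ^ (-ρ) ≤ g u v := by
    intro u v huv h1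
    have h2 := hbig u v huv h1
    rw [Real.mul_rpow (by positivity) (by positivity), mul_comm]
    simp only [g]
    gcongr
    rcases h1 with h1 | h1
    · rw [if_pos (⟨h2, h1⟩ : q ≤ 2 * u ∧ (u : ZMod q) = v)]
      split_ifs
      · have : 0 ≤ (u : ℝ) ^ (-ρ) := by positivity
        linarith
      · simp
    · rw [if_pos (⟨h2, h1⟩ : q ≤ 2 * u ∧ (u : ZMod q) = -v)]
      split_ifs
      · have : 0 ≤ (u : ℝ) ^ (-ρ) := by positivity
        linarith
      · simp
  set U := s.image Prod.fst ∪ s.image Prod.snd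
  have hsU : s ⊆ U ×ˢ U := by
    intro p hp
    rw [mem_product]
    exact ⟨mem_union_left _ (mem_image_of_mem _ hp), mem_union_right _ (mem_image_of_mem _ hp)⟩
  have htot : ∑ v ∈ U, ∑ u ∈ U, g u v ≤ 2 * C * (∑' n : ℕ, (n : ℝ) ^ (-ρ)) * (q : ℝ) ^ (-ρ) := by
    calc ∑ v ∈ U, ∑ u ∈ U, g u v ≤ ∑ v ∈ U, (v : ℝ) ^ (-ρ) * (C * (q : ℝ) ^ (-ρ) + C * (q : ℝ) ^ (-ρ)) := by
          refine sum_le_sum fun v _ => ?_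
          simp only [g]
          rw [← mul_sum, sum_add_distrib]
          gcongr
          · exact h q hq _ U
          · exact h q hq _ U
      _ = (∑ v ∈ U, (v : ℝ) ^ (-ρ)) * (2 * C * (q : ℝ) ^ (-ρ)) := by rw [← sum_mul]; ring
      _ ≤ (∑' n : ℕ, (n : ℝ) ^ (-ρ)) * (2 * C * (q : ℝ) ^ (-ρ)) := by
          gcongr; exact hsum.sum_le_tsum _ fun j _ => by positivity
      _ = _ := by ring
  calc _ ≤ ∑ p ∈ s, (g p.1 p.2 + g p.2 p.1) := by
        refine sum_le_sum fun p _ => ?_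
        split_ifs with hp
        · rcases lt_or_gt_of_ne hp.1 with hlt | hlt
          · have := hkey p.2 p.1 hlt (hp.2.imp (fun h => h.symm) fun h => by rw [h, neg_neg])
            rw [mul_comm] at this
            linarith [hg0 p.1 p.2]
          · linarith [hkey p.1 p.2 hlt hp.2, hg0 p.2 p.1]
        · exact add_nonneg (hg0 _ _) (hg0 _ _)
    _ ≤ ∑ p ∈ U ×ˢ U, (g p.1 p.2 + g p.2 p.1) :=
        sum_le_sum_of_subset_of_nonneg hsU fun p _ _ => add_nonneg (hg0 _ _) (hg0 _ _)
    _ = ∑ v ∈ U, ∑ u ∈ U, g u v + ∑ v ∈ U, ∑ u ∈ U, g u v := by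
        rw [sum_add_distrib, sum_product_right, sum_product]
    _ ≤ _ := by linarith

end OffDiagonal

section BilinearAverage

open Finset

open Classical in
/-- Averaging a bilinear character sum picks out the diagonal. -/
lemma exists_average_bilinear_le {ρ : ℝ} (hρ : 1 < ρ) : ∃ C : ℝ, 0 < C ∧ ∀ (q : ℕ) [Fact q.Prime], q ≠ 2 →
    ∀ a ≤ 1, ∀ (γ : ℕ × ℕ → ℂ) (A : ℝ), 0 ≤ A →
    (∀ u v : ℕ, u ≠ 0 → v ≠ 0 → ‖γ (u, v)‖ ≤ A * ((u : ℝ) * v) ^ (-ρ)) →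
    ∀ S : DirichletCharacter ℂ q → ℂ,
    (∀ χ ∈ parityFamily q a, HasSum (fun p : ℕ × ℕ => γ p * (χ p.1 * χ⁻¹ p.2)) (S χ)) →
    ∀ D : ℂ, HasSum (fun u : ℕ => if q ∣ u then 0 else γ (u, u)) D →
    ‖average a S - D‖ ≤ C * A / q := by
  obtain ⟨C, hC, h⟩ := exists_sum_offDiagonal_le hρ
  have hsum := summable_rpow_mul_rpow hρ
  set Z := ∑' p : ℕ × ℕ, ((p.1 : ℝ) * p.2) ^ (-ρ)
  have hZ : 0 ≤ Z := tsum_nonneg fun p => by positivity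
  refine ⟨C + 4 * Z, by positivity, fun q hq h2 a ha γ A hA hγ S hS D hD => ?_⟩
  have hq2 := two_lt_cast (q := q) h2
  have hq0 : (0 : ℝ) < q := by linarith
  set E : ℕ × ℕ → ℂ := fun p => average a (fun χ : DirichletCharacter ℂ q => χ ((p.1 : ZMod q) * (p.2 : ZMod q)⁻¹))
  have hSE : HasSum (fun p => γ p * E p) (average a S) := by
    refine ((hasSum_sum hS).mul_left (2 / ((q : ℂ) - 1))).congr_fun fun p => ?_
    simp only [E, average]
    rw [← mul_sum, ← mul_assoc, mul_comm (γ p), mul_assoc]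
    congr 2
    refine sum_congr rfl fun χ _ => ?_
    rw [map_mul, MulChar.inv_apply']
  set M : ℕ × ℕ → ℂ := fun p => if p.1 = p.2 ∧ ¬ q ∣ p.1 then γ p else 0
  have hM : HasSum M D := by
    have hinj : Function.Injective fun u : ℕ => (u, u) := fun u v huv => congrArg Prod.fst huv
    rw [← hinj.hasSum_iff (f := M)]
    · refine hD.congr_fun fun u => ?_
      by_cases hu : q ∣ u <;> simp [M, hu]
    · rintro ⟨u, v⟩ hp
      simp only [M]
      rw [if_neg]
      rintro ⟨rfl, -⟩
      exact hp ⟨u, rfl⟩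
  set off : ℕ × ℕ → ℝ := fun p =>
    if p.1 ≠ p.2 ∧ ((p.1 : ZMod q) = p.2 ∨ (p.1 : ZMod q) = -p.2) then ((p.1 : ℝ) * p.2) ^ (-ρ) else 0
  have hoff0 : ∀ p, 0 ≤ off p := fun p => by simp only [off]; split_ifs <;> positivity
  have hoffs := summable_of_sum_le hoff0 (h q hq.out.pos)
  have hofft := hoffs.tsum_le_of_sum_le (h q hq.out.pos)
  have hbound := ((hoffs.hasSum.add (hsum.hasSum.mul_left (2 / ((q : ℝ) - 1)))).mul_left A)
  have hle := (hSE.sub hM).norm_le_of_bounded hbound fun p => ?_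
  · refine hle.trans ?_
    have e1 : (q : ℝ) ^ (-ρ) ≤ 1 / q := by
      rw [one_div, ← Real.rpow_neg_one]
      exact Real.rpow_le_rpow_of_exponent_le (by linarith) (by linarith)
    have e2 : 2 / ((q : ℝ) - 1) ≤ 4 / q := by
      rw [div_le_div_iff₀ (by linarith) hq0]; linarith
    calc _ ≤ A * (C * (1 / q) + 4 / q * Z) := by
          gcongr
          exact hofft.trans (by gcongr)
      _ = _ := by ring
  · obtain ⟨u, v⟩ := p
    have hq1 : 0 ≤ 2 / ((q : ℝ) - 1) := by apply div_nonneg <;> linarith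
    by_cases hv : (v : ZMod q) = 0
    · have hE : E (u, v) = 0 := by
        simp only [E, hv, inv_zero, mul_zero, MulChar.map_zero, average, sum_const_zero]
      have hM0 : M (u, v) = 0 := by
        simp only [M]
        rw [if_neg]
        rintro ⟨rfl, h⟩
        exact h ((ZMod.natCast_eq_zero_iff _ _).mp hv)
      rw [hE, hM0]
      simp only [mul_zero, sub_zero, norm_zero]
      have := hoff0 (u, v)
      positivity
    by_cases hu : (u : ZMod q) = 0
    · have hE : E (u, v) = 0 := by
        simp only [E, hu, zero_mul, mul_zero, MulChar.map_zero, average, sum_const_zero]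
      have hM0 : M (u, v) = 0 := by
        simp only [M]
        rw [if_neg]
        rintro ⟨_, h⟩
        exact h ((ZMod.natCast_eq_zero_iff _ _).mp hu)
      rw [hE, hM0]
      simp only [mul_zero, sub_zero, norm_zero]
      have := hoff0 (u, v)
      positivity
    have hu0 : u ≠ 0 := fun h => hu (by simp [h])
    have hv0 : v ≠ 0 := fun h => hv (by simp [h])
    have hz1 : (u : ZMod q) * (v : ZMod q)⁻¹ = 1 ↔ (u : ZMod q) = v := mul_inv_eq_one₀ hv
    have hz2 : (u : ZMod q) * (v : ZMod q)⁻¹ = -1 ↔ (u : ZMod q) = -v := by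
      rw [mul_inv_eq_iff_eq_mul₀ hv, neg_one_mul]
    have hγuv := hγ u v hu0 hv0
    have hX : 0 ≤ ((u : ℝ) * v) ^ (-ρ) := by positivity
    suffices hs : ∃ B : ℝ, ‖γ (u, v) * E (u, v) - M (u, v)‖ ≤ ‖γ (u, v)‖ * B ∧ 0 ≤ B ∧
        ((u : ℝ) * v) ^ (-ρ) * B ≤ off (u, v) + 2 / ((q : ℝ) - 1) * ((u : ℝ) * v) ^ (-ρ) by
      obtain ⟨B, hB1, hB0, hB2⟩ := hs
      refine hB1.trans ((mul_le_mul_of_nonneg_right hγuv hB0).trans ?_)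
      rw [mul_assoc]
      gcongr
    by_cases huv : u = v
    · subst huv
      have hndvd : ¬ q ∣ u := fun h => hu ((ZMod.natCast_eq_zero_iff _ _).mpr h)
      refine ⟨2 / ((q : ℝ) - 1), ?_, hq1, by simp [off, mul_comm]⟩
      have hne : (1 : ZMod q) ≠ -1 := by
        intro h
        have h' : ((2 : ℕ) : ZMod q) = 0 := by
          push_cast
          rw [show (2 : ZMod q) = 1 + 1 by norm_num]
          nth_rewrite 1 [h]
          ring
        exact h2 (((Nat.prime_dvd_prime_iff_eq hq.out Nat.prime_two).mp ((ZMod.natCast_eq_zero_iff _ _).mp h')))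
      simp only [E, M, hndvd, not_false_eq_true, and_self, if_true]
      rw [mul_inv_cancel₀ hu, average_char ha, if_pos rfl, if_neg hne]
      rw [show γ (u, u) * (1 + (-1) ^ a * 0 - if a = 0 ∧ (1 : ZMod q) ≠ 0 then 2 / ((q : ℂ) - 1) else 0) - γ (u, u)
        = γ (u, u) * (- if a = 0 ∧ (1 : ZMod q) ≠ 0 then 2 / ((q : ℂ) - 1) else 0) by ring, norm_mul, norm_neg]
      gcongr
      split_ifs
      · rw [norm_div, show ((q : ℂ) - 1) = (((q : ℝ) - 1 : ℝ) : ℂ) by push_cast; rfl, Complex.norm_real,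
          Real.norm_of_nonneg (by linarith)]
        simp
      · simpa using hq1
    · have hM0 : M (u, v) = 0 := by simp [M, huv]
      refine ⟨(if (u : ZMod q) = v ∨ (u : ZMod q) = -v then 1 else 0) + 2 / ((q : ℝ) - 1), ?_, by
        split_ifs <;> positivity, ?_⟩
      · rw [hM0, sub_zero, norm_mul]
        gcongr
        refine (norm_average_char_le ha _).trans ?_
        rw [if_congr hz1 rfl rfl, if_congr hz2 rfl rfl]
        gcongr
        have hne : (u : ZMod q) = v → (u : ZMod q) = -v → False := fun h1 h3 => by
          have h4 : ((2 : ℕ) : ZMod q) * v = 0 := by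
            push_cast
            have := h1.symm.trans h3
            linear_combination this
          rcases mul_eq_zero.mp h4 with h5 | h5
          · exact h2 (((Nat.prime_dvd_prime_iff_eq hq.out Nat.prime_two).mp ((ZMod.natCast_eq_zero_iff _ _).mp h5)))
          · exact hv h5
        split_ifs with h1 h3 h4 h5 h6 <;> norm_num <;> tauto
      · simp only [off]
        by_cases h1 : (u : ZMod q) = v ∨ (u : ZMod q) = -v <;> simp [h1, huv, mul_add, mul_comm]

end BilinearAverage

section Mollifier

open Finset

/-- The Dirichlet polynomial `∑_{m ≤ Y} c(m) χ(m)`. -/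
noncomputable def mollifier {q : ℕ} (Y : ℕ) (c : ℕ → ℝ) (χ : DirichletCharacter ℂ q) : ℂ :=
  ∑ m ∈ Icc 1 Y, (c m : ℂ) * χ m

/-- The coefficients of the product of a Dirichlet series with a mollifier. -/
noncomputable def mollify (Y : ℕ) (c : ℕ → ℝ) (F : ℕ → ℂ) (u : ℕ) : ℂ :=
  ∑ m ∈ Icc 1 Y, if m ∣ u then (c m : ℂ) * F (u / m) else 0

lemma mollify_one {Y : ℕ} (hY : 1 ≤ Y) (c : ℕ → ℝ) (F : ℕ → ℂ) : mollify Y c F 1 = c 1 * F 1 := by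
  rw [mollify, sum_eq_single_of_mem 1 (by simp [hY])]
  · simp
  · intro m _ hm
    rw [if_neg]
    simpa using hm

lemma hasSum_mollify {q : ℕ} {χ : DirichletCharacter ℂ q} {F : ℕ → ℂ} {A : ℂ} (Y : ℕ) (c : ℕ → ℝ)
    (h : HasSum (fun n : ℕ => χ n * F n) A) :
    HasSum (fun u : ℕ => χ u * mollify Y c F u) (mollifier Y c χ * A) := by
  have hm : ∀ m ∈ Icc 1 Y, HasSum (fun u : ℕ => (c m : ℂ) * χ m *
      if m ∣ u then χ ((u / m : ℕ) : ZMod q) * F (u / m) else 0) (c m * χ m * A) := fun m hm =>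
    ((hasSum_mul_left_iff (by have := (mem_Icc.mp hm).1; omega)).mpr h).mul_left _
  rw [mollifier, sum_mul]
  refine (hasSum_sum hm).congr_fun fun u => ?_
  rw [mollify, mul_sum]
  refine sum_congr rfl fun m hm1 => ?_
  split_ifs with hd
  · obtain ⟨k, rfl⟩ := hd
    have h0 : 0 < m := (mem_Icc.mp hm1).1
    rw [Nat.mul_div_cancel_left _ h0]
    push_cast
    rw [map_mul]
    ring
  · simp

lemma sum_dvd_le_card {Y u : ℕ} (hu : u ≠ 0) {f : ℕ → ℝ} {B : ℝ} (hB : 0 ≤ B) (h : ∀ m ∈ Icc 1 Y, m ∣ u → f m ≤ B) :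
    ∑ m ∈ Icc 1 Y, (if m ∣ u then f m else 0) ≤ u.divisors.card * B := by
  rw [← sum_filter]
  calc _ ≤ ((Icc 1 Y).filter (· ∣ u)).card • B :=
        sum_le_card_nsmul _ _ _ fun m hm => h m (mem_filter.mp hm).1 (mem_filter.mp hm).2
    _ ≤ _ := by
        rw [nsmul_eq_mul]
        gcongr
        intro m hm
        simpa [hu] using (mem_filter.mp hm).2

lemma norm_mollify_le {Y : ℕ} {c : ℕ → ℝ} {F : ℕ → ℂ} {X A C ρ η : ℝ} (hρ : 1 / 2 ≤ ρ) (hX : 0 ≤ X) (hA : 0 ≤ A)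
    (hc : ∀ m ∈ Icc 1 Y, |c m| ≤ X * (m : ℝ) ^ (-(1 / 2) : ℝ))
    (hF : ∀ n : ℕ, n ≠ 0 → ‖F n‖ ≤ A * (n : ℝ) ^ (-ρ))
    (hC : ∀ n : ℕ, (n.divisors.card : ℝ) ≤ C * (n : ℝ) ^ η) {u : ℕ} (hu : u ≠ 0) :
    ‖mollify Y c F u‖ ≤ A * X * C * (Y : ℝ) ^ (ρ - 1 / 2) * (u : ℝ) ^ (-(ρ - η)) := by
  have hu0 : (0 : ℝ) < u := by positivity
  calc ‖mollify Y c F u‖ ≤ ∑ m ∈ Icc 1 Y, (if m ∣ u then |c m| * ‖F (u / m)‖ else 0) := by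
        refine (norm_sum_le _ _).trans (sum_le_sum fun m _ => ?_)
        split_ifs <;> simp
    _ ≤ u.divisors.card * (A * X * (Y : ℝ) ^ (ρ - 1 / 2) * (u : ℝ) ^ (-ρ)) := by
        refine sum_dvd_le_card hu (by positivity) fun m hm hd => ?_
        obtain ⟨k, rfl⟩ := hd
        have hm1 := mem_Icc.mp hm
        have hm0 : (0 : ℝ) < m := by exact_mod_cast hm1.1
        have hk : k ≠ 0 := by rintro rfl; simp at hu
        have hk0 : (0 : ℝ) < k := by positivity
        rw [Nat.mul_div_cancel_left _ hm1.1]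
        calc |c m| * ‖F k‖ ≤ X * (m : ℝ) ^ (-(1 / 2) : ℝ) * (A * (k : ℝ) ^ (-ρ)) := by
              gcongr
              · exact hc m hm
              · exact hF k hk
          _ = A * X * (m : ℝ) ^ (ρ - 1 / 2) * ((m * k : ℕ) : ℝ) ^ (-ρ) := by
              push_cast
              rw [Real.mul_rpow hm0.le hk0.le, show -(1 / 2 : ℝ) = (ρ - 1 / 2) + -ρ by ring, Real.rpow_add hm0]
              ring
          _ ≤ _ := by
              gcongr
              exact_mod_cast hm1.2
    _ ≤ C * (u : ℝ) ^ η * (A * X * (Y : ℝ) ^ (ρ - 1 / 2) * (u : ℝ) ^ (-ρ)) := by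
        gcongr
        exact hC u
    _ = _ := by
        rw [show -(ρ - η) = η + -ρ by ring, Real.rpow_add hu0]
        ring

lemma norm_mollifier_le {q : ℕ} {Y : ℕ} {c : ℕ → ℝ} {X : ℝ} (hX : 0 ≤ X)
    (hc : ∀ m ∈ Icc 1 Y, |c m| ≤ X * (m : ℝ) ^ (-(1 / 2) : ℝ)) (χ : DirichletCharacter ℂ q) :
    ‖mollifier Y c χ‖ ≤ X * Y := by
  calc _ ≤ ∑ m ∈ Icc 1 Y, X := by
        refine (norm_sum_le _ _).trans (sum_le_sum fun m hm => ?_)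
        rw [norm_mul, Complex.norm_real, Real.norm_eq_abs]
        have h1 : (1 : ℝ) ≤ m := by exact_mod_cast (mem_Icc.mp hm).1
        calc _ ≤ X * (m : ℝ) ^ (-(1 / 2) : ℝ) * 1 := by
              gcongr
              · exact hc m hm
              · exact χ.norm_le_one _
          _ ≤ X * 1 * 1 := by
              gcongr
              exact Real.rpow_le_one_of_one_le_of_nonpos h1 (by norm_num)
          _ = X := by ring
    _ = _ := by simp [mul_comm]

variable {q : ℕ} [hq : Fact q.Prime]

lemma average_add {q : ℕ} (a : ℕ) (f g : DirichletCharacter ℂ q → ℂ) :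
    average a (fun χ => f χ + g χ) = average a f + average a g := by
  simp only [average, sum_add_distrib, mul_add]

lemma average_const_mul {q : ℕ} (a : ℕ) (z : ℂ) (f : DirichletCharacter ℂ q → ℂ) :
    average a (fun χ => z * f χ) = z * average a f := by
  simp only [average, ← mul_sum]
  ring

lemma average_congr {q : ℕ} {a : ℕ} {f g : DirichletCharacter ℂ q → ℂ} (h : ∀ χ ∈ parityFamily q a, f χ = g χ) :
    average a f = average a g := by
  rw [average, average, sum_congr rfl h]

lemma card_parityFamily_le (a : ℕ) : ((parityFamily q a).card : ℝ) ≤ (q : ℝ) - 1 := by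
  classical
  have h := card_le_univ (parityFamily q a)
  rw [← Nat.card_eq_fintype_card, DirichletCharacter.card_eq_totient_of_hasEnoughRootsOfUnity ℂ q, Nat.totient_prime hq.out] at h
  have h' : ((parityFamily q a).card : ℝ) ≤ ((q - 1 : ℕ) : ℝ) := by exact_mod_cast h
  rwa [Nat.cast_sub hq.out.one_le, Nat.cast_one] at h'

lemma norm_average_le {a : ℕ} {f : DirichletCharacter ℂ q → ℂ} {B : ℝ} (hB : 0 ≤ B)
    (h : ∀ χ ∈ parityFamily q a, ‖f χ‖ ≤ B) : ‖average a f‖ ≤ 2 * B := by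
  have hq1 : (1 : ℝ) < q := by exact_mod_cast hq.out.one_lt
  have hq2 : ‖(2 : ℂ) / ((q : ℂ) - 1)‖ = 2 / ((q : ℝ) - 1) := by
    rw [norm_div, show ((q : ℂ) - 1) = (((q : ℝ) - 1 : ℝ) : ℂ) by push_cast; rfl, Complex.norm_real,
      Real.norm_of_nonneg (by linarith)]
    simp
  have hpos : 0 ≤ 2 / ((q : ℝ) - 1) := by apply div_nonneg <;> linarith
  rw [average, norm_mul, hq2]
  calc _ ≤ 2 / ((q : ℝ) - 1) * (((q : ℝ) - 1) * B) := by
        gcongr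
        refine (norm_sum_le _ _).trans ((sum_le_card_nsmul _ _ _ h).trans ?_)
        rw [nsmul_eq_mul]
        gcongr
        exact card_parityFamily_le a
    _ = _ := by field_simp [show (q : ℝ) - 1 ≠ 0 by linarith]

/-- Averaging a Dirichlet series over characters picks out the first coefficient. -/
lemma exists_average_linear_le {ρ : ℝ} (hρ : 1 < ρ) : ∃ C : ℝ, 0 < C ∧ ∀ (q : ℕ) [Fact q.Prime], q ≠ 2 →
    ∀ a ≤ 1, ∀ (γ : ℕ → ℂ) (A : ℝ), 0 ≤ A → (∀ u : ℕ, u ≠ 0 → ‖γ u‖ ≤ A * (u : ℝ) ^ (-ρ)) →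
    ∀ S : DirichletCharacter ℂ q → ℂ,
    (∀ χ ∈ parityFamily q a, HasSum (fun u : ℕ => χ u * γ u) (S χ)) →
    ‖average a S - γ 1‖ ≤ C * A / q := by
  obtain ⟨C, hC, h⟩ := exists_average_bilinear_le hρ
  refine ⟨C, hC, fun q hq h2 a ha γ A hA hγ S hS => ?_⟩
  refine h q h2 a ha (fun p => if p.2 = 1 then γ p.1 else 0) A hA ?_ S ?_ (γ 1) ?_
  · intro u v hu _
    split_ifs with hv
    · subst hv
      simpa using hγ u hu
    · simp only [norm_zero]; positivity
  · intro χ hχ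
    have hinj : Function.Injective fun u : ℕ => (u, 1) := fun u v huv => congrArg Prod.fst huv
    rw [← hinj.hasSum_iff]
    · refine (hS χ hχ).congr_fun fun u => ?_
      simp [mul_comm]
    · rintro ⟨u, v⟩ hp
      simp only
      rw [if_neg, zero_mul]
      rintro rfl
      exact hp ⟨u, rfl⟩
  · have := _root_.hasSum_single (f := fun u : ℕ => if q ∣ u then 0 else if u = 1 then γ u else 0) 1 fun u hu => by
      simp [hu]
    simpa [hq.out.one_lt.ne', hq.out.ne_one] using this

end Mollifier

section FirstMoment

open Finset

lemma abs_coeff_le {Y : ℕ} {c : ℕ → ℝ} {C η Z : ℝ} (hη : 0 ≤ η) (hC0 : 0 ≤ C)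
    (hC : ∀ n : ℕ, (n.divisors.card : ℝ) ≤ C * (n : ℝ) ^ η) (hYZ : (Y : ℝ) ≤ Z)
    (hc : ∀ m ∈ Icc 1 Y, |c m| ≤ m.divisors.card * (m : ℝ) ^ (-(1 / 2) : ℝ)) :
    ∀ m ∈ Icc 1 Y, |c m| ≤ (C * Z ^ η) * (m : ℝ) ^ (-(1 / 2) : ℝ) := by
  intro m hm
  have hmY : (m : ℝ) ≤ Y := by exact_mod_cast (mem_Icc.mp hm).2
  refine (hc m hm).trans ?_
  gcongr
  refine (hC m).trans ?_
  gcongr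
  exact hmY.trans hYZ

lemma exp_neg_mul_sub_log {B x Q e : ℝ} (hx : 0 < x) (hQ : 0 < Q) :
    Real.exp (-(B * (Real.log x - e * Real.log Q))) = Q ^ (e * B) * x ^ (-B) := by
  rw [Real.rpow_def_of_pos hQ, Real.rpow_def_of_pos hx, ← Real.exp_add]
  ring_nf

variable {q : ℕ} [hq : Fact q.Prime]

/-- The dual sum in the unbalanced approximate functional equation is negligible. -/
lemma exists_norm_long_sum_le : ∃ C : ℝ, 0 < C ∧ ∀ (q : ℕ) [Fact q.Prime], ∀ a ≤ 1,
    ∀ χ : DirichletCharacter ℂ q, HasParity χ a →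
    ‖∫ v : ℝ, if (1 / 2 + 1 / 32 : ℝ) * Real.log q < v then logTheta a χ v else 0‖ ≤ C * (q : ℝ) ^ (-2 : ℝ) := by
  obtain ⟨C, hC, hw⟩ := exists_weight_le_exp (B := 64) (by norm_num)
  have hsum : Summable fun n : ℕ => (n : ℝ) ^ (-64 : ℝ) := Real.summable_nat_rpow.mpr (by norm_num)
  refine ⟨C * (∑' n : ℕ, (n : ℝ) ^ (-64 : ℝ) + 1), ?_, fun q hq a ha χ hχ => ?_⟩
  · have : 0 ≤ ∑' n : ℕ, (n : ℝ) ^ (-64 : ℝ) := tsum_nonneg fun n => by positivity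
    positivity
  have hq0 : (0 : ℝ) < q := by exact_mod_cast hq.out.pos
  have hb := hsum.hasSum.mul_left (C * (q : ℝ) ^ (-2 : ℝ))
  refine ((hasSum_single hχ _).norm_le_of_bounded hb fun n => ?_).trans ?_
  · rcases Nat.eq_zero_or_pos n with rfl | hn
    · simp
    have hn0 : (0 : ℝ) < n := by exact_mod_cast hn
    have hn1 : (1 : ℝ) ≤ n := by exact_mod_cast hn
    rw [norm_mul, Complex.norm_real, Real.norm_of_nonneg (mul_nonneg (by positivity) (weight_nonneg _ _))]
    calc _ ≤ 1 * (1 * (C * ((q : ℝ) ^ (-2 : ℝ) * (n : ℝ) ^ (-64 : ℝ)))) := by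
          gcongr
          · exact mul_nonneg (by positivity) (weight_nonneg _ _)
          · exact norm_chi_le _ _
          · exact weight_nonneg _ _
          · exact Real.rpow_le_one_of_one_le_of_nonpos hn1 (by norm_num)
          · refine (hw a ha _).trans (le_of_eq ?_)
            rw [show ((1 / 2 + 1 / 32 : ℝ) * Real.log q + (Real.log n - Real.log q / 2)) =
              Real.log n - (-(1 / 32) : ℝ) * Real.log q by ring, exp_neg_mul_sub_log hn0 hq0]
            norm_num
      _ = _ := by ring
  · have : 0 ≤ C * (q : ℝ) ^ (-2 : ℝ) := by positivity
    nlinarith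

/-- The mollified first moment. -/
lemma exists_first_moment : ∃ C : ℝ, 0 < C ∧ ∀ (q : ℕ) [Fact q.Prime], q ≠ 2 → ∀ a ≤ 1, ∀ Y : ℕ, 1 ≤ Y →
    (Y : ℝ) ≤ (q : ℝ) ^ (1 / 2 : ℝ) → ∀ c : ℕ → ℝ,
    (∀ m ∈ Icc 1 Y, |c m| ≤ m.divisors.card * (m : ℝ) ^ (-(1 / 2) : ℝ)) →
    ‖average a (fun χ : DirichletCharacter ℂ q => (kernelMass a : ℂ) * χ.LFunction (1 / 2) * mollifier Y c χ) -
      kernelMass a * c 1‖ ≤ C * (q : ℝ) ^ (-(1 / 16) : ℝ) := by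
  obtain ⟨C₁, hC₁, hw⟩ := exists_weight_le_exp (B := 9 / 16) (by norm_num)
  obtain ⟨C₂, hC₂, hd⟩ := exists_card_divisors_le (η := 1 / 32) (by norm_num)
  obtain ⟨C₃, hC₃, hlin⟩ := exists_average_linear_le (ρ := 1 + 1 / 32) (by norm_num)
  obtain ⟨C₄, hC₄, hlong⟩ := exists_norm_long_sum_le
  obtain ⟨C₅, hC₅, hk⟩ := exists_kernelMass_sub_weight_le
  refine ⟨C₃ * (C₁ * C₂ * C₂) + C₅ + 2 * (C₄ * C₂), by positivity, fun q hq h2 a ha Y hY hYq c hc => ?_⟩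
  have hq0 : (0 : ℝ) < q := by exact_mod_cast hq.out.pos
  have hq1 : (1 : ℝ) ≤ q := by exact_mod_cast hq.out.one_le
  have hc1 := hc 1 (by simp [hY])
  simp only [Nat.divisors_one, card_singleton, Nat.cast_one, Real.one_rpow, mul_one] at hc1
  have hcX := abs_coeff_le (by norm_num) (by positivity) hd hYq hc
  set X := C₂ * ((q : ℝ) ^ (1 / 2 : ℝ)) ^ (1 / 32 : ℝ) with hXdef
  have hX : 0 ≤ X := by positivity
  set t : ℝ := -((1 / 2 + 1 / 32) * Real.log q) with ht
  set F : ℕ → ℂ := fun n => (((n : ℝ) ^ (-(1 / 2) : ℝ) * weight a (t + (Real.log n - Real.log q / 2)) : ℝ) : ℂ) with hF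
  set S : DirichletCharacter ℂ q → ℂ := fun χ => mollifier Y c χ * ∫ v : ℝ, if t < v then logTheta a χ v else 0
  set R : DirichletCharacter ℂ q → ℂ := fun χ => mollifier Y c χ *
    (rootNumber a χ * ∫ v : ℝ, if -t < v then logTheta a χ⁻¹ v else 0)
  have hsplit : average a (fun χ : DirichletCharacter ℂ q => (kernelMass a : ℂ) * χ.LFunction (1 / 2) * mollifier Y c χ) =
      average a S + average a R := by
    rw [← average_add]
    refine average_congr fun χ hχ => ?_
    obtain ⟨h1, hp⟩ := (mem_parityFamily ha).mp hχ
    rw [single_eq_add h1 hp t]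
    simp only [S, R]
    ring
  have hF1 : F 1 = weight a (-((1 + 1 / 32) * Real.log q)) := by
    simp only [hF, ht]
    norm_num
    congr 1
    ring
  have hS : ‖average a S - c 1 * F 1‖ ≤ C₃ * (C₁ * C₂ * C₂) * (q : ℝ) ^ (-(1 / 16) : ℝ) := by
    have hFle : ∀ n : ℕ, n ≠ 0 → ‖F n‖ ≤ C₁ * (q : ℝ) ^ ((1 + 1 / 32) * (9 / 16) : ℝ) * (n : ℝ) ^ (-(17 / 16) : ℝ) := by
      intro n hn
      have hn0 : (0 : ℝ) < n := by positivity
      rw [Complex.norm_real, Real.norm_of_nonneg (mul_nonneg (by positivity) (weight_nonneg _ _))]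
      calc _ ≤ (n : ℝ) ^ (-(1 / 2) : ℝ) * (C₁ * ((q : ℝ) ^ ((1 + 1 / 32) * (9 / 16) : ℝ) * (n : ℝ) ^ (-(9 / 16) : ℝ))) := by
            gcongr
            refine (hw a ha _).trans (le_of_eq ?_)
            rw [← exp_neg_mul_sub_log hn0 hq0]
            congr 3
            rw [ht]; ring
        _ = _ := by
            rw [show (-(17 / 16) : ℝ) = -(1 / 2) + -(9 / 16) by norm_num, Real.rpow_add hn0]
            ring
    have h := hlin q h2 a ha (mollify Y c F) (C₁ * (q : ℝ) ^ ((1 + 1 / 32) * (9 / 16) : ℝ) * X * C₂ * (Y : ℝ) ^ (17 / 16 - 1 / 2 : ℝ))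
      (by positivity) (fun u hu => by
        have := norm_mollify_le (by norm_num) hX (by positivity) hcX hFle hd hu
        rwa [show -(17 / 16 - 1 / 32 : ℝ) = -(1 + 1 / 32) by norm_num] at this) S
      (fun χ hχ => hasSum_mollify Y c (hasSum_single ((mem_parityFamily ha).mp hχ).2 t))
    rw [mollify_one hY] at h
    refine h.trans ?_
    calc _ ≤ C₃ * (C₁ * (q : ℝ) ^ ((1 + 1 / 32) * (9 / 16) : ℝ) * X * C₂ * ((q : ℝ) ^ (1 / 2 : ℝ)) ^ (17 / 16 - 1 / 2 : ℝ)) / q := by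
          gcongr
      _ = C₃ * (C₁ * C₂ * C₂) * ((q : ℝ) ^ ((1 + 1 / 32) * (9 / 16) : ℝ) * (q : ℝ) ^ (1 / 2 * (1 / 32) : ℝ) *
            (q : ℝ) ^ (1 / 2 * (17 / 16 - 1 / 2) : ℝ) * (q : ℝ) ^ (-1 : ℝ)) := by
          rw [hXdef, Real.rpow_mul hq0.le (1 / 2) (1 / 32), Real.rpow_mul hq0.le (1 / 2) (17 / 16 - 1 / 2), Real.rpow_neg_one]
          ring
      _ ≤ _ := by
          rw [← Real.rpow_add hq0, ← Real.rpow_add hq0, ← Real.rpow_add hq0]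
          gcongr
          norm_num
  have hR : ‖average a R‖ ≤ 2 * (C₄ * C₂) * (q : ℝ) ^ (-(1 / 16) : ℝ) := by
    have hB : ∀ χ ∈ parityFamily q a, ‖R χ‖ ≤ C₄ * C₂ * (q : ℝ) ^ (-(1 / 16) : ℝ) := by
      intro χ hχ
      obtain ⟨h1, hp⟩ := (mem_parityFamily ha).mp hχ
      simp only [R, norm_mul]
      rw [norm_rootNumber h1 hp, one_mul, ht, neg_neg]
      calc _ ≤ X * (q : ℝ) ^ (1 / 2 : ℝ) * (C₄ * (q : ℝ) ^ (-2 : ℝ)) := by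
            gcongr
            · exact (norm_mollifier_le hX hcX χ).trans (by gcongr)
            · exact hlong q a ha _ hp.inv
        _ = C₄ * C₂ * ((q : ℝ) ^ (1 / 2 * (1 / 32) : ℝ) * (q : ℝ) ^ (1 / 2 : ℝ) * (q : ℝ) ^ (-2 : ℝ)) := by
            rw [hXdef, Real.rpow_mul hq0.le]
            ring
        _ ≤ _ := by
          rw [← Real.rpow_add hq0, ← Real.rpow_add hq0]
          gcongr
          norm_num
    refine (norm_average_le (by positivity) hB).trans (le_of_eq ?_)
    ring
  have hW : ‖(c 1 : ℂ) * F 1 - kernelMass a * c 1‖ ≤ C₅ * (q : ℝ) ^ (-(1 / 16) : ℝ) := by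
    rw [hF1, ← Complex.ofReal_mul, ← Complex.ofReal_mul, ← Complex.ofReal_sub, Complex.norm_real, Real.norm_eq_abs,
      show c 1 * weight a (-((1 + 1 / 32) * Real.log q)) - kernelMass a * c 1 =
        c 1 * -(kernelMass a - weight a (-((1 + 1 / 32) * Real.log q))) by ring, abs_mul, abs_neg,
      abs_of_nonneg (sub_nonneg.mpr (weight_le _ _))]
    calc _ ≤ 1 * (C₅ * (q : ℝ) ^ (-(1 / 16) : ℝ)) := by
          gcongr
          · exact sub_nonneg.mpr (weight_le _ _)
          refine (hk a ha _).trans ?_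
          rw [Real.rpow_def_of_pos hq0]
          refine mul_le_mul_of_nonneg_left (Real.exp_le_exp.mpr ?_) hC₅.le
          have := Real.log_nonneg hq1
          linarith
      _ = _ := one_mul _
  rw [hsplit, show average a S + average a R - kernelMass a * c 1 = (average a S - c 1 * F 1) +
    ((c 1 : ℂ) * F 1 - kernelMass a * c 1) + average a R by ring]
  refine (norm_add_le _ _).trans ((add_le_add ((norm_add_le _ _).trans (add_le_add hS hW)) hR).trans (le_of_eq ?_))
  ring

end FirstMoment

section HarmonicWeight

open Finset MeasureTheory

/-- Partial sums of the harmonic series over all positive reals. -/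
lemma exists_abs_harmonic_sub_le : ∃ C : ℝ, 0 < C ∧ ∀ x : ℝ, 0 < x →
    |(harmonic (⌈x⌉₊ - 1) : ℝ) - (Real.log x + Real.eulerMascheroniConstant)| ≤ C * x ^ (-(19 / 20) : ℝ) := by
  refine ⟨4, by norm_num, fun x hx => ?_⟩
  set γ := Real.eulerMascheroniConstant
  have hγ0 : 0 < γ := by linarith [Real.one_half_lt_eulerMascheroniConstant]
  have hγ1 : γ < 1 := by linarith [Real.eulerMascheroniConstant_lt_two_thirds]
  rcases le_or_gt x 1 with h1 | h1
  · have hc : ⌈x⌉₊ - 1 = 0 := by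
      have : ⌈x⌉₊ ≤ 1 := Nat.ceil_le.mpr (by exact_mod_cast h1)
      omega
    have hl := Real.log_le_rpow_div (x := x⁻¹) (by positivity) (ε := 19 / 20) (by norm_num)
    rw [Real.log_inv, Real.inv_rpow hx.le, ← Real.rpow_neg hx.le] at hl
    have hl0 : Real.log x ≤ 0 := Real.log_nonpos hx.le h1
    have hx1 : 1 ≤ x ^ (-(19 / 20) : ℝ) := Real.one_le_rpow_of_pos_of_le_one_of_nonpos hx h1 (by norm_num)
    rw [le_div_iff₀ (by norm_num)] at hl
    rw [hc, harmonic_zero, abs_le]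
    push_cast
    constructor <;> linarith
  · obtain ⟨n, hn⟩ : ∃ n, ⌈x⌉₊ = n + 1 := ⟨⌈x⌉₊ - 1, by
      have : 0 < ⌈x⌉₊ := Nat.ceil_pos.mpr hx
      omega⟩
    have hx2 : x ≤ n + 1 := by have := Nat.le_ceil x; rw [hn] at this; exact_mod_cast this
    have hx3 : (n : ℝ) < x := by
      have := Nat.ceil_lt_add_one hx.le
      rw [hn] at this; push_cast at this; linarith
    have hn1 : 1 ≤ n := by
      by_contra h
      have : n = 0 := by omega
      subst this
      norm_num at hx2
      linarith
    have hn1' : (1 : ℝ) ≤ n := by exact_mod_cast hn1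
    have hs := Real.eulerMascheroniSeq_lt_eulerMascheroniConstant n
    have hs' := Real.eulerMascheroniConstant_lt_eulerMascheroniSeq' n
    rw [Real.eulerMascheroniSeq] at hs
    rw [Real.eulerMascheroniSeq', if_neg (by omega)] at hs'
    have l1 : Real.log (n + 1) - Real.log x ≤ 1 / x := by
      rw [← Real.log_div (by positivity) hx.ne']
      refine (Real.log_le_sub_one_of_pos (by positivity)).trans ?_
      rw [div_sub_one hx.ne']
      gcongr
      linarith
    have l2 : Real.log x - Real.log n ≤ 2 / x := by
      rw [← Real.log_div hx.ne' (by positivity)]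
      refine (Real.log_le_sub_one_of_pos (by positivity)).trans ?_
      rw [div_sub_one (by positivity), div_le_div_iff₀ (by positivity) hx]
      nlinarith
    have hx4 : 1 / x ≤ x ^ (-(19 / 20) : ℝ) := by
      rw [one_div, ← Real.rpow_neg_one]
      exact Real.rpow_le_rpow_of_exponent_le h1.le (by norm_num)
    have hx5 : 2 / x = 2 * (1 / x) := by ring
    have hx6 : 0 < 1 / x := by positivity
    rw [hn, Nat.add_sub_cancel, abs_le]
    constructor <;> linarith

lemma hasSum_harmonic {x : ℝ} (hx : 0 < x) (z : ℝ) :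
    HasSum (fun k : ℕ => if (k : ℝ) < x then (k : ℝ)⁻¹ * z else 0) ((harmonic (⌈x⌉₊ - 1) : ℝ) * z) := by
  have hc : 0 < ⌈x⌉₊ := Nat.ceil_pos.mpr hx
  rw [harmonic_eq_sum_Icc]
  push_cast
  rw [sum_mul]
  have h : ∀ k ∈ Icc 1 (⌈x⌉₊ - 1), (k : ℝ)⁻¹ * z = if (k : ℝ) < x then (k : ℝ)⁻¹ * z else 0 := by
    intro k hk
    rw [if_pos]
    have := (mem_Icc.mp hk).2
    exact Nat.lt_ceil.mp (by omega)
  rw [sum_congr rfl h]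
  refine hasSum_sum_of_ne_finset_zero fun k hk => ?_
  split_ifs with hkx
  · have : k = 0 := by
      by_contra h0
      apply hk
      have := Nat.lt_ceil.mpr hkx
      rw [mem_Icc]; omega
    simp [this]
  · rfl

lemma integrable_mul_logKernel₂ (a : ℕ) : Integrable fun p : ℝ × ℝ => (p.1 + p.2) * logKernel₂ a p := by
  have h1 := integrable_exp_mul_logKernel₂ a (B := 1 / 4) (by norm_num)
  have h2 := integrable_exp_mul_logKernel₂ a (B := -(1 / 4)) (by norm_num)
  have hc := continuous_logKernel₂ a
  refine ((h1.add h2).const_mul 4).mono' (by fun_prop) (Filter.Eventually.of_forall fun p => ?_)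
  have hk := logKernel₂_nonneg a p
  rw [norm_mul, Real.norm_eq_abs, Real.norm_of_nonneg hk]
  have e1 := Real.add_one_le_exp (1 / 4 * (p.1 + p.2))
  have e2 := Real.add_one_le_exp (-(1 / 4) * (p.1 + p.2))
  have e3 := Real.exp_pos (1 / 4 * (p.1 + p.2))
  have e4 := Real.exp_pos (-(1 / 4) * (p.1 + p.2))
  have : |p.1 + p.2| ≤ 4 * (Real.exp (1 / 4 * (p.1 + p.2)) + Real.exp (-(1 / 4) * (p.1 + p.2))) := by
    rw [abs_le]; constructor <;> linarith
  calc _ ≤ _ := mul_le_mul_of_nonneg_right this hk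
    _ = _ := by simp only [Pi.add_apply]; ring

lemma summable_inv_mul_weight₂ {a : ℕ} (ha : a ≤ 1) (L : ℝ) :
    Summable fun k : ℕ => (k : ℝ)⁻¹ * weight₂ a (2 * Real.log k - L) := by
  obtain ⟨C, hC, hw⟩ := exists_weight₂_le_exp (B := 1 / 2) (by norm_num)
  have hs : Summable fun n : ℕ => (n : ℝ) ^ (-2 : ℝ) := Real.summable_nat_rpow.mpr (by norm_num)
  refine Summable.of_nonneg_of_le (fun k => mul_nonneg (by positivity) (weight₂_nonneg _ _)) (fun k => ?_)
    (hs.mul_left (C * Real.exp (L / 2)))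
  rcases Nat.eq_zero_or_pos k with rfl | hk
  · simp
  have hk0 : (0 : ℝ) < k := by exact_mod_cast hk
  calc _ ≤ (k : ℝ)⁻¹ * (C * Real.exp (-(1 / 2 * (2 * Real.log k - L)))) := by
        gcongr
        exact hw a ha _
    _ = _ := by
        rw [show -(1 / 2 * (2 * Real.log k - L)) = L / 2 + -Real.log k by ring, Real.exp_add, Real.exp_neg,
          Real.exp_log hk0, show (-2 : ℝ) = -1 + -1 by norm_num, Real.rpow_add hk0, Real.rpow_neg_one]
        ring

/-- The smoothed harmonic sums are asymptotically logarithmic. -/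
lemma exists_hasSum_inv_mul_weight₂ : ∃ C : ℝ, 0 < C ∧ ∃ c : ℕ → ℝ, ∀ a ≤ 1, ∀ L : ℝ, ∃ H : ℝ,
    HasSum (fun k : ℕ => (k : ℝ)⁻¹ * weight₂ a (2 * Real.log k - L)) H ∧
    |H - (kernelMass a ^ 2 * (L / 2) + c a)| ≤ C * Real.exp (-(19 / 40 * L)) := by
  obtain ⟨C, hC, hh⟩ := exists_abs_harmonic_sub_le
  set D : ℕ → ℝ := fun a => ∫ p : ℝ × ℝ, Real.exp (-(19 / 40) * (p.1 + p.2)) * logKernel₂ a p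
  refine ⟨C * (|D 0| + |D 1| + 1), by positivity, fun a => (∫ p : ℝ × ℝ, (p.1 + p.2) * logKernel₂ a p) / 2 +
    kernelMass a ^ 2 * Real.eulerMascheroniConstant, fun a ha L => ?_⟩
  set x : ℝ × ℝ → ℝ := fun p => Real.exp ((L + (p.1 + p.2)) / 2) with hx
  set G : ℝ × ℝ → ℝ := fun p => (harmonic (⌈x p⌉₊ - 1) : ℝ) * logKernel₂ a p with hG
  set F : ℕ → ℝ × ℝ → ℝ := fun k p => if 2 * Real.log k - L < p.1 + p.2 then (k : ℝ)⁻¹ * logKernel₂ a p else 0 with hF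
  have hFk : ∀ k p, F k p = (k : ℝ)⁻¹ * if 2 * Real.log k - L < p.1 + p.2 then logKernel₂ a p else 0 := by
    intro k p; simp only [hF]; split_ifs <;> simp
  have hFint : ∀ k, ∫ p, F k p = (k : ℝ)⁻¹ * weight₂ a (2 * Real.log k - L) := fun k => by
    simp_rw [hFk]
    rw [integral_const_mul]
    rfl
  have hFI : ∀ k, Integrable (F k) := fun k => by
    have := (integrable_tail (s := fun p : ℝ × ℝ => p.1 + p.2) (by fun_prop) (integrable_logKernel₂ a)
      (2 * Real.log k - L)).const_mul (k : ℝ)⁻¹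
    exact this.congr (Filter.Eventually.of_forall fun p => (hFk k p).symm)
  have hF0 : ∀ k p, 0 ≤ F k p := fun k p => by
    simp only [hF]; split_ifs
    · exact mul_nonneg (by positivity) (logKernel₂_nonneg a p)
    · rfl
  have hFG : ∀ p, HasSum (fun k => F k p) (G p) := fun p => by
    refine (hasSum_harmonic (Real.exp_pos _) _).congr_fun fun k => ?_
    rcases Nat.eq_zero_or_pos k with rfl | hk
    · simp [hF]
    have hk0 : (0 : ℝ) < k := by exact_mod_cast hk
    refine if_congr ?_ rfl rfl
    rw [← Real.log_lt_iff_lt_exp hk0]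
    constructor <;> intro h <;> linarith
  have hmain : HasSum (fun k : ℕ => (k : ℝ)⁻¹ * weight₂ a (2 * Real.log k - L)) (∫ p, G p) := by
    have h := hasSum_integral_of_summable_integral_norm hFI (by
      simp_rw [fun k p => Real.norm_of_nonneg (hF0 k p), hFint]
      exact summable_inv_mul_weight₂ ha L)
    simp_rw [hFint, fun p => (hFG p).tsum_eq] at h
    exact h
  refine ⟨_, hmain, ?_⟩
  set P : ℝ × ℝ → ℝ := fun p => ((L + (p.1 + p.2)) / 2 + Real.eulerMascheroniConstant) * logKernel₂ a p with hP
  have hPI : Integrable P := by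
    have := ((integrable_mul_logKernel₂ a).const_mul (1 / 2)).add
      ((integrable_logKernel₂ a).const_mul (L / 2 + Real.eulerMascheroniConstant))
    refine this.congr (Filter.Eventually.of_forall fun p => ?_)
    simp only [hP, Pi.add_apply]; ring
  have hPint : ∫ p, P p = kernelMass a ^ 2 * (L / 2) + ((∫ p : ℝ × ℝ, (p.1 + p.2) * logKernel₂ a p) / 2 +
      kernelMass a ^ 2 * Real.eulerMascheroniConstant) := by
    have : P = fun p => 1 / 2 * ((p.1 + p.2) * logKernel₂ a p) + (L / 2 + Real.eulerMascheroniConstant) * logKernel₂ a p := by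
      funext p; simp only [hP]; ring
    rw [this, integral_add ((integrable_mul_logKernel₂ a).const_mul _) ((integrable_logKernel₂ a).const_mul _),
      integral_const_mul, integral_const_mul, integral_logKernel₂]
    ring
  have hE := (integrable_exp_mul_logKernel₂ a (B := -(19 / 40)) (by norm_num)).const_mul (C * Real.exp (-(19 / 40 * L)))
  have hbound : ∀ p, ‖G p - P p‖ ≤ C * Real.exp (-(19 / 40 * L)) * (Real.exp (-(19 / 40) * (p.1 + p.2)) * logKernel₂ a p) := by
    intro p
    have h := hh (x p) (Real.exp_pos _)
    have hxp : (x p) ^ (-(19 / 20) : ℝ) = Real.exp (-(19 / 40 * L)) * Real.exp (-(19 / 40) * (p.1 + p.2)) := by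
      rw [hx, ← Real.exp_mul, ← Real.exp_add]; congr 1; ring
    rw [hxp, hx, Real.log_exp] at h
    have hk := logKernel₂_nonneg a p
    rw [hG, hP, ← sub_mul, norm_mul, Real.norm_eq_abs, Real.norm_of_nonneg hk]
    calc _ ≤ _ := mul_le_mul_of_nonneg_right h hk
      _ = _ := by ring
  have hGm : AEStronglyMeasurable G := by
    have h1 : Measurable fun p : ℝ × ℝ => ⌈x p⌉₊ := Nat.measurable_ceil.comp (by fun_prop)
    have h2 : Measurable fun n : ℕ => (harmonic (n - 1) : ℝ) := measurable_from_top
    exact ((h2.comp h1).mul (continuous_logKernel₂ a).measurable).aestronglyMeasurable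
  have hGP : Integrable fun p => G p - P p :=
    hE.mono' (hGm.sub hPI.aestronglyMeasurable) (Filter.Eventually.of_forall hbound)
  have hGI : Integrable G := by
    refine (hGP.add hPI).congr (Filter.Eventually.of_forall fun p => ?_)
    simp
  rw [← hPint, ← integral_sub hGI hPI, ← Real.norm_eq_abs]
  refine (norm_integral_le_of_norm_le hE (Filter.Eventually.of_forall hbound)).trans ?_
  rw [integral_const_mul, mul_assoc, mul_comm (Real.exp _), ← mul_assoc]
  gcongr
  interval_cases a
  · exact (le_abs_self (D 0)).trans (by linarith [abs_nonneg (D 1)])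
  · exact (le_abs_self (D 1)).trans (by linarith [abs_nonneg (D 0)])

end HarmonicWeight

section SecondMoment

open Finset

/-- The coefficients of the product of a double Dirichlet series with two mollifiers. -/
noncomputable def mollify₂ (Y : ℕ) (c : ℕ → ℝ) (F : ℕ × ℕ → ℂ) (p : ℕ × ℕ) : ℂ :=
  ∑ m ∈ Icc 1 Y, ∑ m' ∈ Icc 1 Y,
    if m ∣ p.1 ∧ m' ∣ p.2 then (c m : ℂ) * c m' * F (p.1 / m, p.2 / m') else 0

lemma mollify₂_eq (Y : ℕ) (c : ℕ → ℝ) (F : ℕ × ℕ → ℂ) (u v : ℕ) :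
    mollify₂ Y c F (u, v) = mollify Y c (fun n => mollify Y c (fun n' => F (n, n')) v) u := by
  simp only [mollify₂, mollify]
  refine sum_congr rfl fun m _ => ?_
  split_ifs with h
  · rw [mul_sum]
    refine sum_congr rfl fun m' _ => ?_
    by_cases h' : m' ∣ v <;> simp [h, h', mul_assoc]
  · simp [h]

lemma hasSum_mollify₂ {q : ℕ} {χ : DirichletCharacter ℂ q} {F : ℕ × ℕ → ℂ} {A : ℂ} (Y : ℕ) (c : ℕ → ℝ)
    (h : HasSum (fun n : ℕ × ℕ => F n * (χ n.1 * χ⁻¹ n.2)) A) :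
    HasSum (fun p : ℕ × ℕ => mollify₂ Y c F p * (χ p.1 * χ⁻¹ p.2)) (mollifier Y c χ * mollifier Y c χ⁻¹ * A) := by
  have hm : ∀ m ∈ Icc 1 Y, ∀ m' ∈ Icc 1 Y, HasSum (fun p : ℕ × ℕ => (c m : ℂ) * χ m * (c m' * χ⁻¹ m') *
      if m ∣ p.1 ∧ m' ∣ p.2 then F (p.1 / m, p.2 / m') *
        (χ ((p.1 / m : ℕ) : ZMod q) * χ⁻¹ ((p.2 / m' : ℕ) : ZMod q)) else 0) (c m * χ m * (c m' * χ⁻¹ m') * A) :=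
    fun m hm m' hm' => ((hasSum_mul_left_prod_iff (f := fun n : ℕ × ℕ => F n * (χ n.1 * χ⁻¹ n.2))
      (by have := (mem_Icc.mp hm).1; omega) (by have := (mem_Icc.mp hm').1; omega)).mpr h).mul_left _
  rw [mollifier, mollifier, sum_mul_sum, sum_mul]
  simp_rw [sum_mul]
  refine (hasSum_sum fun m h1 => hasSum_sum fun m' h2 => hm m h1 m' h2).congr_fun fun p => ?_
  obtain ⟨u, v⟩ := p
  simp only [mollify₂, sum_mul]
  refine sum_congr rfl fun m hm1 => sum_congr rfl fun m' hm1' => ?_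
  split_ifs with hd
  · obtain ⟨⟨k, rfl⟩, ⟨l, rfl⟩⟩ := hd
    rw [Nat.mul_div_cancel_left _ (mem_Icc.mp hm1).1, Nat.mul_div_cancel_left _ (mem_Icc.mp hm1').1]
    push_cast
    rw [map_mul, map_mul]
    ring
  · simp

lemma norm_mollify₂_le {Y : ℕ} {c : ℕ → ℝ} {F : ℕ × ℕ → ℂ} {X A C ρ η : ℝ} (hρ : 1 / 2 ≤ ρ) (hX : 0 ≤ X) (hA : 0 ≤ A)
    (hC0 : 0 ≤ C) (hc : ∀ m ∈ Icc 1 Y, |c m| ≤ X * (m : ℝ) ^ (-(1 / 2) : ℝ))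
    (hF : ∀ n n' : ℕ, n ≠ 0 → n' ≠ 0 → ‖F (n, n')‖ ≤ A * ((n : ℝ) * n') ^ (-ρ))
    (hC : ∀ n : ℕ, (n.divisors.card : ℝ) ≤ C * (n : ℝ) ^ η) {u v : ℕ} (hu : u ≠ 0) (hv : v ≠ 0) :
    ‖mollify₂ Y c F (u, v)‖ ≤ A * (X * C * (Y : ℝ) ^ (ρ - 1 / 2)) ^ 2 * ((u : ℝ) * v) ^ (-(ρ - η)) := by
  rw [mollify₂_eq]
  have h1 : ∀ n : ℕ, n ≠ 0 → ‖mollify Y c (fun n' => F (n, n')) v‖ ≤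
      (A * X * C * (Y : ℝ) ^ (ρ - 1 / 2) * (v : ℝ) ^ (-(ρ - η))) * (n : ℝ) ^ (-ρ) := fun n hn => by
    refine (norm_mollify_le (A := A * (n : ℝ) ^ (-ρ)) hρ hX (by positivity) hc (fun n' hn' => ?_) hC hv).trans
      (le_of_eq (by ring))
    refine (hF n n' hn hn').trans (le_of_eq ?_)
    rw [Real.mul_rpow (by positivity) (by positivity), mul_assoc]
  refine (norm_mollify_le hρ hX (by positivity) hc h1 hC hu).trans (le_of_eq ?_)
  rw [Real.mul_rpow (by positivity) (by positivity)]
  ring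

/-- Averaging a bilinear character sum, with the complete diagonal. -/
lemma exists_average_bilinear_sub_tsum_le {ρ : ℝ} (hρ : 1 < ρ) : ∃ C : ℝ, 0 < C ∧ ∀ (q : ℕ) [Fact q.Prime], q ≠ 2 →
    ∀ a ≤ 1, ∀ (γ : ℕ × ℕ → ℂ) (A : ℝ), 0 ≤ A → γ (0, 0) = 0 →
    (∀ u v : ℕ, u ≠ 0 → v ≠ 0 → ‖γ (u, v)‖ ≤ A * ((u : ℝ) * v) ^ (-ρ)) →
    ∀ S : DirichletCharacter ℂ q → ℂ,
    (∀ χ ∈ parityFamily q a, HasSum (fun p : ℕ × ℕ => γ p * (χ p.1 * χ⁻¹ p.2)) (S χ)) →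
    ∀ D : ℂ, HasSum (fun u : ℕ => γ (u, u)) D →
    ‖average a S - D‖ ≤ C * A / q := by
  obtain ⟨C, hC, h⟩ := exists_average_bilinear_le hρ
  have hsum : Summable fun n : ℕ => (n : ℝ) ^ (-ρ) := Real.summable_nat_rpow.mpr (by linarith)
  set Z := ∑' n : ℕ, (n : ℝ) ^ (-ρ)
  have hZ : 0 ≤ Z := tsum_nonneg fun p => by positivity
  refine ⟨C + Z, by positivity, fun q hq h2 a ha γ A hA hγ0 hγ S hS D hD => ?_⟩
  have hq0 : (0 : ℝ) < q := by exact_mod_cast hq.out.pos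
  have hq1 : (1 : ℝ) ≤ q := by exact_mod_cast hq.out.one_le
  have hbound : ∀ u : ℕ, ‖if q ∣ u then γ (u, u) else 0‖ ≤ A / q * (u : ℝ) ^ (-ρ) := fun u => by
    split_ifs with hu
    · rcases Nat.eq_zero_or_pos u with rfl | hu0
      · rw [hγ0, norm_zero]; positivity
      refine (hγ u u hu0.ne' hu0.ne').trans ?_
      have hqu : (q : ℝ) ≤ u := by exact_mod_cast Nat.le_of_dvd hu0 hu
      rw [Real.mul_rpow (by positivity) (by positivity), div_eq_mul_inv, mul_assoc]
      gcongr
      calc (u : ℝ) ^ (-ρ) ≤ (q : ℝ) ^ (-ρ) := Real.rpow_le_rpow_of_nonpos hq0 hqu (by linarith)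
        _ ≤ (q : ℝ) ^ (-1 : ℝ) := Real.rpow_le_rpow_of_exponent_le hq1 (by linarith)
        _ = _ := Real.rpow_neg_one _
    · rw [norm_zero]; positivity
  have hmul := (Summable.of_norm_bounded (hsum.mul_left _) hbound).hasSum
  have hE := hmul.norm_le_of_bounded (hsum.hasSum.mul_left (A / q)) hbound
  have hD' : HasSum (fun u : ℕ => if q ∣ u then 0 else γ (u, u)) (D - ∑' u : ℕ, if q ∣ u then γ (u, u) else 0) := by
    refine (hD.sub hmul).congr_fun fun u => ?_
    split_ifs <;> simp
  have h1 := h q h2 a ha γ A hA hγ S hS _ hD'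
  rw [show average a S - D = (average a S - (D - ∑' u : ℕ, if q ∣ u then γ (u, u) else 0)) -
    ∑' u : ℕ, if q ∣ u then γ (u, u) else 0 by ring]
  refine (norm_sub_le _ _).trans ((add_le_add h1 hE).trans (le_of_eq ?_))
  ring

/-- The product of the cofactors `lcm(m, m') / m` and `lcm(m, m') / m'`. -/
def cofactor (m m' : ℕ) : ℕ := m.lcm m' / m * (m.lcm m' / m')

lemma cofactor_pos {m m' : ℕ} (hm : 0 < m) (hm' : 0 < m') : 0 < cofactor m m' :=
  Nat.mul_pos (Nat.div_pos (Nat.le_of_dvd (Nat.lcm_pos hm hm') (Nat.dvd_lcm_left _ _)) hm)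
    (Nat.div_pos (Nat.le_of_dvd (Nat.lcm_pos hm hm') (Nat.dvd_lcm_right _ _)) hm')

lemma hasSum_diagonal {m m' : ℕ} (hm : 0 < m) (hm' : 0 < m') {a : ℕ} {ℓ H : ℝ} {F : ℕ × ℕ → ℂ}
    (hF : F = fun n : ℕ × ℕ => ((((n.1 : ℝ) * n.2) ^ (-(1 / 2) : ℝ) *
      weight₂ a (Real.log ((n.1 * n.2 : ℕ)) - ℓ) : ℝ) : ℂ))
    (h : HasSum (fun k : ℕ => (k : ℝ)⁻¹ * weight₂ a (2 * Real.log k - (ℓ - Real.log (cofactor m m')))) H) :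
    HasSum (fun u : ℕ => if m ∣ u ∧ m' ∣ u then F (u / m, u / m') else 0)
      (((cofactor m m' : ℝ) ^ (-(1 / 2) : ℝ) * H : ℝ) : ℂ) := by
  have hl : m.lcm m' ≠ 0 := (Nat.lcm_pos hm hm').ne'
  have h1 := (hasSum_mul_left_iff (m := m.lcm m') hl).mpr (Complex.hasSum_ofReal.mpr
    (h.mul_left ((cofactor m m' : ℝ) ^ (-(1 / 2) : ℝ))))
  refine h1.congr_fun fun u => ?_
  rw [if_congr (Nat.lcm_dvd_iff (m := m) (n := m') (k := u)).symm rfl rfl]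
  split_ifs with hu
  · obtain ⟨k, rfl⟩ := hu
    rw [Nat.mul_div_cancel_left _ (Nat.pos_of_ne_zero hl), hF]
    obtain ⟨r, hr⟩ := Nat.dvd_lcm_left m m'
    obtain ⟨s, hs⟩ := Nat.dvd_lcm_right m m'
    have e1 : m.lcm m' * k / m = r * k := by rw [hr, mul_assoc, Nat.mul_div_cancel_left _ hm]
    have e2 : m.lcm m' * k / m' = s * k := by rw [hs, mul_assoc, Nat.mul_div_cancel_left _ hm']
    have e3 : cofactor m m' = r * s := by
      rw [cofactor]; nth_rewrite 1 [hr]; rw [hs, Nat.mul_div_cancel_left _ hm, Nat.mul_div_cancel_left _ hm']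
    have hrs : 0 < r * s := e3 ▸ cofactor_pos hm hm'
    simp only [e1, e2, e3]
    rcases Nat.eq_zero_or_pos k with rfl | hk
    · norm_num
    have hk0 : (0 : ℝ) < k := by exact_mod_cast hk
    have hrs0 : (0 : ℝ) < r * s := by exact_mod_cast hrs
    congr 1
    push_cast
    rw [show (r : ℝ) * k * (s * k) = r * s * (k * k) by ring, Real.mul_rpow hrs0.le (by positivity),
      Real.log_mul hrs0.ne' (by positivity), Real.log_mul hk0.ne' hk0.ne', Real.mul_rpow hk0.le hk0.le,
      ← Real.rpow_add hk0, show (-(1 / 2) + -(1 / 2) : ℝ) = -1 by norm_num, Real.rpow_neg_one,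
      show Real.log (r * s) + (Real.log k + Real.log k) - ℓ = 2 * Real.log k - (ℓ - Real.log (r * s)) by ring]
    ring
  · rfl

lemma sum_rpow_neg_half_le (Y : ℕ) : ∑ m ∈ Icc 1 Y, (m : ℝ) ^ (-(1 / 2) : ℝ) ≤ 2 * (Y : ℝ) ^ (1 / 2 : ℝ) := by
  have key : ∀ n : ℕ, 1 ≤ n → (n : ℝ) ^ (-(1 / 2) : ℝ) = 1 / √n := fun n _ => by
    rw [Real.rpow_neg (by positivity), Real.sqrt_eq_rpow]
    exact (one_div _).symm
  rw [← Real.sqrt_eq_rpow, sum_congr rfl fun m hm => key m (mem_Icc.mp hm).1]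
  induction Y with
  | zero => simp
  | succ n ih =>
    rw [sum_Icc_succ_top (by omega)]
    refine (add_le_add_left ih _).trans ?_
    push_cast
    have h1 : 0 < √((n : ℝ) + 1) := by positivity
    have h2 := Real.sq_sqrt (show (0 : ℝ) ≤ n by positivity)
    have h3 := Real.sq_sqrt (show (0 : ℝ) ≤ (n : ℝ) + 1 by positivity)
    have h4 : √(n : ℝ) ≤ √((n : ℝ) + 1) := Real.sqrt_le_sqrt (by linarith)
    have h5 : 1 / √((n : ℝ) + 1) ≤ 2 * (√((n : ℝ) + 1) - √n) := by
      rw [div_le_iff₀ h1]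
      nlinarith [Real.sqrt_nonneg (n : ℝ)]
    linarith

end SecondMoment

section SecondMoment

open Finset MeasureTheory

lemma product_inv_eq {q : ℕ} [Fact q.Prime] {χ : DirichletCharacter ℂ q} (h1 : χ ≠ 1) {a : ℕ} (hp : HasParity χ a) :
    (kernelMass a : ℂ) ^ 2 * (χ.LFunction (1 / 2) * χ⁻¹.LFunction (1 / 2)) =
      2 * ∫ p : ℝ × ℝ, if 0 < p.1 + p.2 then logTheta a χ p.1 * logTheta a χ⁻¹ p.2 else 0 := by
  have h1' : χ⁻¹ ≠ 1 := inv_ne_one.mpr h1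
  rw [product_eq_add h1 h1' hp hp.inv 0, rootNumber_mul_inv h1 hp, neg_zero, one_mul, inv_inv, two_mul]
  congr 1
  have e1 := hasSum_product hp hp.inv 0
  have e2 := hasSum_product hp.inv (by simpa using hp) 0 (χ₂ := χ)
  refine HasSum.unique e2 ?_
  rw [← (Equiv.prodComm ℕ ℕ).hasSum_iff] at e1
  refine e1.congr_fun fun n => ?_
  simp only [Function.comp_apply, Equiv.prodComm_apply, Prod.fst_swap, Prod.snd_swap]
  rw [mul_comm (n.2 : ℝ), mul_comm n.2 n.1]
  ring

/-- The mollified second moment of absolute values. -/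
lemma exists_second_moment : ∃ C : ℝ, 0 < C ∧ ∃ k : ℕ → ℝ, ∀ (q : ℕ) [Fact q.Prime], q ≠ 2 → ∀ a ≤ 1, ∀ Y : ℕ, 1 ≤ Y →
    (Y : ℝ) ≤ (q : ℝ) ^ (2 / 5 : ℝ) → ∀ c : ℕ → ℝ,
    (∀ m ∈ Icc 1 Y, |c m| ≤ m.divisors.card * (m : ℝ) ^ (-(1 / 2) : ℝ)) →
    ‖average a (fun χ : DirichletCharacter ℂ q => (kernelMass a : ℂ) ^ 2 *
        (χ.LFunction (1 / 2) * χ⁻¹.LFunction (1 / 2)) * (mollifier Y c χ * mollifier Y c χ⁻¹)) -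
      ((∑ m ∈ Icc 1 Y, ∑ m' ∈ Icc 1 Y, c m * c m' * (cofactor m m' : ℝ) ^ (-(1 / 2) : ℝ) *
        (kernelMass a ^ 2 * (Real.log q - Real.log (cofactor m m')) + k a) : ℝ) : ℂ)‖ ≤
      C * (q : ℝ) ^ (-(1 / 16) : ℝ) := by
  obtain ⟨C₁, hC₁, hw⟩ := exists_weight₂_le_exp (B := 33 / 64) (by norm_num)
  obtain ⟨C₂, hC₂, hd⟩ := exists_card_divisors_le (η := 1 / 128) (by norm_num)
  obtain ⟨C₃, hC₃, hlin⟩ := exists_average_bilinear_sub_tsum_le (ρ := 1 + 1 / 128) (by norm_num)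
  obtain ⟨C₄, hC₄, k, hH⟩ := exists_hasSum_inv_mul_weight₂
  refine ⟨2 * (C₃ * (C₁ * (C₂ * C₂) ^ 2)) + 2 * (4 * C₄ * C₂ ^ 2), by positivity, fun a => 2 * k a,
    fun q hq h2 a ha Y hY hYq c hc => ?_⟩
  have hq0 : (0 : ℝ) < q := by exact_mod_cast hq.out.pos
  have hq1 : (1 : ℝ) ≤ q := by exact_mod_cast hq.out.one_le
  have hcX := abs_coeff_le (by norm_num) (by positivity) hd hYq hc
  set X := C₂ * ((q : ℝ) ^ (2 / 5 : ℝ)) ^ (1 / 128 : ℝ) with hXdef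
  have hX : 0 ≤ X := by positivity
  have hX2 : X = C₂ * (q : ℝ) ^ (1 / 320 : ℝ) := by
    rw [hXdef, ← Real.rpow_mul hq0.le]; norm_num
  set F : ℕ × ℕ → ℂ := fun n : ℕ × ℕ => ((((n.1 : ℝ) * n.2) ^ (-(1 / 2) : ℝ) *
      weight₂ a (Real.log ((n.1 * n.2 : ℕ)) - Real.log q) : ℝ) : ℂ) with hF
  set S : DirichletCharacter ℂ q → ℂ := fun χ => mollifier Y c χ * mollifier Y c χ⁻¹ *
    ∫ p : ℝ × ℝ, if 0 < p.1 + p.2 then logTheta a χ p.1 * logTheta a χ⁻¹ p.2 else 0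
  have hsplit : average a (fun χ : DirichletCharacter ℂ q => (kernelMass a : ℂ) ^ 2 *
      (χ.LFunction (1 / 2) * χ⁻¹.LFunction (1 / 2)) * (mollifier Y c χ * mollifier Y c χ⁻¹)) = 2 * average a S := by
    rw [← average_const_mul]
    refine average_congr fun χ hχ => ?_
    obtain ⟨h1, hp⟩ := (mem_parityFamily ha).mp hχ
    rw [product_inv_eq h1 hp]
    simp only [S]
    ring
  choose H hHs hHb using hH a ha
  set r : ℕ → ℕ → ℝ := fun m m' => (cofactor m m' : ℝ)
  have hr1 : ∀ m ∈ Icc 1 Y, ∀ m' ∈ Icc 1 Y, 1 ≤ r m m' := fun m hm m' hm' => by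
    simp only [r]
    exact_mod_cast cofactor_pos (mem_Icc.mp hm).1 (mem_Icc.mp hm').1
  set D : ℝ := ∑ m ∈ Icc 1 Y, ∑ m' ∈ Icc 1 Y, c m * c m' * (r m m' ^ (-(1 / 2) : ℝ) * H (Real.log q - Real.log (r m m')))
  have hD : HasSum (fun u : ℕ => mollify₂ Y c F (u, u)) (D : ℂ) := by
    simp only [D, mollify₂]
    push_cast
    refine hasSum_sum fun m hm => hasSum_sum fun m' hm' => ?_
    have := (hasSum_diagonal (mem_Icc.mp hm).1 (mem_Icc.mp hm').1 hF (hHs _)).mul_left ((c m : ℂ) * c m')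
    push_cast at this
    refine this.congr_fun fun u => ?_
    split_ifs <;> simp
  have hS : ‖average a S - D‖ ≤ C₃ * (C₁ * (C₂ * C₂) ^ 2) * (q : ℝ) ^ (-(1 / 16) : ℝ) := by
    have hFle : ∀ n n' : ℕ, n ≠ 0 → n' ≠ 0 → ‖F (n, n')‖ ≤ C₁ * (q : ℝ) ^ (33 / 64 : ℝ) * ((n : ℝ) * n') ^ (-(65 / 64) : ℝ) := by
      intro n n' hn hn'
      have hn0 : (0 : ℝ) < (n : ℝ) * n' := by positivity
      rw [Complex.norm_real, Real.norm_of_nonneg (mul_nonneg (by positivity) (weight₂_nonneg _ _))]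
      calc _ ≤ ((n : ℝ) * n') ^ (-(1 / 2) : ℝ) * (C₁ * ((q : ℝ) ^ (1 * (33 / 64) : ℝ) * ((n : ℝ) * n') ^ (-(33 / 64) : ℝ))) := by
            gcongr
            refine (hw a ha _).trans (le_of_eq ?_)
            rw [← exp_neg_mul_sub_log hn0 hq0]
            push_cast
            rw [one_mul]
        _ = _ := by
            rw [show (-(65 / 64) : ℝ) = -(1 / 2) + -(33 / 64) by norm_num, Real.rpow_add hn0, one_mul]
            ring
    have h0 : mollify₂ Y c F (0, 0) = 0 := by
      simp [mollify₂, hF]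
    have h := hlin q h2 a ha (mollify₂ Y c F) (C₁ * (q : ℝ) ^ (33 / 64 : ℝ) * (X * C₂ * (Y : ℝ) ^ (65 / 64 - 1 / 2 : ℝ)) ^ 2)
      (by positivity) h0 (fun u v hu hv => by
        have := norm_mollify₂_le (by norm_num) hX (by positivity) (by positivity) hcX hFle hd hu hv
        rwa [show -(65 / 64 - 1 / 128 : ℝ) = -(1 + 1 / 128) by norm_num] at this) S
      (fun χ hχ => hasSum_mollify₂ Y c (by
        have hp := ((mem_parityFamily ha).mp hχ).2
        refine (hasSum_product hp hp.inv 0).congr_fun fun n => ?_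
        simp only [hF, zero_add]
        ring)) D hD
    refine h.trans ?_
    calc _ ≤ C₃ * (C₁ * (q : ℝ) ^ (33 / 64 : ℝ) * (X * C₂ * ((q : ℝ) ^ (2 / 5 : ℝ)) ^ (65 / 64 - 1 / 2 : ℝ)) ^ 2) / q := by
          gcongr
      _ = C₃ * (C₁ * (C₂ * C₂) ^ 2) * ((q : ℝ) ^ (33 / 64 : ℝ) * ((q : ℝ) ^ (1 / 320 : ℝ) * (q : ℝ) ^ (1 / 320 : ℝ)) *
            ((q : ℝ) ^ (2 / 5 * (65 / 64 - 1 / 2) : ℝ) * (q : ℝ) ^ (2 / 5 * (65 / 64 - 1 / 2) : ℝ)) * (q : ℝ) ^ (-1 : ℝ)) := by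
          rw [hX2, Real.rpow_mul hq0.le (2 / 5), Real.rpow_neg_one]
          ring
      _ ≤ _ := by
          simp only [← Real.rpow_add hq0]
          gcongr
          norm_num
  have hM : |D - ∑ m ∈ Icc 1 Y, ∑ m' ∈ Icc 1 Y, c m * c m' * (r m m' ^ (-(1 / 2) : ℝ) *
      (kernelMass a ^ 2 * ((Real.log q - Real.log (r m m')) / 2) + k a))| ≤ 4 * C₄ * C₂ ^ 2 * (q : ℝ) ^ (-(1 / 16) : ℝ) := by
    simp only [D, ← sum_sub_distrib, ← mul_sub]
    calc _ ≤ ∑ m ∈ Icc 1 Y, ∑ m' ∈ Icc 1 Y, C₄ * (q : ℝ) ^ (-(19 / 40) : ℝ) * X ^ 2 * ((m : ℝ) ^ (-(1 / 2) : ℝ) * (m' : ℝ) ^ (-(1 / 2) : ℝ)) := by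
          refine (abs_sum_le_sum_abs _ _).trans (sum_le_sum fun m hm => (abs_sum_le_sum_abs _ _).trans (sum_le_sum fun m' hm' => ?_))
          have hr := hr1 m hm m' hm'
          have hr0 : 0 < r m m' := by linarith
          rw [abs_mul, abs_mul, abs_mul, abs_of_pos (show 0 < r m m' ^ (-(1 / 2) : ℝ) by positivity)]
          have hb := hHb (Real.log q - Real.log (r m m'))
          rw [show -(19 / 40 * (Real.log q - Real.log (r m m'))) = Real.log q * -(19 / 40) + Real.log (r m m') * (19 / 40) by ring,
            Real.exp_add, ← Real.rpow_def_of_pos hq0, ← Real.rpow_def_of_pos hr0] at hb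
          calc _ ≤ (X * (m : ℝ) ^ (-(1 / 2) : ℝ)) * (X * (m' : ℝ) ^ (-(1 / 2) : ℝ)) * (r m m' ^ (-(1 / 2) : ℝ) *
                (C₄ * ((q : ℝ) ^ (-(19 / 40) : ℝ) * r m m' ^ (19 / 40 : ℝ)))) := by
                gcongr
                · exact hcX m hm
                · exact hcX m' hm'
            _ = C₄ * (q : ℝ) ^ (-(19 / 40) : ℝ) * X ^ 2 * ((m : ℝ) ^ (-(1 / 2) : ℝ) * (m' : ℝ) ^ (-(1 / 2) : ℝ)) *
                (r m m' ^ (-(1 / 2) : ℝ) * r m m' ^ (19 / 40 : ℝ)) := by ring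
            _ ≤ C₄ * (q : ℝ) ^ (-(19 / 40) : ℝ) * X ^ 2 * ((m : ℝ) ^ (-(1 / 2) : ℝ) * (m' : ℝ) ^ (-(1 / 2) : ℝ)) * 1 := by
                gcongr
                rw [← Real.rpow_add hr0]
                exact Real.rpow_le_one_of_one_le_of_nonpos hr (by norm_num)
            _ = _ := mul_one _
      _ = C₄ * (q : ℝ) ^ (-(19 / 40) : ℝ) * X ^ 2 * (∑ m ∈ Icc 1 Y, (m : ℝ) ^ (-(1 / 2) : ℝ)) ^ 2 := by
          simp only [← mul_sum, sq (∑ m ∈ Icc 1 Y, (m : ℝ) ^ (-(1 / 2) : ℝ)), ← sum_mul]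
      _ ≤ C₄ * (q : ℝ) ^ (-(19 / 40) : ℝ) * X ^ 2 * (2 * ((q : ℝ) ^ (2 / 5 : ℝ)) ^ (1 / 2 : ℝ)) ^ 2 := by
          gcongr
          exact (sum_rpow_neg_half_le Y).trans (by gcongr)
      _ = 4 * C₄ * C₂ ^ 2 * ((q : ℝ) ^ (-(19 / 40) : ℝ) * ((q : ℝ) ^ (1 / 320 : ℝ) * (q : ℝ) ^ (1 / 320 : ℝ)) *
            ((q : ℝ) ^ (2 / 5 * (1 / 2) : ℝ) * (q : ℝ) ^ (2 / 5 * (1 / 2) : ℝ))) := by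
          rw [hX2, Real.rpow_mul hq0.le (2 / 5)]
          ring
      _ ≤ _ := by
          simp only [← Real.rpow_add hq0]
          gcongr
          norm_num
  set D' := ∑ m ∈ Icc 1 Y, ∑ m' ∈ Icc 1 Y, c m * c m' * (r m m' ^ (-(1 / 2) : ℝ) *
      (kernelMass a ^ 2 * ((Real.log q - Real.log (r m m')) / 2) + k a))
  have hD' : (∑ m ∈ Icc 1 Y, ∑ m' ∈ Icc 1 Y, c m * c m' * r m m' ^ (-(1 / 2) : ℝ) *
        (kernelMass a ^ 2 * (Real.log q - Real.log (r m m')) + 2 * k a)) = 2 * D' := by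
    simp only [D', mul_sum]
    refine sum_congr rfl fun m _ => sum_congr rfl fun m' _ => ?_
    ring
  rw [hsplit, hD', show 2 * average a S - ((2 * D' : ℝ) : ℂ) = 2 * (average a S - D) + 2 * ((D - D' : ℝ) : ℂ) by
    push_cast; ring]
  refine (norm_add_le _ _).trans ?_
  rw [norm_mul, norm_mul, Complex.norm_real, Complex.norm_two, Real.norm_eq_abs]
  linarith

end SecondMoment

section PseudoMoment

open Finset MeasureTheory

/-- The coefficients of the (smoothed) Dirichlet series of `L(χ, s)²` at the central point. -/
noncomputable def squareCoeff (a : ℕ) (x : ℝ) (n : ℕ) : ℝ :=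
  n.divisors.card * ((n : ℝ) ^ (-(1 / 2) : ℝ) * weight₂ a (Real.log n - x))

lemma squareCoeff_nonneg (a : ℕ) (x : ℝ) (n : ℕ) : 0 ≤ squareCoeff a x n :=
  mul_nonneg (by positivity) (mul_nonneg (by positivity) (weight₂_nonneg _ _))

lemma hasSum_square {q : ℕ} [Fact q.Prime] {χ : DirichletCharacter ℂ q} {a : ℕ} (hp : HasParity χ a) (t : ℝ) :
    HasSum (fun n : ℕ => χ n * (squareCoeff a (Real.log q - t) n : ℂ))
      (∫ p : ℝ × ℝ, if t < p.1 + p.2 then logTheta a χ p.1 * logTheta a χ p.2 else 0) := by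
  refine (hasSum_product_regroup (f := fun n : ℕ => χ n *
    (((n : ℝ) ^ (-(1 / 2) : ℝ) * weight₂ a (Real.log n - (Real.log q - t)) : ℝ) : ℂ)) ?_ ?_).congr_fun fun n => ?_
  · refine (hasSum_product hp hp t).congr_fun fun n => ?_
    push_cast
    rw [map_mul, show Real.log ((n.1 : ℝ) * n.2) - (Real.log q - t) = t + Real.log ((n.1 : ℝ) * n.2) - Real.log q by ring]
  · norm_num
  · simp only [squareCoeff]
    push_cast
    ring

lemma exists_squareCoeff_le {B η : ℝ} (hB : 0 ≤ B) (hη : 0 < η) : ∃ C : ℝ, 0 < C ∧ ∀ a ≤ 1, ∀ Q : ℝ, 0 < Q → ∀ e : ℝ,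
    ∀ n : ℕ, n ≠ 0 → squareCoeff a (e * Real.log Q) n ≤ C * Q ^ (e * B) * (n : ℝ) ^ (-(1 / 2 + B - η)) := by
  obtain ⟨C₁, hC₁, hw⟩ := exists_weight₂_le_exp hB
  obtain ⟨C₂, hC₂, hd⟩ := exists_card_divisors_le hη
  refine ⟨C₁ * C₂, by positivity, fun a ha Q hQ e n hn => ?_⟩
  have hn0 : (0 : ℝ) < n := by positivity
  have hw0 := weight₂_nonneg a (Real.log n - e * Real.log Q)
  calc _ ≤ C₂ * (n : ℝ) ^ η * ((n : ℝ) ^ (-(1 / 2) : ℝ) * (C₁ * (Q ^ (e * B) * (n : ℝ) ^ (-B)))) := by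
        unfold squareCoeff
        gcongr
        · exact hd n
        · exact (hw a ha _).trans (le_of_eq (by rw [exp_neg_mul_sub_log hn0 hQ]))
    _ = C₁ * C₂ * Q ^ (e * B) * ((n : ℝ) ^ η * (n : ℝ) ^ (-(1 / 2) : ℝ) * (n : ℝ) ^ (-B)) := by ring
    _ = _ := by
        rw [← Real.rpow_add hn0, ← Real.rpow_add hn0]
        congr 2; ring

lemma exists_average_square_le {δ : ℝ} (hδ : 0 < δ) : ∃ C : ℝ, 0 < C ∧ ∀ (q : ℕ) [Fact q.Prime], q ≠ 2 →
    ∀ a ≤ 1, ∀ θ : ℝ, 0 ≤ θ → θ ≤ 1 / 2 → ∀ Y : ℕ, 1 ≤ Y → (Y : ℝ) ≤ (q : ℝ) ^ θ → ∀ c : ℕ → ℝ,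
    (∀ m ∈ Icc 1 Y, |c m| ≤ m.divisors.card * (m : ℝ) ^ (-(1 / 2) : ℝ)) →
    ‖average a (fun χ : DirichletCharacter ℂ q => mollifier Y c χ ^ 2 *
      ∫ p : ℝ × ℝ, if -((1 - δ - 2 * θ) * Real.log q) < p.1 + p.2 then logTheta a χ p.1 * logTheta a χ p.2 else 0)‖ ≤
      kernelMass a ^ 2 + C * (q : ℝ) ^ (-(δ / 4)) := by
  set η := δ / 36 with hη
  have hη0 : 0 < η := by positivity
  obtain ⟨C₁, hC₁, hw⟩ := exists_squareCoeff_le (B := 1 / 2 + 4 * η) (by positivity) hη0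
  obtain ⟨C₂, hC₂, hd⟩ := exists_card_divisors_le hη0
  obtain ⟨C₃, hC₃, hlin⟩ := exists_average_linear_le (ρ := 1 + η) (by linarith)
  refine ⟨C₃ * (C₁ * (C₂ * C₂) ^ 2), by positivity, fun q hq h2 a ha θ hθ0 hθ1 Y hY hYq c hc => ?_⟩
  have hq0 : (0 : ℝ) < q := by exact_mod_cast hq.out.pos
  have hq1 : (1 : ℝ) ≤ q := by exact_mod_cast hq.out.one_le
  have hc1 := hc 1 (by simp [hY])
  simp only [Nat.divisors_one, card_singleton, Nat.cast_one, Real.one_rpow, mul_one] at hc1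
  have hcX := abs_coeff_le hη0.le (by positivity) hd hYq hc
  set X := C₂ * ((q : ℝ) ^ θ) ^ η with hXdef
  have hX : 0 ≤ X := by positivity
  set F : ℕ → ℂ := fun n => (squareCoeff a ((2 - δ - 2 * θ) * Real.log q) n : ℂ) with hF
  have hFle : ∀ n : ℕ, n ≠ 0 → ‖F n‖ ≤ C₁ * (q : ℝ) ^ ((2 - δ - 2 * θ) * (1 / 2 + 4 * η)) * (n : ℝ) ^ (-(1 + 3 * η)) := fun n hn => by
    rw [hF, Complex.norm_real, Real.norm_of_nonneg (squareCoeff_nonneg _ _ _)]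
    refine (hw a ha q hq0 _ n hn).trans (le_of_eq ?_)
    rw [show 1 / 2 + (1 / 2 + 4 * η) - η = 1 + 3 * η by ring]
  have hFle2 : ∀ n : ℕ, n ≠ 0 → ‖mollify Y c F n‖ ≤ C₁ * (q : ℝ) ^ ((2 - δ - 2 * θ) * (1 / 2 + 4 * η)) * X * C₂ * (Y : ℝ) ^ (1 + 3 * η - 1 / 2) * (n : ℝ) ^ (-(1 + 3 * η - η)) := fun n hn =>
    norm_mollify_le (by linarith) hX (by positivity) hcX hFle hd hn
  have hFle3 : ∀ n : ℕ, n ≠ 0 → ‖mollify Y c (mollify Y c F) n‖ ≤ C₁ * (q : ℝ) ^ ((2 - δ - 2 * θ) * (1 / 2 + 4 * η)) * X * C₂ * (Y : ℝ) ^ (1 + 3 * η - 1 / 2) * X * C₂ * (Y : ℝ) ^ (1 + 3 * η - η - 1 / 2) * (n : ℝ) ^ (-(1 + 3 * η - η - η)) := fun n hn =>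
    norm_mollify_le (by linarith) hX (by positivity) hcX hFle2 hd hn
  have h := hlin q h2 a ha (mollify Y c (mollify Y c F))
    (C₁ * (q : ℝ) ^ ((2 - δ - 2 * θ) * (1 / 2 + 4 * η)) * X * C₂ * (Y : ℝ) ^ (1 + 3 * η - 1 / 2) * X * C₂ * (Y : ℝ) ^ (1 + 3 * η - η - 1 / 2)) (by positivity) (fun n hn => by
      have := hFle3 n hn
      rwa [show 1 + 3 * η - η - η = 1 + η by ring] at this)
    (fun χ : DirichletCharacter ℂ q => mollifier Y c χ ^ 2 *
      ∫ p : ℝ × ℝ, if -((1 - δ - 2 * θ) * Real.log q) < p.1 + p.2 then logTheta a χ p.1 * logTheta a χ p.2 else 0)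
    (fun χ hχ => by
      rw [sq, mul_assoc]
      refine hasSum_mollify Y c (hasSum_mollify Y c ?_)
      have := hasSum_square ((mem_parityFamily ha).mp hχ).2 (-((1 - δ - 2 * θ) * Real.log q))
      rwa [show Real.log q - -((1 - δ - 2 * θ) * Real.log q) = (2 - δ - 2 * θ) * Real.log q by ring] at this)
  rw [mollify_one hY, mollify_one hY] at h
  have hmain : ‖(c 1 : ℂ) * (c 1 * F 1)‖ ≤ kernelMass a ^ 2 := by
    rw [norm_mul, norm_mul, Complex.norm_real, hF, Complex.norm_real, Real.norm_eq_abs,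
      Real.norm_of_nonneg (squareCoeff_nonneg _ _ _)]
    calc _ ≤ 1 * (1 * kernelMass a ^ 2) := by
          gcongr
          · exact mul_nonneg (abs_nonneg _) (squareCoeff_nonneg _ _ _)
          · exact squareCoeff_nonneg _ _ _
          · simp only [squareCoeff, Nat.divisors_one, card_singleton, Nat.cast_one, Real.one_rpow, one_mul]
            exact weight₂_le _ _
      _ = _ := by ring
  refine (norm_le_norm_add_norm_sub' _ ((c 1 : ℂ) * (c 1 * F 1))).trans (add_le_add hmain (h.trans ?_))
  calc _ ≤ C₃ * (C₁ * (q : ℝ) ^ ((2 - δ - 2 * θ) * (1 / 2 + 4 * η)) * X * C₂ * ((q : ℝ) ^ θ) ^ (1 + 3 * η - 1 / 2) * X * C₂ *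
        ((q : ℝ) ^ θ) ^ (1 + 3 * η - η - 1 / 2)) / q := by
        gcongr
        · linarith
        · linarith
    _ = C₃ * (C₁ * (C₂ * C₂) ^ 2) * ((q : ℝ) ^ ((2 - δ - 2 * θ) * (1 / 2 + 4 * η)) * ((q : ℝ) ^ (θ * η) * (q : ℝ) ^ (θ * η)) *
        (q : ℝ) ^ (θ * (1 + 3 * η - 1 / 2)) * (q : ℝ) ^ (θ * (1 + 3 * η - η - 1 / 2)) * (q : ℝ) ^ (-1 : ℝ)) := by
        rw [hXdef, Real.rpow_mul hq0.le θ, Real.rpow_mul hq0.le θ, Real.rpow_mul hq0.le θ, Real.rpow_neg_one]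
        ring
    _ ≤ _ := by
        simp only [← Real.rpow_add hq0]
        gcongr
        rw [hη]
        nlinarith [mul_nonneg hθ0 hδ.le, mul_pos hδ hδ]

end PseudoMoment

section UnitSums

open Finset ComplexConjugate

variable {q : ℕ} [hq : Fact q.Prime]

lemma star_kloosterman (u : ZMod q) : conj (kloosterman q u) = kloosterman q u := by
  unfold kloosterman
  rw [map_sum, ← Equiv.sum_comp (Equiv.neg (ZMod q)ˣ)]
  refine sum_congr rfl fun x _ => ?_
  rw [← AddChar.map_neg_eq_conj]
  congr 1
  simp only [Equiv.neg_apply, Units.val_neg, div_neg]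
  ring

lemma sum_norm_pow_four_le (h2 : q ≠ 2) (g : (ZMod q)ˣ → ℝ) (s : (ZMod q)ˣ) :
    ∑ r : (ZMod q)ˣ, ‖∑ u : (ZMod q)ˣ, (g u : ℂ) * kloosterman q (((s * u⁻¹ : (ZMod q)ˣ) : ZMod q) * r)‖ ^ 4 ≤
      600 * (q : ℝ) ^ 3 * (∑ u, g u ^ 2) ^ 2 + 200 * ((q : ℝ) ^ 2 * √q) * (∑ u, |g u|) ^ 4 := by
  classical
  set K : (ZMod q)ˣ → (ZMod q)ˣ → ℂ := fun u r => kloosterman q (((s * u⁻¹ : (ZMod q)ˣ) : ZMod q) * r) with hK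
  set S : (ZMod q)ˣ → (ZMod q)ˣ → (ZMod q)ˣ → (ZMod q)ˣ → ℂ := fun a b c d => ∑ r, K a r * K b r * (K c r * K d r) with hS
  have hSle : ∀ a c b d, ‖S a b c d‖ ≤ 200 * (q : ℝ) ^ 3 * ((if a = b then 1 else 0) * (if c = d then 1 else 0) +
      (if a = c then 1 else 0) * (if b = d then 1 else 0) + (if a = d then 1 else 0) * (if b = c then 1 else 0)) +
      200 * ((q : ℝ) ^ 2 * √q) := by
    intro a c b d
    by_cases h : (a = b ∧ c = d) ∨ (a = c ∧ b = d) ∨ (a = d ∧ b = c)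
    · have h0 := kloosterman_fourth_moment_le h2 (s * a⁻¹) (s * b⁻¹) (s * c⁻¹) (s * d⁻¹)
      have h1 : (1 : ℝ) ≤ (if a = b then 1 else 0) * (if c = d then 1 else 0) +
          (if a = c then 1 else 0) * (if b = d then 1 else 0) + (if a = d then 1 else 0) * (if b = c then 1 else 0) := by
        rcases h with ⟨rfl, rfl⟩ | ⟨rfl, rfl⟩ | ⟨rfl, rfl⟩ <;> simp only [if_true] <;> split_ifs <;> norm_num
      refine h0.trans ?_
      nlinarith [show (0 : ℝ) ≤ 200 * (q : ℝ) ^ 3 by positivity, show (0 : ℝ) ≤ 200 * ((q : ℝ) ^ 2 * √q) by positivity]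
    · push Not at h
      have h0 := kloosterman_fourth_moment_generic_le h2 (a := s * a⁻¹) (b := s * b⁻¹) (c := s * c⁻¹) (d := s * d⁻¹)
        (by simpa using h.1) (by simpa using h.2.1) (by simpa using h.2.2)
      refine h0.trans (le_add_of_nonneg_left ?_)
      have : ∀ P : Prop, [Decidable P] → (0 : ℝ) ≤ if P then 1 else 0 := fun P _ => by split_ifs <;> norm_num
      have := fun P Q [Decidable P] [Decidable Q] => mul_nonneg (this P) (this Q)
      exact mul_nonneg (by positivity) (add_nonneg (add_nonneg (this _ _) (this _ _)) (this _ _))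
  have hconj : ∀ r, conj (∑ u, (g u : ℂ) * K u r) = ∑ u, (g u : ℂ) * K u r := fun r => by
    simp only [map_sum, map_mul, hK, star_kloosterman, Complex.conj_ofReal]
  have hexp : (((∑ r, ‖∑ u, (g u : ℂ) * K u r‖ ^ 4 : ℝ)) : ℂ) =
      ∑ a, ∑ c, ∑ b, ∑ d, (g a : ℂ) * g b * (g c * g d) * S a b c d := by
    have h1 : ∀ r, ((‖∑ u, (g u : ℂ) * K u r‖ ^ 4 : ℝ) : ℂ) =
        ∑ a, ∑ c, ∑ b, ∑ d, (g a : ℂ) * g b * (g c * g d) * (K a r * K b r * (K c r * K d r)) := fun r => by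
      have h3 := Complex.mul_conj' (∑ u, (g u : ℂ) * K u r)
      rw [hconj] at h3
      push_cast
      rw [show ∀ z : ℂ, z ^ 4 = z ^ 2 * z ^ 2 from fun z => by ring, ← h3, sum_mul_sum, sum_mul_sum]
      refine sum_congr rfl fun a _ => sum_congr rfl fun c _ => ?_
      rw [sum_mul_sum]
      exact sum_congr rfl fun b _ => sum_congr rfl fun d _ => by ring
    rw [Complex.ofReal_sum, sum_congr rfl fun r _ => h1 r, sum_comm]
    refine sum_congr rfl fun a _ => ?_
    rw [sum_comm]
    refine sum_congr rfl fun c _ => ?_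
    rw [sum_comm]
    refine sum_congr rfl fun b _ => ?_
    rw [sum_comm]
    refine sum_congr rfl fun d _ => ?_
    rw [hS, mul_sum]
  have hnn : 0 ≤ ∑ r, ‖∑ u, (g u : ℂ) * K u r‖ ^ 4 := sum_nonneg fun r _ => by positivity
  rw [← Real.norm_of_nonneg hnn, ← Complex.norm_real, hexp]
  calc _ ≤ ∑ a, ∑ c, ∑ b, ∑ d, |g a| * |g b| * (|g c| * |g d|) * (200 * (q : ℝ) ^ 3 * ((if a = b then 1 else 0) * (if c = d then 1 else 0) +
      (if a = c then 1 else 0) * (if b = d then 1 else 0) + (if a = d then 1 else 0) * (if b = c then 1 else 0)) +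
      200 * ((q : ℝ) ^ 2 * √q)) := by
        refine (norm_sum_le _ _).trans (sum_le_sum fun a _ => ?_)
        refine (norm_sum_le _ _).trans (sum_le_sum fun c _ => ?_)
        refine (norm_sum_le _ _).trans (sum_le_sum fun b _ => ?_)
        refine (norm_sum_le _ _).trans (sum_le_sum fun d _ => ?_)
        simp only [norm_mul, Complex.norm_real, Real.norm_eq_abs]
        gcongr
        exact hSle a c b d
    _ = 200 * (q : ℝ) ^ 3 * (∑ a, ∑ c, ∑ b, ∑ d, |g a| * |g b| * (|g c| * |g d|) * ((if a = b then 1 else 0) * (if c = d then 1 else 0)) +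
          ∑ a, ∑ c, ∑ b, ∑ d, |g a| * |g b| * (|g c| * |g d|) * ((if a = c then 1 else 0) * (if b = d then 1 else 0)) +
          ∑ a, ∑ c, ∑ b, ∑ d, |g a| * |g b| * (|g c| * |g d|) * ((if a = d then 1 else 0) * (if b = c then 1 else 0))) +
          200 * ((q : ℝ) ^ 2 * √q) * ∑ a, ∑ c, ∑ b, ∑ d, |g a| * |g b| * (|g c| * |g d|) := by
        simp only [mul_sum, mul_add, ← sum_add_distrib]
        refine sum_congr rfl fun a _ => sum_congr rfl fun c _ => sum_congr rfl fun b _ => sum_congr rfl fun d _ => ?_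
        ring
    _ = 200 * (q : ℝ) ^ 3 * ((∑ u, g u ^ 2) ^ 2 + (∑ u, g u ^ 2) ^ 2 + (∑ u, g u ^ 2) ^ 2) +
          200 * ((q : ℝ) ^ 2 * √q) * (∑ u, |g u|) ^ 4 := by
        have e' : ∀ a c : (ZMod q)ˣ, |g a| * |g c| * (|g a| * |g c|) = g a ^ 2 * g c ^ 2 := fun a c => by
          rw [← sq_abs (g a), ← sq_abs (g c)]; ring
        have e'' : ∀ a c : (ZMod q)ˣ, |g a| * |g c| * (|g c| * |g a|) = g a ^ 2 * g c ^ 2 := fun a c => by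
          rw [← sq_abs (g a), ← sq_abs (g c)]; ring
        have hsq : (∑ u, g u ^ 2) ^ 2 = ∑ a, ∑ c, g a ^ 2 * g c ^ 2 := by rw [sq, sum_mul_sum]
        congr 2
        · congr 1
          · congr 1
            · simp [mul_ite, sq, sum_mul_sum]
            · simp [mul_ite, e', hsq]
          · simp [mul_ite, e'', hsq]
        · rw [show ∀ z : ℝ, z ^ 4 = z * z * (z * z) from fun z => by ring, sum_mul_sum, sum_mul_sum]
          refine sum_congr rfl fun a _ => sum_congr rfl fun c _ => ?_
          rw [sum_mul_sum]
    _ = _ := by ring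

lemma sum_sq_convolution_eq (f g : (ZMod q)ˣ → ℝ) :
    ∑ s, (∑ u, g u * f (s * u)) ^ 2 = ∑ s, (∑ u, g u * f (s * u⁻¹)) ^ 2 := by
  simp only [sq, sum_mul_sum]
  rw [sum_comm]
  conv_rhs => rw [sum_comm]
  refine sum_congr rfl fun u _ => ?_
  rw [sum_comm]
  conv_rhs => rw [sum_comm]
  refine sum_congr rfl fun v _ => ?_
  rw [← Equiv.sum_comp (Equiv.mulRight (u⁻¹ * v⁻¹))]
  refine sum_congr rfl fun s _ => ?_
  simp only [Equiv.coe_mulRight]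
  rw [show s * (u⁻¹ * v⁻¹) * u = s * v⁻¹ by rw [mul_comm u⁻¹]; group, show s * (u⁻¹ * v⁻¹) * v = s * u⁻¹ by group]
  ring

lemma sum_mul_pow_four_le {ι : Type*} [Fintype ι] {f g : ι → ℝ} (hf : ∀ i, 0 ≤ f i) :
    (∑ i, f i * g i) ^ 4 ≤ (∑ i, f i) ^ 2 * ((∑ i, f i ^ 2) * ∑ i, g i ^ 4) := by
  have h1 : (∑ i, f i * g i) ^ 2 ≤ (∑ i, f i) * ∑ i, f i * g i ^ 2 :=
    sum_sq_le_sum_mul_sum_of_sq_le_mul _ (fun i _ => hf i) (fun i _ => mul_nonneg (hf i) (sq_nonneg _)) fun i _ => le_of_eq (by ring)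
  have h2 : (∑ i, f i * g i ^ 2) ^ 2 ≤ (∑ i, f i ^ 2) * ∑ i, g i ^ 4 :=
    sum_sq_le_sum_mul_sum_of_sq_le_mul _ (fun i _ => by positivity) (fun i _ => by positivity) fun i _ => le_of_eq (by ring)
  calc (∑ i, f i * g i) ^ 4 = ((∑ i, f i * g i) ^ 2) ^ 2 := by ring
    _ ≤ ((∑ i, f i) * ∑ i, f i * g i ^ 2) ^ 2 := by gcongr
    _ = (∑ i, f i) ^ 2 * (∑ i, f i * g i ^ 2) ^ 2 := by ring
    _ ≤ _ := by gcongr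

end UnitSums

section DualAverage

open Finset

variable {q : ℕ} [hq : Fact q.Prime]

lemma average_sum {q : ℕ} {ι : Type*} (s : Finset ι) (a : ℕ) (f : ι → DirichletCharacter ℂ q → ℂ) :
    average a (fun χ => ∑ i ∈ s, f i χ) = ∑ i ∈ s, average a (f i) := by
  simp only [average, mul_sum]
  rw [sum_comm]

lemma gaussSum_eq_sum_units (χ : DirichletCharacter ℂ q) :
    gaussSum χ ZMod.stdAddChar = ∑ x : (ZMod q)ˣ, χ x * ZMod.stdAddChar (x : ZMod q) := by
  have h := sum_units_add_zero (p := q) fun x => χ x * ZMod.stdAddChar x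
  rw [MulChar.map_zero, zero_mul, add_zero] at h
  rw [gaussSum, h]

lemma average_gaussSum_sq {a : ℕ} (ha : a ≤ 1) (w : (ZMod q)ˣ) :
    average a (fun χ : DirichletCharacter ℂ q => gaussSum χ ZMod.stdAddChar ^ 2 * χ (w⁻¹ : (ZMod q)ˣ)) =
      kloosterman q w + (-1) ^ a * kloosterman q (-w) - if a = 0 then 2 / ((q : ℂ) - 1) else 0 := by
  classical
  have hexp : ∀ χ : DirichletCharacter ℂ q, gaussSum χ ZMod.stdAddChar ^ 2 * χ (w⁻¹ : (ZMod q)ˣ) =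
      ∑ x : (ZMod q)ˣ, ∑ y : (ZMod q)ˣ, ZMod.stdAddChar ((x : ZMod q) + (y : ZMod q)) * χ ((x * y * w⁻¹ : (ZMod q)ˣ) : ZMod q) := by
    intro χ
    rw [gaussSum_eq_sum_units, sq, sum_mul_sum, sum_mul]
    refine sum_congr rfl fun x _ => ?_
    rw [sum_mul]
    refine sum_congr rfl fun y _ => ?_
    rw [AddChar.map_add_eq_mul, Units.val_mul, Units.val_mul, map_mul, map_mul]
    ring
  have hdelta : ∀ (t : (ZMod q)ˣ), ∑ x : (ZMod q)ˣ, ∑ y : (ZMod q)ˣ, ZMod.stdAddChar ((x : ZMod q) + (y : ZMod q)) *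
      (if ((x * y * w⁻¹ : (ZMod q)ˣ) : ZMod q) = t then 1 else 0) = kloosterman q (t * w) := by
    intro t
    refine sum_congr rfl fun x _ => ?_
    rw [sum_eq_single (t * w * x⁻¹)]
    · rw [if_pos (by rw [Units.val_inj]; rw [show t * w * x⁻¹ = x⁻¹ * (t * w) by rw [mul_comm]]; group), mul_one]
      rw [Units.val_mul, Units.val_mul, Units.val_inv_eq_inv_val, div_eq_mul_inv]
    · intro y _ hy
      rw [if_neg, mul_zero]
      rw [Units.val_inj]
      rintro rfl
      exact hy (by rw [show x * y * w⁻¹ * w * x⁻¹ = x * y * x⁻¹ by group]; rw [mul_comm x y]; group)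
    · exact fun h => absurd (mem_univ _) h
  simp only [hexp, average_sum, average_const_mul, average_char ha, mul_sub, mul_add, sum_add_distrib, sum_sub_distrib]
  have h1 := hdelta 1
  have h2 := hdelta (-1)
  simp only [Units.val_one, Units.val_neg, one_mul, neg_mul] at h1 h2
  rw [h1, ← h2]
  congr 1
  · congr 1
    simp only [mul_sum]
    exact sum_congr rfl fun x _ => sum_congr rfl fun y _ => by ring
  · split_ifs with h
    · simp only [h, Units.ne_zero, ne_eq, not_false_eq_true, and_self, if_true, AddChar.map_add_eq_mul]
      have h1 := sum_units_stdAddChar_ne (p := q) one_ne_zero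
      simp only [mul_one] at h1
      simp only [← mul_sum, ← sum_mul, h1]
      ring
    · simp only [h, false_and, if_false, mul_zero, sum_const_zero]

lemma rootNumber_sq (a : ℕ) (χ : DirichletCharacter ℂ q) :
    rootNumber a χ ^ 2 = (-1) ^ a / q * gaussSum χ ZMod.stdAddChar ^ 2 := by
  have h : ((√(q : ℝ) : ℝ) : ℂ) ^ 2 = q := by
    rw [← Complex.ofReal_pow, Real.sq_sqrt (Nat.cast_nonneg q)]; simp
  rw [rootNumber, div_pow, h, mul_pow, ← pow_mul, mul_comm a 2, pow_mul, neg_sq, Complex.I_sq]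
  ring

lemma norm_average_dual_le {a : ℕ} (h2 : q ≠ 2) (ha : a ≤ 1) (g : (ZMod q)ˣ → ℝ) {Ω : (ZMod q)ˣ → ℝ} (hΩ : ∀ r, 0 ≤ Ω r)
    {B : ℝ} (hB : 0 ≤ B) (hB4 : ((∑ u, |g u|) * ∑ r, Ω r) ^ 2 * ((∑ s, (∑ u, |g u| * Ω (s * u⁻¹)) ^ 2) *
      (600 * (q : ℝ) ^ 3 * (∑ u, g u ^ 2) ^ 2 + 200 * ((q : ℝ) ^ 2 * √q) * (∑ u, |g u|) ^ 4)) ≤ B ^ 4) :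
    ‖average a (fun χ : DirichletCharacter ℂ q => rootNumber a χ ^ 2 * (∑ u : (ZMod q)ˣ, (g u : ℂ) * χ u) ^ 2 *
      ∑ r : (ZMod q)ˣ, (Ω r : ℂ) * χ⁻¹ r)‖ ≤ (2 * B + 2 / ((q : ℝ) - 1) * ((∑ r, Ω r) * (∑ u, |g u|) ^ 2)) / q := by
  have hq2 := two_lt_cast h2
  have hexp : ∀ χ : DirichletCharacter ℂ q, rootNumber a χ ^ 2 * (∑ u : (ZMod q)ˣ, (g u : ℂ) * χ u) ^ 2 *
      ∑ r : (ZMod q)ˣ, (Ω r : ℂ) * χ⁻¹ r = (-1) ^ a / q * ∑ u, ∑ v, ∑ r, (g u * g v * Ω r : ℂ) *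
        (gaussSum χ ZMod.stdAddChar ^ 2 * χ ((r * u⁻¹ * v⁻¹ : (ZMod q)ˣ)⁻¹ : (ZMod q)ˣ)) := by
    intro χ
    rw [rootNumber_sq, sq (∑ u : (ZMod q)ˣ, (g u : ℂ) * χ u), sum_mul_sum, mul_assoc, mul_assoc, sum_mul, mul_sum]
    congr 1
    refine sum_congr rfl fun u _ => ?_
    rw [sum_mul, mul_sum]
    refine sum_congr rfl fun v _ => ?_
    rw [mul_sum, mul_sum]
    refine sum_congr rfl fun r _ => ?_
    rw [MulChar.inv_apply', ← Units.val_inv_eq_inv_val, show (r * u⁻¹ * v⁻¹)⁻¹ = r⁻¹ * u * v by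
      rw [mul_inv_rev, mul_inv_rev, inv_inv, inv_inv]; rw [mul_comm, mul_comm u], Units.val_mul, Units.val_mul, map_mul, map_mul]
    ring
  have hpiece : ∀ s : (ZMod q)ˣ, ‖∑ u, ∑ v, ∑ r, (g u * g v * Ω r : ℂ) * kloosterman q ((s : ZMod q) * (r * u⁻¹ * v⁻¹ : (ZMod q)ˣ))‖ ≤ B := by
    intro s
    set G : (ZMod q)ˣ → ℂ := fun r => ∑ u : (ZMod q)ˣ, (g u : ℂ) * kloosterman q (((s * u⁻¹ : (ZMod q)ˣ) : ZMod q) * r) with hG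
    have hre : ∑ u, ∑ v, ∑ r, (g u * g v * Ω r : ℂ) * kloosterman q ((s : ZMod q) * (r * u⁻¹ * v⁻¹ : (ZMod q)ˣ)) =
        ∑ t, (∑ u, (g u : ℂ) * Ω (t * u)) * G t := by
      simp only [sum_mul]
      conv_rhs => rw [sum_comm]
      refine sum_congr rfl fun u _ => ?_
      rw [sum_comm, ← Equiv.sum_comp (Equiv.mulRight u)]
      refine sum_congr rfl fun t _ => ?_
      rw [hG, mul_sum]
      refine sum_congr rfl fun v _ => ?_
      rw [Equiv.coe_mulRight, show t * u * u⁻¹ * v⁻¹ = v⁻¹ * t by rw [mul_inv_cancel_right, mul_comm],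
        ← Units.val_mul, ← Units.val_mul, mul_assoc s]
      ring
    rw [hre]
    have hle : ‖∑ t, (∑ u, (g u : ℂ) * Ω (t * u)) * G t‖ ≤ ∑ t, (∑ u, |g u| * Ω (t * u)) * ‖G t‖ := by
      refine (norm_sum_le _ _).trans (sum_le_sum fun t _ => ?_)
      rw [norm_mul]
      gcongr
      refine (norm_sum_le _ _).trans (sum_le_sum fun u _ => ?_)
      rw [norm_mul, Complex.norm_real, Complex.norm_real, Real.norm_eq_abs, Real.norm_of_nonneg (hΩ _)]
    refine hle.trans (le_of_pow_le_pow_left₀ (n := 4) (by norm_num) hB ((sum_mul_pow_four_le fun t =>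
      sum_nonneg fun u _ => mul_nonneg (abs_nonneg _) (hΩ _)).trans (le_trans ?_ hB4)))
    have hsum : ∑ t, ∑ u, |g u| * Ω (t * u) = (∑ u, |g u|) * ∑ r, Ω r := by
      rw [sum_comm, sum_mul]
      refine sum_congr rfl fun u _ => ?_
      rw [← mul_sum]
      exact congrArg _ (Equiv.sum_comp (Equiv.mulRight u) Ω)
    rw [hsum, sum_sq_convolution_eq]
    gcongr
    exact sum_norm_pow_four_le h2 g s
  simp only [hexp, average_const_mul, average_sum, average_gaussSum_sq ha]
  have hsplit : ∑ u, ∑ v, ∑ r, (g u * g v * Ω r : ℂ) * (kloosterman q (r * u⁻¹ * v⁻¹ : (ZMod q)ˣ) +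
        (-1) ^ a * kloosterman q (-((r * u⁻¹ * v⁻¹ : (ZMod q)ˣ) : ZMod q)) - if a = 0 then 2 / ((q : ℂ) - 1) else 0) =
      ∑ u, ∑ v, ∑ r, (g u * g v * Ω r : ℂ) * kloosterman q (((1 : (ZMod q)ˣ) : ZMod q) * (r * u⁻¹ * v⁻¹ : (ZMod q)ˣ)) +
      (-1) ^ a * ∑ u, ∑ v, ∑ r, (g u * g v * Ω r : ℂ) * kloosterman q (((-1 : (ZMod q)ˣ) : ZMod q) * (r * u⁻¹ * v⁻¹ : (ZMod q)ˣ)) -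
      ∑ u, ∑ v, ∑ r, (g u * g v * Ω r : ℂ) * (if a = 0 then 2 / ((q : ℂ) - 1) else 0) := by
    simp only [mul_sum, ← sum_add_distrib, ← sum_sub_distrib]
    refine sum_congr rfl fun u _ => sum_congr rfl fun v _ => sum_congr rfl fun r _ => ?_
    rw [Units.val_one, Units.val_neg, Units.val_one, one_mul, neg_one_mul]
    ring
  have hcorr : ‖∑ u, ∑ v, ∑ r, (g u * g v * Ω r : ℂ) * (if a = 0 then 2 / ((q : ℂ) - 1) else 0)‖ ≤
      2 / ((q : ℝ) - 1) * ((∑ r, Ω r) * (∑ u, |g u|) ^ 2) := by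
    have h : ‖(if a = 0 then 2 / ((q : ℂ) - 1) else 0)‖ ≤ 2 / ((q : ℝ) - 1) := by
      split_ifs
      · rw [norm_div, show (q : ℂ) - 1 = (((q : ℝ) - 1 : ℝ) : ℂ) by push_cast; rfl, Complex.norm_real,
          Real.norm_of_nonneg (by linarith)]
        norm_num
      · rw [norm_zero]; exact div_nonneg (by norm_num) (by linarith)
    calc _ ≤ ∑ u, ∑ v, ∑ r, |g u| * |g v| * Ω r * (2 / ((q : ℝ) - 1)) := by
          refine (norm_sum_le _ _).trans (sum_le_sum fun u _ => ?_)
          refine (norm_sum_le _ _).trans (sum_le_sum fun v _ => ?_)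
          refine (norm_sum_le _ _).trans (sum_le_sum fun r _ => ?_)
          rw [norm_mul, norm_mul, norm_mul, Complex.norm_real, Complex.norm_real, Complex.norm_real, Real.norm_eq_abs,
            Real.norm_eq_abs, Real.norm_of_nonneg (hΩ r)]
          have := hΩ r
          gcongr
      _ = _ := by
          simp only [← sum_mul, ← mul_sum]
          ring
  rw [hsplit, norm_mul, norm_div, norm_pow, norm_neg, norm_one, one_pow, Complex.norm_natCast, one_div, mul_comm, ← div_eq_mul_inv]
  gcongr
  refine (norm_sub_le _ _).trans (add_le_add ((norm_add_le _ _).trans ?_) hcorr)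
  rw [norm_mul, norm_pow, norm_neg, norm_one, one_pow, one_mul]
  linarith [hpiece 1, hpiece (-1)]

end DualAverage

section ResidueClasses

open Finset

variable {q : ℕ} [hq : Fact q.Prime]

/-- A sequence supported on `[1, Y]`, as a function on the units modulo `q`. -/
noncomputable def unitCoeff (q Y : ℕ) (c : ℕ → ℝ) (u : (ZMod q)ˣ) : ℝ :=
  if (u : ZMod q).val ≤ Y then c (u : ZMod q).val else 0

/-- The sum of `ω n` over the `n` in the residue class of `r`. -/
noncomputable def classSum (ω : ℕ → ℝ) (r : (ZMod q)ˣ) : ℝ := ∑' n : ℕ, if (n : ZMod q) = r then ω n else 0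

lemma sum_units_ite_val {M : Type*} [AddCommMonoid M] {Y : ℕ} (hY : Y < q) (f : ℕ → M) :
    ∑ u : (ZMod q)ˣ, (if (u : ZMod q).val ≤ Y then f (u : ZMod q).val else 0) = ∑ m ∈ Icc 1 Y, f m := by
  rw [← sum_filter]
  refine sum_bij (fun u _ => (u : ZMod q).val) ?_ ?_ ?_ fun _ _ => rfl
  · intro u hu
    rw [mem_Icc]
    refine ⟨Nat.one_le_iff_ne_zero.mpr ?_, (mem_filter.mp hu).2⟩
    rw [ne_eq, ZMod.val_eq_zero]
    exact u.ne_zero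
  · intro u _ v _ h
    exact Units.ext (ZMod.val_injective q h)
  · intro m hm
    have hm1 := mem_Icc.mp hm
    have h0 : (m : ZMod q) ≠ 0 := by
      rw [ne_eq, ZMod.natCast_eq_zero_iff]
      exact Nat.not_dvd_of_pos_of_lt hm1.1 (by omega)
    have hv : ((Units.mk0 (m : ZMod q) h0 : (ZMod q)ˣ) : ZMod q).val = m := by
      rw [Units.val_mk0, ZMod.val_natCast_of_lt (by omega)]
    exact ⟨Units.mk0 (m : ZMod q) h0, by rw [mem_filter, hv]; exact ⟨mem_univ _, hm1.2⟩, hv⟩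

lemma sum_unitCoeff_comp {Y : ℕ} (hY : Y < q) (c : ℕ → ℝ) {M : Type*} [AddCommMonoid M] (F : ℝ → ZMod q → M)
    (hF : ∀ z, F 0 z = 0) :
    ∑ u : (ZMod q)ˣ, F (unitCoeff q Y c u) u = ∑ m ∈ Icc 1 Y, F (c m) m := by
  rw [← sum_units_ite_val hY]
  refine sum_congr rfl fun u _ => ?_
  rw [unitCoeff]
  split_ifs
  · rw [ZMod.natCast_zmod_val]
  · rw [hF]

lemma mollifier_eq_sum_units {Y : ℕ} (hY : Y < q) (c : ℕ → ℝ) (χ : DirichletCharacter ℂ q) :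
    mollifier Y c χ = ∑ u : (ZMod q)ˣ, (unitCoeff q Y c u : ℂ) * χ u := by
  rw [sum_unitCoeff_comp hY c fun x z => (x : ℂ) * χ z]
  · rfl
  · simp

lemma summable_class {ω : ℕ → ℝ} (h : Summable ω) (r : ZMod q) :
    Summable fun n : ℕ => if (n : ZMod q) = r then ω n else 0 :=
  (h.indicator {n : ℕ | (n : ZMod q) = r}).congr fun n => by simp [Set.indicator]

lemma classSum_nonneg {ω : ℕ → ℝ} (h0 : ∀ n, 0 ≤ ω n) (r : (ZMod q)ˣ) : 0 ≤ classSum ω r :=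
  tsum_nonneg fun n => by split_ifs <;> simp [h0]

lemma hasSum_mul_class {ω : ℕ → ℝ} (h : Summable ω) {f : ZMod q → ℂ} (hf : f 0 = 0) :
    HasSum (fun n : ℕ => f n * (ω n : ℂ)) (∑ r : (ZMod q)ˣ, (classSum ω r : ℂ) * f r) := by
  have h1 : ∀ r ∈ (univ : Finset (ZMod q)ˣ), HasSum (fun n : ℕ => ((if (n : ZMod q) = r then ω n else 0 : ℝ) : ℂ) * f r)
      ((classSum ω r : ℂ) * f r) := fun r _ =>
    (Complex.hasSum_ofReal.mpr (summable_class h (r : ZMod q)).hasSum).mul_right _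
  refine (hasSum_sum h1).congr_fun fun n => ?_
  by_cases hn : (n : ZMod q) = 0
  · rw [hn, hf, zero_mul]
    refine (sum_eq_zero fun r _ => ?_).symm
    rw [if_neg r.ne_zero.symm]
    simp
  · rw [sum_eq_single (Units.mk0 (n : ZMod q) hn)]
    · simp [mul_comm]
    · intro r _ hr
      rw [if_neg]
      · simp
      · intro h
        exact hr (Units.ext h.symm)
    · exact fun h => absurd (mem_univ _) h

lemma sum_classSum_le {ω : ℕ → ℝ} (h0 : ∀ n, 0 ≤ ω n) (h : Summable ω) :
    ∑ r : (ZMod q)ˣ, classSum ω r ≤ ∑' n, ω n := by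
  have h1 : ∀ r ∈ (univ : Finset (ZMod q)ˣ), HasSum (fun n : ℕ => if (n : ZMod q) = r then ω n else 0) (classSum ω r) :=
    fun r _ => (summable_class h (r : ZMod q)).hasSum
  refine hasSum_le (fun n => ?_) (hasSum_sum h1) h.hasSum
  by_cases hn : (n : ZMod q) = 0
  · rw [sum_eq_zero fun r _ => if_neg (by rw [hn]; exact r.ne_zero.symm)]
    exact h0 n
  · rw [sum_eq_single (Units.mk0 (n : ZMod q) hn)]
    · simp
    · intro r _ hr
      exact if_neg fun h => hr (Units.ext h.symm)
    · exact fun h => absurd (mem_univ _) h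

lemma hasSum_class_mollify {ω : ℕ → ℝ} (h : Summable ω) {Y : ℕ} (hY : Y < q) (c : ℕ → ℝ) (s : (ZMod q)ˣ) :
    HasSum (fun v : ℕ => if (v : ZMod q) = s then mollify Y (fun m => |c m|) (fun n => (ω n : ℂ)) v else 0)
      ((∑ u : (ZMod q)ˣ, |unitCoeff q Y c u| * classSum ω (s * u⁻¹) : ℝ) : ℂ) := by
  have h1 : ∀ u ∈ (univ : Finset (ZMod q)ˣ), HasSum (fun v : ℕ => if (u : ZMod q).val ≤ Y then
      (if (u : ZMod q).val ∣ v then ((|c (u : ZMod q).val| : ℝ) : ℂ) *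
        (((if ((v / (u : ZMod q).val : ℕ) : ZMod q) = (s * u⁻¹ : (ZMod q)ˣ) then ω (v / (u : ZMod q).val) else 0 : ℝ)) : ℂ) else 0) else 0)
      ((|unitCoeff q Y c u| * classSum ω (s * u⁻¹) : ℝ) : ℂ) := by
    intro u _
    by_cases hu : (u : ZMod q).val ≤ Y
    · simp only [unitCoeff, if_pos hu]
      rw [Complex.ofReal_mul]
      have h2 := (Complex.hasSum_ofReal.mpr (summable_class h ((s * u⁻¹ : (ZMod q)ˣ) : ZMod q)).hasSum)
      have hm : (u : ZMod q).val ≠ 0 := by rw [ne_eq, ZMod.val_eq_zero]; exact u.ne_zero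
      have h3 := (hasSum_mul_left_iff hm).mpr (h2.mul_left ((|c (u : ZMod q).val| : ℝ) : ℂ))
      exact h3
    · simp only [unitCoeff, if_neg hu]
      rw [abs_zero, zero_mul, Complex.ofReal_zero]
      exact hasSum_zero
  rw [Complex.ofReal_sum]
  refine (hasSum_sum h1).congr_fun fun v => ?_
  simp only [mollify]
  rw [← sum_units_ite_val hY]
  have hiff : ∀ (u : (ZMod q)ˣ) (k : ℕ), (((u : ZMod q).val * k : ℕ) : ZMod q) = s ↔ (k : ZMod q) = (s * u⁻¹ : (ZMod q)ˣ) := by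
    intro u k
    rw [Nat.cast_mul, ZMod.natCast_zmod_val, Units.val_mul, Units.eq_mul_inv_iff_mul_eq, mul_comm]
  have hu0 : ∀ u : (ZMod q)ˣ, 0 < (u : ZMod q).val := fun u =>
    Nat.pos_of_ne_zero (by rw [ne_eq, ZMod.val_eq_zero]; exact u.ne_zero)
  by_cases hv : (v : ZMod q) = s
  · rw [if_pos hv]
    refine sum_congr rfl fun u _ => ?_
    by_cases hd : (u : ZMod q).val ∣ v
    · obtain ⟨k, rfl⟩ := hd
      rw [Nat.mul_div_cancel_left _ (hu0 u), if_pos ((hiff u k).mp hv)]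
    · simp only [if_neg hd]
  · rw [if_neg hv]
    refine (sum_eq_zero fun u _ => ?_).symm
    by_cases hd : (u : ZMod q).val ∣ v
    · obtain ⟨k, rfl⟩ := hd
      rw [Nat.mul_div_cancel_left _ (hu0 u), if_neg fun h => hv ((hiff u k).mpr h)]
      simp
    · simp only [if_neg hd, ite_self]

lemma exists_sum_class_sq_le {η : ℝ} (hη : 0 < η) : ∃ C : ℝ, 0 < C ∧ ∀ (q : ℕ) [Fact q.Prime], ∀ (h : ℕ → ℂ) (H : (ZMod q)ˣ → ℝ),
    (∀ s : (ZMod q)ˣ, HasSum (fun v : ℕ => if (v : ZMod q) = s then h v else 0) (H s : ℂ)) → ∀ A₁ A₂ : ℝ, 0 ≤ A₁ → 0 ≤ A₂ →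
    (∀ v : ℕ, v ≠ 0 → ‖h v‖ ≤ A₁ * (v : ℝ) ^ (-(1 / 2 + η))) → (∀ v : ℕ, v ≠ 0 → ‖h v‖ ≤ A₂ * (v : ℝ) ^ (-(1 + η))) →
    ∑ s, H s ^ 2 ≤ C * (A₁ ^ 2 + A₂ ^ 2 / q) := by
  obtain ⟨C₁, hC₁, hcl⟩ := exists_sum_class_le (ρ := 1 + η) (by linarith)
  have hsum : Summable fun n : ℕ => (n : ℝ) ^ (-(1 + 2 * η)) := Real.summable_nat_rpow.mpr (by linarith)
  set S := ∑' n : ℕ, (n : ℝ) ^ (-(1 + 2 * η)) with hS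
  have hS0 : 0 ≤ S := tsum_nonneg fun n => by positivity
  refine ⟨2 * S + 2 * C₁ ^ 2, by positivity, fun q hq h H hH A₁ A₂ hA₁ hA₂ h1 h2 => ?_⟩
  have hq0 : (0 : ℝ) < q := by exact_mod_cast hq.out.pos
  have hq1 : (1 : ℝ) ≤ q := by exact_mod_cast hq.out.one_le
  have hval : ∀ s : (ZMod q)ˣ, (s : ZMod q).val ≠ 0 := fun s => by rw [ne_eq, ZMod.val_eq_zero]; exact s.ne_zero
  have hHle : ∀ s, |H s| ≤ A₁ * ((s : ZMod q).val : ℝ) ^ (-(1 / 2 + η)) + A₂ * (C₁ * (q : ℝ) ^ (-(1 + η))) := by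
    intro s
    rw [← Real.norm_eq_abs, ← Complex.norm_real]
    refine le_of_tendsto (hH s).norm (Filter.Eventually.of_forall fun T => ?_)
    have hterm : ∀ v ∈ T, ‖if (v : ZMod q) = s then h v else 0‖ ≤
        (if v = (s : ZMod q).val then A₁ * ((s : ZMod q).val : ℝ) ^ (-(1 / 2 + η)) else 0) +
        A₂ * (if q ≤ 2 * v ∧ (v : ZMod q) = s then (v : ℝ) ^ (-(1 + η)) else 0) := by
      intro v _
      by_cases hv : (v : ZMod q) = s
      · have hv0 : v ≠ 0 := by rintro rfl; exact s.ne_zero (by simpa using hv.symm)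
        rw [if_pos hv]
        by_cases hvq : v < q
        · have : v = (s : ZMod q).val := by rw [← hv, ZMod.val_natCast_of_lt hvq]
          rw [if_pos this, ← this]
          exact (h1 v hv0).trans (le_add_of_nonneg_right (by positivity))
        · have hcond : q ≤ 2 * v ∧ (v : ZMod q) = s := ⟨by omega, hv⟩
          rw [if_pos hcond]
          exact (h2 v hv0).trans (le_add_of_nonneg_left (by split_ifs <;> positivity))
      · rw [if_neg hv, norm_zero]
        positivity
    refine (norm_sum_le _ _).trans ((sum_le_sum hterm).trans ?_)
    rw [sum_add_distrib, ← mul_sum]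
    refine add_le_add ?_ (mul_le_mul_of_nonneg_left (hcl q hq.out.pos _ _) hA₂)
    rw [sum_ite_eq']
    split_ifs
    · exact le_rfl
    · positivity
  have hcount : (Fintype.card (ZMod q)ˣ : ℝ) ≤ q := by
    rw [ZMod.card_units_eq_totient]
    exact_mod_cast Nat.totient_le q
  calc ∑ s, H s ^ 2 ≤ ∑ s : (ZMod q)ˣ, (2 * A₁ ^ 2 * ((s : ZMod q).val : ℝ) ^ (-(1 + 2 * η)) + 2 * (A₂ * (C₁ * (q : ℝ) ^ (-(1 + η)))) ^ 2) := by
        refine sum_le_sum fun s _ => ?_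
        have hs0 : (0 : ℝ) < ((s : ZMod q).val : ℝ) := by exact_mod_cast Nat.pos_of_ne_zero (hval s)
        rw [← sq_abs, show (-(1 + 2 * η)) = -(1 / 2 + η) + -(1 / 2 + η) by ring, Real.rpow_add hs0]
        refine (pow_le_pow_left₀ (abs_nonneg _) (hHle s) 2).trans ?_
        nlinarith [sq_nonneg (A₁ * ((s : ZMod q).val : ℝ) ^ (-(1 / 2 + η)) - A₂ * (C₁ * (q : ℝ) ^ (-(1 + η))))]
    _ = 2 * A₁ ^ 2 * ∑ s : (ZMod q)ˣ, ((s : ZMod q).val : ℝ) ^ (-(1 + 2 * η)) +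
        (Fintype.card (ZMod q)ˣ : ℝ) * (2 * (A₂ * (C₁ * (q : ℝ) ^ (-(1 + η)))) ^ 2) := by
        rw [sum_add_distrib, ← mul_sum, sum_const, nsmul_eq_mul, card_univ]
    _ ≤ 2 * A₁ ^ 2 * S + q * (2 * (A₂ * (C₁ * (q : ℝ) ^ (-1 : ℝ))) ^ 2) := by
        gcongr
        · have h3 := sum_units_ite_val (q := q) (Nat.sub_lt hq.out.pos one_pos) fun n : ℕ => (n : ℝ) ^ (-(1 + 2 * η))
          have h4 : ∀ s : (ZMod q)ˣ, (s : ZMod q).val ≤ q - 1 := fun s => by have := ZMod.val_lt (s : ZMod q); omega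
          simp only [h4, if_true] at h3
          rw [h3]
          exact hsum.sum_le_tsum _ fun n _ => by positivity
        · linarith
    _ = 2 * S * A₁ ^ 2 + 2 * C₁ ^ 2 * (A₂ ^ 2 / q) := by
        rw [Real.rpow_neg_one]; field_simp
    _ ≤ _ := by nlinarith [sq_nonneg A₁, sq_nonneg C₁, div_nonneg (sq_nonneg A₂) hq0.le, mul_nonneg hS0 (div_nonneg (sq_nonneg A₂) hq0.le), mul_nonneg (sq_nonneg C₁) (sq_nonneg A₁)]

end ResidueClasses

section DualBound

open Finset MeasureTheory

lemma exists_sum_inv_le {η : ℝ} (hη : 0 < η) : ∃ C : ℝ, 1 ≤ C ∧ ∀ Y : ℕ, ∑ m ∈ Icc 1 Y, (m : ℝ)⁻¹ ≤ C * (Y : ℝ) ^ η := by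
  have hsum : Summable fun n : ℕ => (n : ℝ) ^ (-(1 + η)) := Real.summable_nat_rpow.mpr (by linarith)
  refine ⟨∑' n : ℕ, (n : ℝ) ^ (-(1 + η)), ?_, fun Y => ?_⟩
  · have := hsum.le_tsum 1 fun n _ => by positivity
    simpa using this
  · rw [mul_comm]
    calc ∑ m ∈ Icc 1 Y, (m : ℝ)⁻¹ ≤ ∑ m ∈ Icc 1 Y, (Y : ℝ) ^ η * (m : ℝ) ^ (-(1 + η)) := by
          refine sum_le_sum fun m hm => ?_
          have hm1 := mem_Icc.mp hm
          have hm0 : (0 : ℝ) < m := by exact_mod_cast hm1.1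
          have hmY : (m : ℝ) ≤ Y := by exact_mod_cast hm1.2
          calc (m : ℝ)⁻¹ = (m : ℝ) ^ η * (m : ℝ) ^ (-(1 + η)) := by
                rw [← Real.rpow_add hm0, ← Real.rpow_neg_one]; congr 1; ring
            _ ≤ _ := by gcongr
      _ ≤ _ := by
          rw [← mul_sum]
          gcongr
          exact hsum.sum_le_tsum _ fun n _ => by positivity

lemma integral_square_eq {q : ℕ} [Fact q.Prime] {a : ℕ} {δ : ℝ} {ω : ℕ → ℝ} (hω : ω = squareCoeff a ((3 / 5 - δ) * Real.log q)) (hωs : Summable ω)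
    {χ : DirichletCharacter ℂ q} (h : HasParity χ a) :
    ∫ p : ℝ × ℝ, (if (2 / 5 + δ) * Real.log q < p.1 + p.2 then logTheta a χ p.1 * logTheta a χ p.2 else 0) =
      ∑ r : (ZMod q)ˣ, (classSum ω r : ℂ) * χ r := by
  have h3 := hasSum_square h ((2 / 5 + δ) * Real.log q)
  rw [show Real.log q - (2 / 5 + δ) * Real.log q = (3 / 5 - δ) * Real.log q by ring, ← hω] at h3
  exact h3.unique (hasSum_mul_class hωs (chi_zero _))

set_option maxHeartbeats 2000000 in
lemma exists_average_dual_square_le {δ : ℝ} (hδ : 0 < δ) (hδ1 : δ ≤ 1 / 20) : ∃ C : ℝ, 0 < C ∧ ∀ (q : ℕ) [Fact q.Prime], q ≠ 2 →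
    ∀ a ≤ 1, ∀ Y : ℕ, 1 ≤ Y → (Y : ℝ) ≤ (q : ℝ) ^ (3 / 10 - δ) → ∀ c : ℕ → ℝ,
    (∀ m ∈ Icc 1 Y, |c m| ≤ m.divisors.card * (m : ℝ) ^ (-(1 / 2) : ℝ)) →
    ‖average a (fun χ : DirichletCharacter ℂ q => rootNumber a χ ^ 2 * mollifier Y c χ ^ 2 *
      ∫ p : ℝ × ℝ, if (2 / 5 + δ) * Real.log q < p.1 + p.2 then logTheta a χ⁻¹ p.1 * logTheta a χ⁻¹ p.2 else 0)‖ ≤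
      C * (q : ℝ) ^ (-(δ / 2)) := by
  set η := δ / 13 with hη
  have hη0 : 0 < η := by positivity
  obtain ⟨D, hD, hd⟩ := exists_card_divisors_le hη0
  obtain ⟨W, hW, hw⟩ := exists_squareCoeff_le (B := 1 / 2 + 2 * η) (by positivity) hη0
  obtain ⟨W₁, hW₁, hw₁⟩ := exists_squareCoeff_le (B := 3 * η) (by positivity) hη0
  obtain ⟨W₂, hW₂, hw₂⟩ := exists_squareCoeff_le (B := 1 / 2 + 3 * η) (by positivity) hη0
  obtain ⟨S, hS, hinv⟩ := exists_sum_inv_le hη0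
  obtain ⟨R, hR, hsq⟩ := exists_sum_class_sq_le hη0
  have hsumm : Summable fun n : ℕ => (n : ℝ) ^ (-(1 + η)) := Real.summable_nat_rpow.mpr (by linarith)
  set T := ∑' n : ℕ, (n : ℝ) ^ (-(1 + η)) with hT
  have hT0 : 0 ≤ T := tsum_nonneg fun n => by positivity
  have hS0 : 0 ≤ S := by linarith
  set K := (2 * D * (W * T)) ^ 2 * (R * ((W₁ * D * D) ^ 2 + (W₂ * D * D) ^ 2) * (600 * (D ^ 2 * S) ^ 2 + 200 * (2 * D) ^ 4)) + 1 with hK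
  have hK1 : 1 ≤ K := le_add_of_nonneg_left (by positivity)
  refine ⟨2 * K + 3 * (W * T * (2 * D) ^ 2), by positivity, fun q hq h2 a ha Y hY hYq c hc => ?_⟩
  have hq0 : (0 : ℝ) < q := by exact_mod_cast hq.out.pos
  have hq2 : (2 : ℝ) < q := two_lt_cast h2
  have hq1 : (1 : ℝ) ≤ q := by linarith
  have hY0 : (0 : ℝ) ≤ Y := Nat.cast_nonneg Y
  have hYlt : Y < q := by
    have h : (Y : ℝ) < (q : ℝ) ^ (1 : ℝ) := hYq.trans_lt (Real.rpow_lt_rpow_of_exponent_lt (by linarith) (by linarith))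
    rw [Real.rpow_one] at h
    exact_mod_cast h
  set θ := 3 / 10 - δ with hθ
  have hcX := abs_coeff_le hη0.le (by positivity) hd hYq hc
  set X := D * ((q : ℝ) ^ θ) ^ η with hXdef
  have hX : 0 ≤ X := by positivity
  have hXle : X ≤ D * (q : ℝ) ^ (θ * η) := by rw [hXdef, Real.rpow_mul hq0.le]
  set ω : ℕ → ℝ := squareCoeff a ((3 / 5 - δ) * Real.log q) with hω
  have hω0 : ∀ n, 0 ≤ ω n := fun n => squareCoeff_nonneg _ _ _
  have hωz : ω 0 = 0 := by simp [hω, squareCoeff]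
  have hωle : ∀ n, ω n ≤ W * (q : ℝ) ^ ((3 / 5 - δ) * (1 / 2 + 2 * η)) * (n : ℝ) ^ (-(1 + η)) := fun n => by
    rcases eq_or_ne n 0 with rfl | hn
    · rw [hωz]; positivity
    · have := hw a ha q hq0 (3 / 5 - δ) n hn
      rwa [show 1 / 2 + (1 / 2 + 2 * η) - η = 1 + η by ring] at this
  have hωs : Summable ω := Summable.of_nonneg_of_le hω0 hωle (hsumm.mul_left _)
  have hωsum : ∑' n, ω n ≤ W * T * (q : ℝ) ^ ((3 / 5 - δ) * (1 / 2 + 2 * η)) := by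
    refine (hωs.tsum_le_tsum hωle (hsumm.mul_left _)).trans (le_of_eq ?_)
    rw [tsum_mul_left]; ring
  set g := unitCoeff q Y c with hg
  clear_value g ω X K T θ η
  have hθη : θ * η ≤ η := mul_le_of_le_one_left hη0.le (by linarith)
  have hgabs : ∑ u, |g u| ≤ 2 * D * (q : ℝ) ^ (θ * η + θ / 2) := by
    rw [hg, sum_unitCoeff_comp hYlt c (fun x _ => |x|) fun _ => abs_zero]
    calc _ ≤ ∑ m ∈ Icc 1 Y, X * (m : ℝ) ^ (-(1 / 2) : ℝ) := sum_le_sum hcX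
      _ = X * ∑ m ∈ Icc 1 Y, (m : ℝ) ^ (-(1 / 2) : ℝ) := by rw [mul_sum]
      _ ≤ (D * (q : ℝ) ^ (θ * η)) * (2 * ((q : ℝ) ^ θ) ^ (1 / 2 : ℝ)) := by
          gcongr
          exact (sum_rpow_neg_half_le Y).trans (by gcongr)
      _ = _ := by
          rw [← Real.rpow_mul hq0.le, Real.rpow_add hq0, show θ * (1 / 2) = θ / 2 by ring]; ring
  have hgsq : ∑ u, g u ^ 2 ≤ D ^ 2 * S * (q : ℝ) ^ (3 * (θ * η)) := by
    rw [hg, sum_unitCoeff_comp hYlt c (fun x _ => x ^ 2) fun _ => by norm_num]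
    calc _ ≤ ∑ m ∈ Icc 1 Y, X ^ 2 * (m : ℝ)⁻¹ := by
          refine sum_le_sum fun m hm => ?_
          have hm0 : (0 : ℝ) < m := by exact_mod_cast (mem_Icc.mp hm).1
          rw [← sq_abs]
          calc _ ≤ (X * (m : ℝ) ^ (-(1 / 2) : ℝ)) ^ 2 := by gcongr; exact hcX m hm
            _ = X ^ 2 * ((m : ℝ) ^ (-(1 / 2) : ℝ) * (m : ℝ) ^ (-(1 / 2) : ℝ)) := by ring
            _ = _ := by rw [← Real.rpow_add hm0, ← Real.rpow_neg_one]; norm_num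
      _ = X ^ 2 * ∑ m ∈ Icc 1 Y, (m : ℝ)⁻¹ := by rw [mul_sum]
      _ ≤ (D * (q : ℝ) ^ (θ * η)) ^ 2 * (S * ((q : ℝ) ^ θ) ^ η) := by
          gcongr
          exact (hinv Y).trans (by gcongr)
      _ = _ := by
          rw [← Real.rpow_mul hq0.le, show 3 * (θ * η) = θ * η + θ * η + θ * η by ring, Real.rpow_add hq0, Real.rpow_add hq0]; ring
  have hH : ∑ s, (∑ u, |g u| * classSum ω (s * u⁻¹)) ^ 2 ≤ R * ((W₁ * D * D) ^ 2 + (W₂ * D * D) ^ 2) * (q : ℝ) ^ (12 * η) := by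
    have hm := hsq q (mollify Y (fun m => |c m|) fun n => (ω n : ℂ)) _ (hasSum_class_mollify hωs hYlt c)
      (W₁ * (q : ℝ) ^ ((3 / 5 - δ) * (3 * η)) * X * D * (Y : ℝ) ^ (1 / 2 + 2 * η - 1 / 2))
      (W₂ * (q : ℝ) ^ ((3 / 5 - δ) * (1 / 2 + 3 * η)) * X * D * (Y : ℝ) ^ (1 + 2 * η - 1 / 2)) (by positivity) (by positivity)
      (fun v hv => by
        have := norm_mollify_le (Y := Y) (c := fun m => |c m|) (F := fun n => (ω n : ℂ)) (ρ := 1 / 2 + 2 * η)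
          (A := W₁ * (q : ℝ) ^ ((3 / 5 - δ) * (3 * η))) (by linarith) hX (by positivity)
          (fun m hm => by rw [abs_abs]; exact hcX m hm) (fun n hn => by
            rw [Complex.norm_real, Real.norm_of_nonneg (hω0 n)]
            have := hw₁ a ha q hq0 (3 / 5 - δ) n hn
            rwa [show 1 / 2 + 3 * η - η = 1 / 2 + 2 * η by ring, ← hω] at this) hd hv
        rwa [show 1 / 2 + 2 * η - η = 1 / 2 + η by ring] at this)
      (fun v hv => by
        have := norm_mollify_le (Y := Y) (c := fun m => |c m|) (F := fun n => (ω n : ℂ)) (ρ := 1 + 2 * η)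
          (A := W₂ * (q : ℝ) ^ ((3 / 5 - δ) * (1 / 2 + 3 * η))) (by linarith) hX (by positivity)
          (fun m hm => by rw [abs_abs]; exact hcX m hm) (fun n hn => by
            rw [Complex.norm_real, Real.norm_of_nonneg (hω0 n)]
            have := hw₂ a ha q hq0 (3 / 5 - δ) n hn
            rwa [show 1 / 2 + (1 / 2 + 3 * η) - η = 1 + 2 * η by ring, ← hω] at this) hd hv
        rwa [show 1 + 2 * η - η = 1 + η by ring] at this)
    rw [← hg] at hm
    refine hm.trans ?_
    rw [mul_assoc R]
    have hA₁ : W₁ * (q : ℝ) ^ ((3 / 5 - δ) * (3 * η)) * X * D * (Y : ℝ) ^ (1 / 2 + 2 * η - 1 / 2) ≤ W₁ * D * D * (q : ℝ) ^ (6 * η) := by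
      calc _ ≤ W₁ * (q : ℝ) ^ ((3 / 5 - δ) * (3 * η)) * (D * (q : ℝ) ^ (θ * η)) * D * ((q : ℝ) ^ θ) ^ (1 / 2 + 2 * η - 1 / 2) := by
            have h0 : 0 ≤ 1 / 2 + 2 * η - 1 / 2 := by linarith
            gcongr
        _ = W₁ * D * D * ((q : ℝ) ^ ((3 / 5 - δ) * (3 * η)) * (q : ℝ) ^ (θ * η) * (q : ℝ) ^ (θ * (1 / 2 + 2 * η - 1 / 2))) := by
            rw [← Real.rpow_mul hq0.le]; ring
        _ ≤ _ := by
            simp only [← Real.rpow_add hq0]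
            refine mul_le_mul_of_nonneg_left (Real.rpow_le_rpow_of_exponent_le hq1 ?_) (by positivity)
            rw [hθ]
            nlinarith [mul_pos hη0 hδ]
    have hA₂ : W₂ * (q : ℝ) ^ ((3 / 5 - δ) * (1 / 2 + 3 * η)) * X * D * (Y : ℝ) ^ (1 + 2 * η - 1 / 2) ≤
        W₂ * D * D * (q : ℝ) ^ (1 / 2 + 6 * η) := by
      calc _ ≤ W₂ * (q : ℝ) ^ ((3 / 5 - δ) * (1 / 2 + 3 * η)) * (D * (q : ℝ) ^ (θ * η)) * D * ((q : ℝ) ^ θ) ^ (1 + 2 * η - 1 / 2) := by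
            have h0 : 0 ≤ 1 + 2 * η - 1 / 2 := by linarith
            gcongr
        _ = W₂ * D * D * ((q : ℝ) ^ ((3 / 5 - δ) * (1 / 2 + 3 * η)) * (q : ℝ) ^ (θ * η) * (q : ℝ) ^ (θ * (1 + 2 * η - 1 / 2))) := by
            rw [← Real.rpow_mul hq0.le]; ring
        _ ≤ _ := by
            simp only [← Real.rpow_add hq0]
            refine mul_le_mul_of_nonneg_left (Real.rpow_le_rpow_of_exponent_le hq1 ?_) (by positivity)
            rw [hθ]
            nlinarith [mul_pos hη0 hδ]
    calc _ ≤ R * ((W₁ * D * D * (q : ℝ) ^ (6 * η)) ^ 2 + (W₂ * D * D * (q : ℝ) ^ (1 / 2 + 6 * η)) ^ 2 / q) := by gcongr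
      _ = R * ((W₁ * D * D) ^ 2 * ((q : ℝ) ^ (6 * η) * (q : ℝ) ^ (6 * η)) +
          (W₂ * D * D) ^ 2 * ((q : ℝ) ^ (1 / 2 + 6 * η) * (q : ℝ) ^ (1 / 2 + 6 * η) * (q : ℝ) ^ (-1 : ℝ))) := by
          rw [Real.rpow_neg_one]; ring
      _ = _ := by
          simp only [← Real.rpow_add hq0]
          rw [show 6 * η + 6 * η = 12 * η by ring, show 1 / 2 + 6 * η + (1 / 2 + 6 * η) + -1 = 12 * η by ring]
          ring
  have hfour : 600 * (q : ℝ) ^ 3 * (∑ u, g u ^ 2) ^ 2 + 200 * ((q : ℝ) ^ 2 * √q) * (∑ u, |g u|) ^ 4 ≤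
      (600 * (D ^ 2 * S) ^ 2 + 200 * (2 * D) ^ 4) * (q : ℝ) ^ (5 / 2 + 2 * θ + 6 * η) := by
    have e3 : (q : ℝ) ^ 3 = (q : ℝ) ^ (3 : ℝ) := by norm_cast
    have e2 : (q : ℝ) ^ 2 * √q = (q : ℝ) ^ (5 / 2 : ℝ) := by
      rw [Real.sqrt_eq_rpow, ← Real.rpow_natCast, ← Real.rpow_add hq0]; norm_num
    rw [e3, e2]
    calc _ ≤ 600 * (q : ℝ) ^ (3 : ℝ) * (D ^ 2 * S * (q : ℝ) ^ (3 * (θ * η))) ^ 2 +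
          200 * (q : ℝ) ^ (5 / 2 : ℝ) * (2 * D * (q : ℝ) ^ (θ * η + θ / 2)) ^ 4 := by
          gcongr
      _ = 600 * (D ^ 2 * S) ^ 2 * ((q : ℝ) ^ (3 : ℝ) * (q : ℝ) ^ (3 * (θ * η)) * (q : ℝ) ^ (3 * (θ * η))) +
          200 * (2 * D) ^ 4 * ((q : ℝ) ^ (5 / 2 : ℝ) * (q : ℝ) ^ (θ * η + θ / 2) * (q : ℝ) ^ (θ * η + θ / 2) *
            (q : ℝ) ^ (θ * η + θ / 2) * (q : ℝ) ^ (θ * η + θ / 2)) := by ring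
      _ ≤ 600 * (D ^ 2 * S) ^ 2 * (q : ℝ) ^ (5 / 2 + 2 * θ + 6 * η) + 200 * (2 * D) ^ 4 * (q : ℝ) ^ (5 / 2 + 2 * θ + 6 * η) := by
          simp only [← Real.rpow_add hq0]
          refine add_le_add (mul_le_mul_of_nonneg_left (Real.rpow_le_rpow_of_exponent_le hq1 ?_) (by positivity))
            (mul_le_mul_of_nonneg_left (Real.rpow_le_rpow_of_exponent_le hq1 ?_) (by positivity)) <;> linarith
      _ = _ := by ring
  have hΩsum : ∑ r : (ZMod q)ˣ, classSum ω r ≤ W * T * (q : ℝ) ^ ((3 / 5 - δ) * (1 / 2 + 2 * η)) :=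
    (sum_classSum_le hω0 hωs).trans hωsum
  have hΩ0 : ∀ r : (ZMod q)ˣ, 0 ≤ classSum ω r := classSum_nonneg hω0
  have hΩs0 : 0 ≤ ∑ r : (ZMod q)ˣ, classSum ω r := sum_nonneg fun r _ => hΩ0 r
  have hga0 : 0 ≤ ∑ u, |g u| := sum_nonneg fun _ _ => abs_nonneg _
  have hB4 : ((∑ u, |g u|) * ∑ r : (ZMod q)ˣ, classSum ω r) ^ 2 * ((∑ s, (∑ u, |g u| * classSum ω (s * u⁻¹)) ^ 2) *
      (600 * (q : ℝ) ^ 3 * (∑ u, g u ^ 2) ^ 2 + 200 * ((q : ℝ) ^ 2 * √q) * (∑ u, |g u|) ^ 4)) ≤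
      (K * (q : ℝ) ^ (1 - δ / 2)) ^ 4 := by
    calc _ ≤ ((2 * D * (q : ℝ) ^ (θ * η + θ / 2)) * (W * T * (q : ℝ) ^ ((3 / 5 - δ) * (1 / 2 + 2 * η)))) ^ 2 *
          ((R * ((W₁ * D * D) ^ 2 + (W₂ * D * D) ^ 2) * (q : ℝ) ^ (12 * η)) *
          ((600 * (D ^ 2 * S) ^ 2 + 200 * (2 * D) ^ 4) * (q : ℝ) ^ (5 / 2 + 2 * θ + 6 * η))) := by
          gcongr
      _ = (K - 1) * ((q : ℝ) ^ (θ * η + θ / 2) * (q : ℝ) ^ (θ * η + θ / 2) * (q : ℝ) ^ ((3 / 5 - δ) * (1 / 2 + 2 * η)) *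
          (q : ℝ) ^ ((3 / 5 - δ) * (1 / 2 + 2 * η)) * (q : ℝ) ^ (12 * η) * (q : ℝ) ^ (5 / 2 + 2 * θ + 6 * η)) := by
          rw [hK]; ring
      _ ≤ K ^ 4 * ((q : ℝ) ^ (1 - δ / 2) * (q : ℝ) ^ (1 - δ / 2) * (q : ℝ) ^ (1 - δ / 2) * (q : ℝ) ^ (1 - δ / 2)) := by
          simp only [← Real.rpow_add hq0]
          refine mul_le_mul ?_ (Real.rpow_le_rpow_of_exponent_le hq1 ?_) (by positivity) (by positivity)
          · calc K - 1 ≤ K ^ 1 := by linarith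
              _ ≤ K ^ 4 := pow_le_pow_right₀ hK1 (by norm_num)
          · rw [hθ, hη]
            nlinarith [mul_pos hδ hδ]
      _ = _ := by ring
  have hfinal := norm_average_dual_le h2 ha g hΩ0 (B := K * (q : ℝ) ^ (1 - δ / 2)) (by positivity) hB4
  have hcongr : average a (fun χ : DirichletCharacter ℂ q => rootNumber a χ ^ 2 * mollifier Y c χ ^ 2 *
      ∫ p : ℝ × ℝ, if (2 / 5 + δ) * Real.log q < p.1 + p.2 then logTheta a χ⁻¹ p.1 * logTheta a χ⁻¹ p.2 else 0) =
      average a (fun χ : DirichletCharacter ℂ q => rootNumber a χ ^ 2 * (∑ u : (ZMod q)ˣ, (g u : ℂ) * χ u) ^ 2 *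
      ∑ r : (ZMod q)ˣ, (classSum ω r : ℂ) * χ⁻¹ r) := by
    refine average_congr fun χ hχ => ?_
    rw [mollifier_eq_sum_units hYlt]
    rw [integral_square_eq hω hωs ((mem_parityFamily ha).mp hχ).2.inv, hg]
  rw [hcongr]
  refine hfinal.trans ?_
  have hcorr : 2 / ((q : ℝ) - 1) * ((∑ r : (ZMod q)ˣ, classSum ω r) * (∑ u, |g u|) ^ 2) ≤ 3 * (W * T * (2 * D) ^ 2) * (q : ℝ) ^ (1 - δ / 2) := by
    have hq3 : 2 / ((q : ℝ) - 1) ≤ 3 := by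
      rw [div_le_iff₀ (by linarith)]
      linarith
    calc _ ≤ 3 * ((W * T * (q : ℝ) ^ ((3 / 5 - δ) * (1 / 2 + 2 * η))) * (2 * D * (q : ℝ) ^ (θ * η + θ / 2)) ^ 2) := by
          gcongr
      _ = 3 * (W * T * (2 * D) ^ 2) * ((q : ℝ) ^ ((3 / 5 - δ) * (1 / 2 + 2 * η)) * (q : ℝ) ^ (θ * η + θ / 2) * (q : ℝ) ^ (θ * η + θ / 2)) := by
          ring
      _ ≤ _ := by
          simp only [← Real.rpow_add hq0]
          refine mul_le_mul_of_nonneg_left (Real.rpow_le_rpow_of_exponent_le hq1 ?_) (by positivity)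
          rw [hθ, hη]
          nlinarith [mul_pos hδ hδ]
  rw [div_le_iff₀ hq0]
  calc _ ≤ (2 * K + 3 * (W * T * (2 * D) ^ 2)) * (q : ℝ) ^ (1 - δ / 2) := by linarith
    _ = _ := by
      rw [mul_assoc _ _ (q : ℝ), ← Real.rpow_add_one hq0.ne']
      congr 2; ring

end DualBound

section SquareMoment

open Finset MeasureTheory

/-- The mollified second moment without absolute values. -/
lemma exists_square_moment_le {δ : ℝ} (hδ : 0 < δ) (hδ1 : δ ≤ 1 / 20) : ∃ C : ℝ, 0 < C ∧ ∀ (q : ℕ) [Fact q.Prime], q ≠ 2 →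
    ∀ a ≤ 1, ∀ Y : ℕ, 1 ≤ Y → (Y : ℝ) ≤ (q : ℝ) ^ (3 / 10 - δ) → ∀ c : ℕ → ℝ,
    (∀ m ∈ Icc 1 Y, |c m| ≤ m.divisors.card * (m : ℝ) ^ (-(1 / 2) : ℝ)) →
    ‖average a (fun χ : DirichletCharacter ℂ q => ((kernelMass a : ℂ) * χ.LFunction (1 / 2) * mollifier Y c χ) ^ 2)‖ ≤
      kernelMass a ^ 2 + C * (q : ℝ) ^ (-(δ / 4)) := by
  obtain ⟨C₁, hC₁, h₁⟩ := exists_average_square_le hδ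
  obtain ⟨C₂, hC₂, h₂⟩ := exists_average_dual_square_le hδ hδ1
  refine ⟨C₁ + C₂, by positivity, fun q hq h2 a ha Y hY hYq c hc => ?_⟩
  have hq1 : (1 : ℝ) ≤ q := by linarith [two_lt_cast h2]
  have k₁ := h₁ q h2 a ha (3 / 10 - δ) (by linarith) (by linarith) Y hY hYq c hc
  have k₂ := h₂ q h2 a ha Y hY hYq c hc
  rw [show 1 - δ - 2 * (3 / 10 - δ) = 2 / 5 + δ by ring] at k₁
  rw [average_congr (g := fun χ : DirichletCharacter ℂ q => (mollifier Y c χ ^ 2 *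
      ∫ p : ℝ × ℝ, if -((2 / 5 + δ) * Real.log q) < p.1 + p.2 then logTheta a χ p.1 * logTheta a χ p.2 else 0) +
      rootNumber a χ ^ 2 * mollifier Y c χ ^ 2 *
      ∫ p : ℝ × ℝ, if (2 / 5 + δ) * Real.log q < p.1 + p.2 then logTheta a χ⁻¹ p.1 * logTheta a χ⁻¹ p.2 else 0)
      fun χ hχ => ?_, average_add]
  · refine (norm_add_le _ _).trans ?_
    have : (q : ℝ) ^ (-(δ / 2)) ≤ (q : ℝ) ^ (-(δ / 4)) := Real.rpow_le_rpow_of_exponent_le hq1 (by linarith)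
    nlinarith
  · obtain ⟨hχ1, hp⟩ := (mem_parityFamily ha).mp hχ
    have h := product_eq_add hχ1 hχ1 hp hp (-((2 / 5 + δ) * Real.log q))
    rw [neg_neg] at h
    calc _ = (kernelMass a : ℂ) ^ 2 * (χ.LFunction (1 / 2) * χ.LFunction (1 / 2)) * mollifier Y c χ ^ 2 := by ring
      _ = _ := by rw [h]; ring

end SquareMoment

section TotientSum

open Finset

/-- The squarefree integers up to `Y`. -/
def squarefrees (Y : ℕ) : Finset ℕ := (Icc 1 Y).filter Squarefree

/-- The sum of `1 / φ(d)` over squarefree `d ≤ Y`. -/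
noncomputable def totientSum (Y : ℕ) : ℝ := ∑ d ∈ squarefrees Y, (d.totient : ℝ)⁻¹

lemma mem_squarefrees {Y d : ℕ} : d ∈ squarefrees Y ↔ (1 ≤ d ∧ d ≤ Y) ∧ Squarefree d := by
  simp [squarefrees]

lemma inv_mul_prod_primeFactors (d : ℕ) :
    (d : ℝ)⁻¹ * ∏ p ∈ d.primeFactors, (1 - (p : ℝ)⁻¹)⁻¹ = (d.totient : ℝ)⁻¹ := by
  have h := Nat.totient_eq_mul_prod_factors d
  have h' : (d.totient : ℝ) = d * ∏ p ∈ d.primeFactors, (1 - (p : ℝ)⁻¹) := by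
    have := congrArg (fun x : ℚ => (x : ℝ)) h
    push_cast at this
    exact this
  rw [h', mul_inv, prod_inv_distrib]

lemma sum_inv_le_of_primeFactors_eq {d : ℕ} (hd : Squarefree d) (A : Finset ℕ)
    (hA : ∀ n ∈ A, n ≠ 0 ∧ n.primeFactors = d.primeFactors) : ∑ n ∈ A, (n : ℝ)⁻¹ ≤ (d.totient : ℝ)⁻¹ := by
  let f : ℕ →* ℝ := { toFun := fun n => (n : ℝ)⁻¹, map_one' := by simp, map_mul' := fun m n => by push_cast; rw [mul_inv] }
  have hE := (EulerProduct.summable_and_hasSum_factoredNumbers_prod_filter_prime_geometric (f := f)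
    (fun {p} hp => by
      have : (1 : ℝ) < p := by exact_mod_cast hp.one_lt
      change ‖(p : ℝ)⁻¹‖ < 1
      rw [norm_inv, Real.norm_natCast]
      exact inv_lt_one_of_one_lt₀ this) d.primeFactors).2
  rw [filter_true_of_mem fun p hp => Nat.prime_of_mem_primeFactors hp] at hE
  have hdvd : ∀ n ∈ A, d ∣ n := fun n hn => by
    rw [← Nat.prod_primeFactors_of_squarefree hd, ← (hA n hn).2]
    exact Nat.prod_primeFactors_dvd n
  have hd0 := hd.ne_zero
  have hmem : ∀ n ∈ A, n / d ∈ Nat.factoredNumbers d.primeFactors := fun n hn => by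
    rw [Nat.mem_factoredNumbers_iff_primeFactors_subset]
    obtain ⟨h0, h1⟩ := hA n hn
    refine ⟨(Nat.div_pos (Nat.le_of_dvd (Nat.pos_of_ne_zero h0) (hdvd n hn)) (Nat.pos_of_ne_zero hd0)).ne', ?_⟩
    rw [← h1]
    exact Nat.primeFactors_mono (Nat.div_dvd_of_dvd (hdvd n hn)) h0
  rw [← inv_mul_prod_primeFactors d]
  calc ∑ n ∈ A, (n : ℝ)⁻¹ = (d : ℝ)⁻¹ * ∑ n : A, f (n / d) := by
        rw [mul_sum, ← sum_coe_sort A]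
        refine sum_congr rfl fun n _ => ?_
        change _ = _ * (((n : ℕ) / d : ℕ) : ℝ)⁻¹
        rw [← mul_inv, ← Nat.cast_mul, Nat.mul_div_cancel' (hdvd n n.2)]
    _ ≤ _ := by
        gcongr
        let e : A → Nat.factoredNumbers d.primeFactors := fun n => ⟨n / d, hmem n n.2⟩
        have he : Function.Injective e := fun m n h => by
          have := congrArg Subtype.val h
          exact Subtype.ext (Nat.div_left_inj (hdvd m m.2) (hdvd n n.2) |>.mp this)
        calc ∑ n : A, f (n / d) = ∑ m ∈ univ.map ⟨e, he⟩, f m := by simp [e]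
          _ ≤ _ := sum_le_hasSum _ (fun m _ => by change 0 ≤ ((m : ℕ) : ℝ)⁻¹; positivity) hE

lemma log_le_totientSum (Y : ℕ) : Real.log (Y + 1) ≤ totientSum Y := by
  have h := log_add_one_le_harmonic Y
  rw [harmonic_eq_sum_Icc] at h
  push_cast at h
  refine h.trans ?_
  have hmaps : ∀ n ∈ Icc 1 Y, ∏ p ∈ n.primeFactors, p ∈ squarefrees Y := fun n hn => by
    obtain ⟨h1, h2⟩ := mem_Icc.mp hn
    refine mem_squarefrees.mpr ⟨⟨Nat.pos_of_ne_zero (prod_ne_zero_iff.mpr fun p hp => (Nat.prime_of_mem_primeFactors hp).ne_zero),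
      (Nat.le_of_dvd h1 (Nat.prod_primeFactors_dvd n)).trans h2⟩, ?_⟩
    rw [← Nat.radical_eq_prod_primeFactors]
    exact UniqueFactorizationMonoid.squarefree_radical
  rw [← sum_fiberwise_of_maps_to hmaps, totientSum]
  refine sum_le_sum fun d hd => sum_inv_le_of_primeFactors_eq (mem_squarefrees.mp hd).2 _ fun n hn => ?_
  obtain ⟨hn1, hn2⟩ := mem_filter.mp hn
  refine ⟨by have := (mem_Icc.mp hn1).1; omega, ?_⟩
  rw [← hn2, Nat.primeFactors_prod fun p hp => Nat.prime_of_mem_primeFactors hp]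

lemma squarefrees_succ (Y : ℕ) : squarefrees (Y + 1) = if Squarefree (Y + 1) then insert (Y + 1) (squarefrees Y) else squarefrees Y := by
  rw [squarefrees, ← insert_Icc_right_eq_Icc_add_one (by simp), filter_insert]
  rfl

lemma sum_log_le_totientSum (Y : ℕ) :
    ∑ d ∈ squarefrees Y, Real.log d * (d.totient : ℝ)⁻¹ ≤ Real.log (Y + 1) * totientSum Y - Real.log (Y + 1) ^ 2 / 2 := by
  induction Y with
  | zero => simp [squarefrees, totientSum]
  | succ n ih =>
    have hG := log_le_totientSum (n + 1)
    push_cast at hG ⊢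
    have hlog : Real.log (n + 1) ≤ Real.log (n + 1 + 1) := Real.log_le_log (by positivity) (by linarith)
    have key : ∑ d ∈ squarefrees (n + 1), Real.log d * (d.totient : ℝ)⁻¹ - Real.log (n + 1) * totientSum (n + 1) =
        ∑ d ∈ squarefrees n, Real.log d * (d.totient : ℝ)⁻¹ - Real.log (n + 1) * totientSum n := by
      rw [totientSum, totientSum, squarefrees_succ]
      split_ifs with h
      · have hn : n + 1 ∉ squarefrees n := by simp [mem_squarefrees]
        rw [sum_insert hn, sum_insert hn]
        push_cast
        ring
      · rfl
    nlinarith [mul_le_mul_of_nonneg_left hG (sub_nonneg.mpr hlog), sq_nonneg (Real.log (n + 1 + 1) - Real.log (n + 1))]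

end TotientSum

section SelbergWeights

open Finset
open scoped ArithmeticFunction.Moebius ArithmeticFunction.vonMangoldt

/-- The optimal mollifier weights, divided by the index. -/
noncomputable def selbergWeight (Y m : ℕ) : ℝ :=
  μ m / totientSum Y * ∑ n ∈ (squarefrees Y).filter (m ∣ ·), (n.totient : ℝ)⁻¹

lemma one_le_totientSum {Y : ℕ} (hY : 1 ≤ Y) : 1 ≤ totientSum Y := by
  have h := single_le_sum (f := fun d : ℕ => (d.totient : ℝ)⁻¹) (fun d _ => by positivity)
    (mem_squarefrees.mpr ⟨⟨le_refl 1, hY⟩, squarefree_one⟩)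
  simpa [totientSum] using h

lemma selbergWeight_one {Y : ℕ} (hY : 1 ≤ Y) : selbergWeight Y 1 = 1 := by
  have := one_le_totientSum hY
  simp only [selbergWeight, one_dvd, filter_true, ArithmeticFunction.moebius_apply_one]
  rw [← totientSum, Int.cast_one, one_div_mul_cancel (by linarith)]

lemma sum_totient_inv_dvd_le (Y : ℕ) {m : ℕ} (hm : m ≠ 0) :
    ∑ n ∈ (squarefrees Y).filter (m ∣ ·), (n.totient : ℝ)⁻¹ ≤ (m.totient : ℝ)⁻¹ * totientSum Y := by
  have hcop : ∀ n ∈ (squarefrees Y).filter (m ∣ ·), n = m * (n / m) ∧ m.Coprime (n / m) ∧ n / m ∈ squarefrees Y := fun n hn => by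
    obtain ⟨hn1, k, rfl⟩ := mem_filter.mp hn
    obtain ⟨⟨h1, h2⟩, h3⟩ := mem_squarefrees.mp hn1
    have hk : m * k / m = k := Nat.mul_div_cancel_left k (Nat.pos_of_ne_zero hm)
    rw [hk]
    refine ⟨rfl, Nat.coprime_of_squarefree_mul h3, mem_squarefrees.mpr ⟨⟨?_, ?_⟩, h3.squarefree_of_dvd (Dvd.intro_left m rfl)⟩⟩
    · exact Nat.pos_of_ne_zero fun h => by simp [h] at h1
    · exact (Nat.le_mul_of_pos_left k (Nat.pos_of_ne_zero hm)).trans h2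
  have hinj : Set.InjOn (· / m) ((squarefrees Y).filter (m ∣ ·) : Set ℕ) := fun a ha b hb h => by
    rw [(hcop a ha).1, (hcop b hb).1]
    exact congrArg (m * ·) h
  calc _ = ∑ n ∈ (squarefrees Y).filter (m ∣ ·), (m.totient : ℝ)⁻¹ * ((n / m).totient : ℝ)⁻¹ := by
        refine sum_congr rfl fun n hn => ?_
        obtain ⟨h1, h2, -⟩ := hcop n hn
        rw [← mul_inv, ← Nat.cast_mul, ← Nat.totient_mul h2, ← h1]
    _ = (m.totient : ℝ)⁻¹ * ∑ k ∈ ((squarefrees Y).filter (m ∣ ·)).image (· / m), (k.totient : ℝ)⁻¹ := by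
        rw [sum_image hinj, mul_sum]
    _ ≤ _ := by
        refine mul_le_mul_of_nonneg_left ?_ (by positivity)
        exact sum_le_sum_of_subset_of_nonneg (image_subset_iff.mpr fun n hn => (hcop n hn).2.2) fun _ _ _ => by positivity

lemma le_card_divisors_mul_totient (m : ℕ) : m ≤ m.divisors.card * m.totient := by
  calc m = ∑ d ∈ m.divisors, d.totient := (Nat.sum_totient m).symm
    _ ≤ _ := sum_le_card_nsmul _ _ _ fun d hd => Nat.le_of_dvd
      (Nat.totient_pos.mpr (Nat.pos_of_ne_zero (Nat.mem_divisors.mp hd).2)) (Nat.totient_dvd_of_dvd (Nat.dvd_of_mem_divisors hd))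

lemma abs_selbergWeight_le {Y m : ℕ} (hY : 1 ≤ Y) (hm : m ≠ 0) : |selbergWeight Y m| ≤ m.divisors.card * (m : ℝ)⁻¹ := by
  have hG := one_le_totientSum hY
  have hG0 : 0 < totientSum Y := by linarith
  have hm0 : (0 : ℝ) < m := by exact_mod_cast Nat.pos_of_ne_zero hm
  by_cases hsq : Squarefree m
  · have hφ : (0 : ℝ) < m.totient := by exact_mod_cast Nat.totient_pos.mpr (Nat.pos_of_ne_zero hm)
    have hμ : |(μ m : ℝ)| = 1 := by
      have := ArithmeticFunction.abs_moebius_eq_one_of_squarefree hsq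
      exact_mod_cast this
    have hs : 0 ≤ ∑ n ∈ (squarefrees Y).filter (m ∣ ·), (n.totient : ℝ)⁻¹ := sum_nonneg fun _ _ => by positivity
    rw [selbergWeight, abs_mul, abs_div, hμ, abs_of_pos hG0, abs_of_nonneg hs]
    calc _ ≤ 1 / totientSum Y * ((m.totient : ℝ)⁻¹ * totientSum Y) := by
          gcongr
          exact sum_totient_inv_dvd_le Y hm
      _ = (m.totient : ℝ)⁻¹ := by field_simp
      _ ≤ _ := by
          rw [inv_le_iff_one_le_mul₀ hφ, mul_right_comm, ← div_eq_mul_inv, one_le_div hm0]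
          exact_mod_cast le_card_divisors_mul_totient m
  · rw [selbergWeight, ArithmeticFunction.moebius_eq_zero_of_not_squarefree hsq]
    simp
    positivity

lemma sum_selbergWeight_mul (Y : ℕ) {d : ℕ} (hd : d ≠ 0) (f : ℕ → ℝ) :
    ∑ m ∈ (Icc 1 Y).filter (d ∣ ·), selbergWeight Y m * f m =
      μ d / totientSum Y * ∑ n ∈ (squarefrees Y).filter (d ∣ ·), (n.totient : ℝ)⁻¹ * ∑ k ∈ (n / d).divisors, μ k * f (d * k) := by
  have hinner : ∀ n ∈ squarefrees Y, ∑ m ∈ (Icc 1 Y).filter (d ∣ ·), (if m ∣ n then (μ m : ℝ) * f m else 0) =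
      if d ∣ n then μ d * ∑ k ∈ (n / d).divisors, μ k * f (d * k) else 0 := fun n hn => by
    obtain ⟨⟨hn1, hn2⟩, hsq⟩ := mem_squarefrees.mp hn
    rw [← sum_filter, filter_filter]
    split_ifs with hdn
    · obtain ⟨e, rfl⟩ := hdn
      have he : d * e / d = e := Nat.mul_div_cancel_left e (Nat.pos_of_ne_zero hd)
      have he0 : e ≠ 0 := fun h => by simp [h] at hn1
      rw [he, mul_sum]
      refine (sum_nbij (d * ·) (fun k hk => ?_) (fun a _ b _ h => Nat.eq_of_mul_eq_mul_left (Nat.pos_of_ne_zero hd) h)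
        (fun m hm => ?_) fun k hk => ?_).symm
      · have hke := Nat.dvd_of_mem_divisors hk
        have hk0 := Nat.pos_of_mem_divisors hk
        rw [mem_filter, mem_Icc]
        exact ⟨⟨Nat.mul_pos (Nat.pos_of_ne_zero hd) hk0, (Nat.mul_le_mul_left d (Nat.le_of_dvd (Nat.pos_of_ne_zero he0) hke)).trans hn2⟩,
          dvd_mul_right _ _, Nat.mul_dvd_mul_left d hke⟩
      · rw [mem_coe, mem_filter] at hm
        obtain ⟨-, ⟨k, rfl⟩, h2⟩ := hm
        exact ⟨k, by simpa [he0] using Nat.dvd_of_mul_dvd_mul_left (Nat.pos_of_ne_zero hd) h2, rfl⟩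
      · have hke := Nat.dvd_of_mem_divisors hk
        have hc : d.Coprime k := Nat.Coprime.coprime_dvd_right hke (Nat.coprime_of_squarefree_mul hsq)
        rw [ArithmeticFunction.isMultiplicative_moebius.map_mul_of_coprime hc]
        push_cast
        ring
    · refine sum_eq_zero fun m hm => absurd ?_ hdn
      obtain ⟨-, h1, h2⟩ := mem_filter.mp hm
      exact h1.trans h2
  calc _ = ∑ m ∈ (Icc 1 Y).filter (d ∣ ·), ∑ n ∈ squarefrees Y, (totientSum Y)⁻¹ * (n.totient : ℝ)⁻¹ *
        (if m ∣ n then (μ m : ℝ) * f m else 0) := by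
        refine sum_congr rfl fun m _ => ?_
        rw [selbergWeight, sum_filter, mul_sum, sum_mul]
        refine sum_congr rfl fun n _ => ?_
        split_ifs <;> ring
    _ = ∑ n ∈ squarefrees Y, (totientSum Y)⁻¹ * (n.totient : ℝ)⁻¹ *
        if d ∣ n then μ d * ∑ k ∈ (n / d).divisors, μ k * f (d * k) else 0 := by
        rw [sum_comm]
        refine sum_congr rfl fun n hn => ?_
        rw [← mul_sum, hinner n hn]
    _ = _ := by
        rw [sum_filter, mul_sum]
        refine sum_congr rfl fun n _ => ?_
        split_ifs <;> ring

lemma sum_moebius (n : ℕ) : ∑ k ∈ n.divisors, (μ k : ℝ) = if n = 1 then 1 else 0 := by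
  have h := congrArg (fun f : ArithmeticFunction ℝ => f n) (ArithmeticFunction.coe_moebius_mul_coe_zeta (R := ℝ))
  simp only [ArithmeticFunction.coe_mul_zeta_apply, ArithmeticFunction.one_apply, ArithmeticFunction.intCoe_apply] at h
  exact h

lemma sum_selbergWeight (Y : ℕ) {d : ℕ} (hd : d ≠ 0) :
    ∑ m ∈ (Icc 1 Y).filter (d ∣ ·), selbergWeight Y m =
      if d ∈ squarefrees Y then μ d / totientSum Y * (d.totient : ℝ)⁻¹ else 0 := by
  have h := sum_selbergWeight_mul Y hd fun _ => 1
  simp only [mul_one] at h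
  have hk : ∀ n ∈ (squarefrees Y).filter (d ∣ ·), (n.totient : ℝ)⁻¹ * ∑ k ∈ (n / d).divisors, (μ k : ℝ) =
      if n = d then (d.totient : ℝ)⁻¹ else 0 := fun n hn => by
    obtain ⟨hn1, e, rfl⟩ := mem_filter.mp hn
    have he : d * e / d = e := Nat.mul_div_cancel_left e (Nat.pos_of_ne_zero hd)
    rw [he, sum_moebius]
    by_cases h1 : e = 1
    · simp [h1]
    · have : d * e ≠ d := fun h => h1 (Nat.eq_of_mul_eq_mul_left (Nat.pos_of_ne_zero hd) (by omega))
      simp [h1, this]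
  rw [h, sum_congr rfl hk, sum_ite_eq' ]
  simp [mem_filter]

end SelbergWeights

section QuadraticForm

open Finset
open scoped ArithmeticFunction.Moebius ArithmeticFunction.vonMangoldt ArithmeticFunction.zeta

lemma sum_mul_gcd_eq (Y : ℕ) (u v h F : ℕ → ℝ) (hF : ∀ g, g ≠ 0 → F g = ∑ d ∈ g.divisors, h d) :
    ∑ m ∈ Icc 1 Y, ∑ m' ∈ Icc 1 Y, u m * v m' * F (m.gcd m') =
      ∑ d ∈ Icc 1 Y, h d * (∑ m ∈ (Icc 1 Y).filter (d ∣ ·), u m) * ∑ m ∈ (Icc 1 Y).filter (d ∣ ·), v m := by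
  have hg : ∀ m ∈ Icc 1 Y, ∀ m' ∈ Icc 1 Y, F (m.gcd m') = ∑ d ∈ Icc 1 Y, if d ∣ m then (if d ∣ m' then h d else 0) else 0 := by
    intro m hm m' _
    obtain ⟨h1, h2⟩ := mem_Icc.mp hm
    have hg0 : 0 < m.gcd m' := Nat.gcd_pos_of_pos_left _ h1
    rw [hF _ hg0.ne', ← sum_filter, ← sum_filter, filter_filter]
    refine sum_congr ?_ fun _ _ => rfl
    ext d
    rw [Nat.mem_divisors, mem_filter, mem_Icc, Nat.dvd_gcd_iff]
    refine ⟨fun ⟨hd, _⟩ => ⟨⟨Nat.pos_of_dvd_of_pos hd.1 h1, (Nat.le_of_dvd h1 hd.1).trans h2⟩, hd⟩, fun hd => ⟨hd.2, hg0.ne'⟩⟩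
  calc _ = ∑ m ∈ Icc 1 Y, ∑ m' ∈ Icc 1 Y, ∑ d ∈ Icc 1 Y, h d * (if d ∣ m then u m else 0) * (if d ∣ m' then v m' else 0) := by
        refine sum_congr rfl fun m hm => sum_congr rfl fun m' hm' => ?_
        rw [hg m hm m' hm', mul_sum]
        refine sum_congr rfl fun d _ => ?_
        split_ifs <;> ring
    _ = ∑ d ∈ Icc 1 Y, ∑ m ∈ Icc 1 Y, ∑ m' ∈ Icc 1 Y, h d * (if d ∣ m then u m else 0) * (if d ∣ m' then v m' else 0) := by
        rw [sum_comm_cycle]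
    _ = _ := by
        refine sum_congr rfl fun d _ => ?_
        rw [sum_filter, sum_filter, mul_assoc, sum_mul_sum, mul_sum]
        refine sum_congr rfl fun m _ => ?_
        rw [mul_sum]
        exact sum_congr rfl fun m' _ => by ring

lemma sum_Icc_mul_selbergWeight (Y : ℕ) (f : ℕ → ℝ) :
    ∑ d ∈ Icc 1 Y, f d * ∑ m ∈ (Icc 1 Y).filter (d ∣ ·), selbergWeight Y m =
      ∑ d ∈ squarefrees Y, f d * (μ d / totientSum Y * (d.totient : ℝ)⁻¹) := by
  rw [squarefrees, sum_filter]
  refine sum_congr rfl fun d hd => ?_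
  have hd1 := (mem_Icc.mp hd).1
  rw [sum_selbergWeight Y (by omega)]
  simp only [squarefrees, mem_filter, hd, true_and, mul_ite, mul_zero]

lemma moebius_sq_cast {d : ℕ} (h : Squarefree d) : (μ d : ℝ) * μ d = 1 := by
  have := ArithmeticFunction.moebius_sq_eq_one_of_squarefree h
  rw [← sq]
  exact_mod_cast this

lemma sum_gcd_selbergWeight (Y : ℕ) (h F : ℕ → ℝ) (hF : ∀ g, g ≠ 0 → F g = ∑ d ∈ g.divisors, h d) :
    ∑ m ∈ Icc 1 Y, ∑ m' ∈ Icc 1 Y, selbergWeight Y m * selbergWeight Y m' * F (m.gcd m') =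
      (totientSum Y ^ 2)⁻¹ * ∑ d ∈ squarefrees Y, h d * ((d.totient : ℝ) ^ 2)⁻¹ := by
  rw [sum_mul_gcd_eq Y _ _ h F hF, sum_Icc_mul_selbergWeight, mul_sum]
  refine sum_congr rfl fun d hd => ?_
  have hs := (mem_squarefrees.mp hd).2
  rw [sum_selbergWeight Y hs.ne_zero, if_pos hd]
  calc _ = (μ d * μ d : ℝ) * ((totientSum Y ^ 2)⁻¹ * (h d * ((d.totient : ℝ) ^ 2)⁻¹)) := by
        simp only [div_eq_mul_inv, sq, mul_inv]; ring
    _ = _ := by rw [moebius_sq_cast hs, one_mul]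

lemma sum_gcd_selbergWeight_self {Y : ℕ} (hY : 1 ≤ Y) :
    ∑ m ∈ Icc 1 Y, ∑ m' ∈ Icc 1 Y, selbergWeight Y m * selbergWeight Y m' * (m.gcd m' : ℝ) = (totientSum Y)⁻¹ := by
  have hG := one_le_totientSum hY
  rw [sum_gcd_selbergWeight Y (fun d => (d.totient : ℝ)) (fun g => (g : ℝ)) fun g _ => by rw [← Nat.cast_sum, Nat.sum_totient]]
  have : ∑ d ∈ squarefrees Y, (d.totient : ℝ) * ((d.totient : ℝ) ^ 2)⁻¹ = totientSum Y := by
    refine sum_congr rfl fun d hd => ?_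
    have hd1 := (mem_squarefrees.mp hd).1.1
    have : (d.totient : ℝ) ≠ 0 := by exact_mod_cast (Nat.totient_pos.mpr hd1).ne'
    field_simp
  rw [this]
  field_simp

lemma sum_moebius_mul_log {d e : ℕ} (hd : d ≠ 0) :
    ∑ k ∈ e.divisors, μ k * Real.log ((d * k : ℕ)) = (if e = 1 then Real.log d else 0) - Λ e := by
  have h1 := ArithmeticFunction.sum_moebius_mul_log_eq (n := e)
  have hd0 : (d : ℝ) ≠ 0 := by exact_mod_cast hd
  calc _ = ∑ k ∈ e.divisors, ((μ k : ℝ) * Real.log d + μ k * Real.log k) := by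
        refine sum_congr rfl fun k hk => ?_
        have hk0 : (k : ℝ) ≠ 0 := by exact_mod_cast (Nat.pos_of_mem_divisors hk).ne'
        rw [Nat.cast_mul, Real.log_mul hd0 hk0]
        ring
    _ = (∑ k ∈ e.divisors, (μ k : ℝ)) * Real.log d + ∑ k ∈ e.divisors, μ k * ArithmeticFunction.log k := by
        rw [sum_add_distrib, sum_mul]; rfl
    _ = _ := by
        rw [sum_moebius, h1]
        split_ifs <;> ring

lemma sum_log_gcd_selbergWeight (Y : ℕ) :
    ∑ m ∈ Icc 1 Y, ∑ m' ∈ Icc 1 Y, selbergWeight Y m * Real.log m * selbergWeight Y m' * (m.gcd m' : ℝ) = 0 := by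
  rw [sum_mul_gcd_eq Y (fun m => selbergWeight Y m * Real.log m) (selbergWeight Y) (fun d => (d.totient : ℝ)) (fun g => (g : ℝ))
    fun g _ => by rw [← Nat.cast_sum, Nat.sum_totient], sum_Icc_mul_selbergWeight]
  have hz : ∀ d ∈ squarefrees Y, (d.totient : ℝ) * (∑ m ∈ (Icc 1 Y).filter (d ∣ ·), selbergWeight Y m * Real.log m) *
      (μ d / totientSum Y * (d.totient : ℝ)⁻¹) = (totientSum Y ^ 2)⁻¹ * ∑ n ∈ squarefrees Y,
        if d ∣ n then (n.totient : ℝ)⁻¹ * ((if n = d then Real.log d else 0) - Λ (n / d)) else 0 := fun d hd => by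
    obtain ⟨⟨hd1, -⟩, hs⟩ := mem_squarefrees.mp hd
    have hφ : (d.totient : ℝ) ≠ 0 := by exact_mod_cast (Nat.totient_pos.mpr hd1).ne'
    rw [sum_selbergWeight_mul Y hs.ne_zero fun m => Real.log m, ← sum_filter]
    have e : ∀ n ∈ (squarefrees Y).filter (d ∣ ·), (n.totient : ℝ)⁻¹ * ∑ k ∈ (n / d).divisors, μ k * Real.log ((d * k : ℕ)) =
        (n.totient : ℝ)⁻¹ * ((if n = d then Real.log d else 0) - Λ (n / d)) := fun n hn => by
      obtain ⟨-, r, rfl⟩ := mem_filter.mp hn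
      rw [sum_moebius_mul_log hs.ne_zero, Nat.mul_div_cancel_left _ hd1]
      simp only [Nat.mul_eq_left hs.ne_zero]
    rw [sum_congr rfl e]
    calc _ = (μ d * μ d : ℝ) * ((totientSum Y ^ 2)⁻¹ * ((d.totient : ℝ) * (d.totient : ℝ)⁻¹) * ∑ n ∈ (squarefrees Y).filter (d ∣ ·),
          (n.totient : ℝ)⁻¹ * ((if n = d then Real.log d else 0) - Λ (n / d))) := by
          simp only [div_eq_mul_inv, sq, mul_inv]; ring
      _ = _ := by rw [moebius_sq_cast hs, one_mul, mul_inv_cancel₀ hφ, mul_one]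
  rw [sum_congr rfl hz, ← mul_sum, sum_comm]
  refine mul_eq_zero_of_right _ (sum_eq_zero fun n hn => ?_)
  obtain ⟨⟨hn1, hn2⟩, hs⟩ := mem_squarefrees.mp hn
  have hdiv : (squarefrees Y).filter (· ∣ n) = n.divisors := by
    ext d
    rw [mem_filter, mem_squarefrees, Nat.mem_divisors]
    exact ⟨fun h => ⟨h.2, by omega⟩, fun h => ⟨⟨⟨Nat.pos_of_dvd_of_pos h.1 hn1, (Nat.le_of_dvd hn1 h.1).trans hn2⟩,
      hs.squarefree_of_dvd h.1⟩, h.1⟩⟩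
  rw [← sum_filter, hdiv, ← mul_sum, sum_sub_distrib, Nat.sum_div_divisors n fun k => (Λ k : ℝ), ArithmeticFunction.vonMangoldt_sum,
    sum_ite_eq, if_pos (Nat.mem_divisors_self n (by omega)), sub_self, mul_zero]

/-- The Euler totient as a real arithmetic function. -/
def totientFunction : ArithmeticFunction ℝ := ⟨fun n => n.totient, by simp⟩

lemma sum_divisors_totient_log {n : ℕ} (hn : n ≠ 0) :
    ∑ d ∈ n.divisors, ((d.totient : ℝ) * Real.log d + (Λ * totientFunction) d) = n * Real.log n := by
  rw [sum_add_distrib, ← ArithmeticFunction.coe_mul_zeta_apply, mul_comm Λ, mul_assoc, ArithmeticFunction.vonMangoldt_mul_zeta,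
    ArithmeticFunction.mul_apply, Nat.sum_divisorsAntidiagonal fun i j => totientFunction i * ArithmeticFunction.log j, ← sum_add_distrib]
  calc _ = ∑ d ∈ n.divisors, (d.totient : ℝ) * Real.log n := by
        refine sum_congr rfl fun d hd => ?_
        obtain ⟨e, rfl⟩ := Nat.dvd_of_mem_divisors hd
        have hd0 : d ≠ 0 := left_ne_zero_of_mul hn
        have he0 : e ≠ 0 := right_ne_zero_of_mul hn
        rw [Nat.mul_div_cancel_left _ (Nat.pos_of_ne_zero hd0), Nat.cast_mul,
          Real.log_mul (by exact_mod_cast hd0) (by exact_mod_cast he0), mul_add]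
        rfl
    _ = _ := by rw [← sum_mul, ← Nat.cast_sum, Nat.sum_totient]

lemma cofactor_mul_gcd_sq {m m' : ℕ} (hm : 0 < m) (hm' : 0 < m') : cofactor m m' * (m.gcd m') ^ 2 = m * m' := by
  obtain ⟨r, hr⟩ := Nat.dvd_lcm_left m m'
  obtain ⟨s, hs⟩ := Nat.dvd_lcm_right m m'
  have e1 : m.lcm m' / m = r := by rw [hr, Nat.mul_div_cancel_left _ hm]
  have e2 : m.lcm m' / m' = s := by rw [hs, Nat.mul_div_cancel_left _ hm']
  rw [cofactor, e1, e2]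
  have hl := Nat.gcd_mul_lcm m m'
  have h1 : m.gcd m' * r = m' := Nat.eq_of_mul_eq_mul_left hm (by rw [← hl, hr]; ring)
  have h2 : m.gcd m' * s = m := Nat.eq_of_mul_eq_mul_right hm' (by rw [← hl, hs]; ring)
  calc _ = (m.gcd m' * s) * (m.gcd m' * r) := by ring
    _ = _ := by rw [h1, h2]

lemma log_cofactor {m m' : ℕ} (hm : 0 < m) (hm' : 0 < m') :
    Real.log (cofactor m m') = Real.log m + Real.log m' - 2 * Real.log (m.gcd m') := by
  have hg := Nat.gcd_pos_of_pos_left m' hm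
  have h := cofactor_mul_gcd_sq hm hm'
  have h' : (cofactor m m' : ℝ) * (m.gcd m' : ℝ) ^ 2 = m * m' := by exact_mod_cast h
  have hc : (0 : ℝ) < cofactor m m' := by exact_mod_cast cofactor_pos hm hm'
  have hg' : (0 : ℝ) < m.gcd m' := by exact_mod_cast hg
  have := congrArg Real.log h'
  rw [Real.log_mul hc.ne' (by positivity), Real.log_pow, Real.log_mul (by positivity) (by positivity)] at this
  push_cast at this
  linarith

end QuadraticForm

section MollifierForm

open Finset
open scoped ArithmeticFunction.Moebius ArithmeticFunction.vonMangoldt ArithmeticFunction.zeta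

lemma vonMangoldt_div_totient_sq_le {k : ℕ} (hk : Squarefree k) :
    Λ k * ((k.totient : ℝ) ^ 2)⁻¹ ≤ 8 * (k : ℝ) ^ (-(3 / 2) : ℝ) := by
  rcases eq_or_ne (Λ k) 0 with h0 | h0
  · rw [h0, zero_mul]; positivity
  · obtain ⟨p, n, hp, hn, rfl⟩ := (isPrimePow_nat_iff k).mp (ArithmeticFunction.vonMangoldt_ne_zero_iff.mp h0)
    have hn1 : n = 1 := ((Nat.squarefree_pow_iff hp.ne_one hn.ne').mp hk).2
    subst hn1
    rw [pow_one]
    have hp0 : (0 : ℝ) < p := by exact_mod_cast hp.pos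
    have hp2 : (2 : ℝ) ≤ p := by exact_mod_cast hp.two_le
    rw [ArithmeticFunction.vonMangoldt_apply_prime hp, Nat.totient_prime hp, Nat.cast_pred hp.pos]
    have hlog : Real.log p ≤ 2 * (p : ℝ) ^ (1 / 2 : ℝ) := by
      have := Real.log_le_rpow_div hp0.le (show (0 : ℝ) < 1 / 2 by norm_num)
      linarith
    have h1 : ((p : ℝ) - 1) ^ 2 ≥ (p : ℝ) ^ 2 / 4 := by nlinarith
    calc _ ≤ 2 * (p : ℝ) ^ (1 / 2 : ℝ) * ((p : ℝ) ^ 2 / 4)⁻¹ := by gcongr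
      _ = 8 * ((p : ℝ) ^ (1 / 2 : ℝ) * (p : ℝ) ^ (-2 : ℝ)) := by
        rw [Real.rpow_neg hp0.le, Real.rpow_two, inv_div]; ring
      _ = _ := by rw [← Real.rpow_add hp0]; norm_num

lemma exists_sum_vonMangoldt_totient_le : ∃ C : ℝ, 0 < C ∧ ∀ Y : ℕ,
    ∑ d ∈ squarefrees Y, (Λ * totientFunction) d * ((d.totient : ℝ) ^ 2)⁻¹ ≤ C * totientSum Y := by
  have hsum : Summable fun n : ℕ => (n : ℝ) ^ (-(3 / 2) : ℝ) := Real.summable_nat_rpow.mpr (by norm_num)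
  refine ⟨8 * ∑' n : ℕ, (n : ℝ) ^ (-(3 / 2) : ℝ), mul_pos (by norm_num) (hsum.tsum_pos (fun n => by positivity) 1 (by simp)), fun Y => ?_⟩
  have hterm : ∀ d ∈ squarefrees Y, (Λ * totientFunction) d * ((d.totient : ℝ) ^ 2)⁻¹ =
      ∑ p ∈ squarefrees Y ×ˢ squarefrees Y, if p.1 * p.2 = d then Λ p.1 * ((p.1.totient : ℝ) ^ 2)⁻¹ * (p.2.totient : ℝ)⁻¹ else 0 := by
    intro d hd
    obtain ⟨⟨hd1, hd2⟩, hs⟩ := mem_squarefrees.mp hd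
    have hset : d.divisorsAntidiagonal = (squarefrees Y ×ˢ squarefrees Y).filter fun p => p.1 * p.2 = d := by
      ext ⟨i, j⟩
      simp only [Nat.mem_divisorsAntidiagonal, mem_filter, mem_product, mem_squarefrees]
      refine ⟨fun ⟨h, _⟩ => ⟨?_, h⟩, fun h => ⟨h.2, by omega⟩⟩
      subst h
      have hi := Nat.pos_of_ne_zero (left_ne_zero_of_mul hs.ne_zero)
      have hj := Nat.pos_of_ne_zero (right_ne_zero_of_mul hs.ne_zero)
      exact ⟨⟨⟨hi, (Nat.le_mul_of_pos_right i hj).trans hd2⟩, hs.squarefree_of_dvd (dvd_mul_right _ _)⟩,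
        ⟨hj, (Nat.le_mul_of_pos_left j hi).trans hd2⟩, hs.squarefree_of_dvd (dvd_mul_left _ _)⟩
    rw [ArithmeticFunction.mul_apply, hset, sum_filter, sum_mul]
    refine sum_congr rfl fun p _ => ?_
    split_ifs with hp
    · obtain ⟨i, j⟩ := p
      subst hp
      have hj : (j.totient : ℝ) ≠ 0 := by
        exact_mod_cast (Nat.totient_pos.mpr (Nat.pos_of_ne_zero (right_ne_zero_of_mul hs.ne_zero))).ne'
      rw [Nat.totient_mul (Nat.coprime_of_squarefree_mul hs)]
      change Λ i * (j.totient : ℝ) * _ = _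
      push_cast
      rw [mul_pow, mul_inv, sq (j.totient : ℝ), mul_inv]
      field_simp
    · rw [zero_mul]
  rw [sum_congr rfl hterm, sum_comm]
  calc _ ≤ ∑ p ∈ squarefrees Y ×ˢ squarefrees Y, Λ p.1 * ((p.1.totient : ℝ) ^ 2)⁻¹ * (p.2.totient : ℝ)⁻¹ := by
        refine sum_le_sum fun p _ => ?_
        rw [sum_ite_eq]
        have h0 : 0 ≤ Λ p.1 := ArithmeticFunction.vonMangoldt_nonneg
        split_ifs
        · exact le_rfl
        · positivity
    _ = (∑ k ∈ squarefrees Y, Λ k * ((k.totient : ℝ) ^ 2)⁻¹) * totientSum Y := by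
        rw [sum_product, totientSum, sum_mul_sum]
    _ ≤ _ := by
        have hG : 0 ≤ totientSum Y := sum_nonneg fun _ _ => by positivity
        gcongr
        calc _ ≤ ∑ k ∈ squarefrees Y, 8 * (k : ℝ) ^ (-(3 / 2) : ℝ) :=
              sum_le_sum fun k hk => vonMangoldt_div_totient_sq_le (mem_squarefrees.mp hk).2
          _ ≤ _ := by
              rw [← mul_sum]
              gcongr
              exact hsum.sum_le_tsum _ fun _ _ => by positivity

/-- The coefficients of the mollifier. -/
noncomputable def mollifierCoeff (Y m : ℕ) : ℝ := selbergWeight Y m * (m : ℝ) ^ (1 / 2 : ℝ)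

lemma mollifierCoeff_one {Y : ℕ} (hY : 1 ≤ Y) : mollifierCoeff Y 1 = 1 := by
  simp [mollifierCoeff, selbergWeight_one hY]

lemma abs_mollifierCoeff_le {Y : ℕ} (hY : 1 ≤ Y) : ∀ m ∈ Icc 1 Y, |mollifierCoeff Y m| ≤ m.divisors.card * (m : ℝ) ^ (-(1 / 2) : ℝ) := by
  intro m hm
  have hm1 := (mem_Icc.mp hm).1
  have hm0 : (0 : ℝ) < m := by exact_mod_cast hm1
  rw [mollifierCoeff, abs_mul, abs_of_nonneg (Real.rpow_nonneg hm0.le _)]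
  calc _ ≤ m.divisors.card * (m : ℝ)⁻¹ * (m : ℝ) ^ (1 / 2 : ℝ) := by
        gcongr
        exact abs_selbergWeight_le hY (by omega)
    _ = _ := by
        rw [mul_assoc, ← Real.rpow_neg_one, ← Real.rpow_add hm0]
        norm_num

lemma mollifierCoeff_mul (Y : ℕ) {m m' : ℕ} (hm : 0 < m) (hm' : 0 < m') :
    mollifierCoeff Y m * mollifierCoeff Y m' * (cofactor m m' : ℝ) ^ (-(1 / 2) : ℝ) =
      selbergWeight Y m * selbergWeight Y m' * (m.gcd m' : ℝ) := by
  have h : (cofactor m m' : ℝ) * (m.gcd m' : ℝ) ^ 2 = m * m' := by exact_mod_cast cofactor_mul_gcd_sq hm hm'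
  have hc : (0 : ℝ) < cofactor m m' := by exact_mod_cast cofactor_pos hm hm'
  have e : (m : ℝ) ^ (1 / 2 : ℝ) * (m' : ℝ) ^ (1 / 2 : ℝ) * (cofactor m m' : ℝ) ^ (-(1 / 2) : ℝ) = m.gcd m' := by
    rw [← Real.mul_rpow (by positivity) (by positivity), ← h, Real.mul_rpow hc.le (by positivity), mul_right_comm,
      ← Real.rpow_add hc, ← Real.sqrt_eq_rpow, Real.sqrt_sq (by positivity)]
    norm_num
  calc _ = selbergWeight Y m * selbergWeight Y m' *
        ((m : ℝ) ^ (1 / 2 : ℝ) * (m' : ℝ) ^ (1 / 2 : ℝ) * (cofactor m m' : ℝ) ^ (-(1 / 2) : ℝ)) := by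
        rw [mollifierCoeff, mollifierCoeff]; ring
    _ = _ := by rw [e]

lemma mollifier_form_eq {Y : ℕ} (hY : 1 ≤ Y) (A k ℓ : ℝ) :
    ∑ m ∈ Icc 1 Y, ∑ m' ∈ Icc 1 Y, mollifierCoeff Y m * mollifierCoeff Y m' * (cofactor m m' : ℝ) ^ (-(1 / 2) : ℝ) *
        (A * (ℓ - Real.log (cofactor m m')) + k) =
      (A * ℓ + k) * (totientSum Y)⁻¹ + 2 * A * ((totientSum Y ^ 2)⁻¹ * ∑ d ∈ squarefrees Y,
        ((d.totient : ℝ) * Real.log d + (Λ * totientFunction) d) * ((d.totient : ℝ) ^ 2)⁻¹) := by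
  have h1 := sum_gcd_selbergWeight_self hY
  have h2 := sum_log_gcd_selbergWeight Y
  have h3 := sum_gcd_selbergWeight Y (fun d => (d.totient : ℝ) * Real.log d + (Λ * totientFunction) d) (fun g => g * Real.log g)
    fun g hg => (sum_divisors_totient_log hg).symm
  have h2' : ∑ m ∈ Icc 1 Y, ∑ m' ∈ Icc 1 Y, selbergWeight Y m * Real.log m' * selbergWeight Y m' * (m.gcd m' : ℝ) = 0 := by
    rw [sum_comm, ← h2]
    refine sum_congr rfl fun m _ => sum_congr rfl fun m' _ => ?_
    rw [Nat.gcd_comm]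
    ring
  rw [← h3, ← h1]
  calc _ = ∑ m ∈ Icc 1 Y, ∑ m' ∈ Icc 1 Y, ((A * ℓ + k) * (selbergWeight Y m * selbergWeight Y m' * (m.gcd m' : ℝ)) +
        2 * A * (selbergWeight Y m * selbergWeight Y m' * ((m.gcd m' : ℝ) * Real.log (m.gcd m'))) -
        A * (selbergWeight Y m * Real.log m * selbergWeight Y m' * (m.gcd m' : ℝ)) -
        A * (selbergWeight Y m * Real.log m' * selbergWeight Y m' * (m.gcd m' : ℝ))) := by
        refine sum_congr rfl fun m hm => sum_congr rfl fun m' hm' => ?_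
        have hm0 : 0 < m := (mem_Icc.mp hm).1
        have hm0' : 0 < m' := (mem_Icc.mp hm').1
        rw [mollifierCoeff_mul Y hm0 hm0', log_cofactor hm0 hm0']
        ring
    _ = _ := by
        simp only [sum_sub_distrib, sum_add_distrib, ← mul_sum]
        rw [h2, h2']
        ring

lemma exists_mollifier_form_le : ∃ C : ℝ, 0 < C ∧ ∀ Y : ℕ, 1 ≤ Y → ∀ θ : ℝ, 0 < θ → ∀ q : ℝ, 1 < q → q ^ θ ≤ Y + 1 → ∀ A k : ℝ, 0 ≤ A →
    ∑ m ∈ Icc 1 Y, ∑ m' ∈ Icc 1 Y, mollifierCoeff Y m * mollifierCoeff Y m' * (cofactor m m' : ℝ) ^ (-(1 / 2) : ℝ) *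
        (A * (Real.log q - Real.log (cofactor m m')) + k) ≤ A * (θ⁻¹ + 1) + (|k| + 2 * A * C) / (θ * Real.log q) := by
  obtain ⟨C, hC, hsum⟩ := exists_sum_vonMangoldt_totient_le
  refine ⟨C, hC, fun Y hY θ hθ q hq hqY A k hA => ?_⟩
  rw [mollifier_form_eq hY]
  have hq0 : 0 < q := by linarith
  set G := totientSum Y with hG
  set L := Real.log (Y + 1) with hL
  have hlogq : 0 < Real.log q := Real.log_pos hq
  have hqL : θ * Real.log q ≤ L := by
    rw [← Real.log_rpow hq0]
    exact Real.log_le_log (by positivity) hqY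
  have hL0 : 0 < L := lt_of_lt_of_le (by positivity) hqL
  have hLG : L ≤ G := log_le_totientSum Y
  have hG0 : 0 < G := by linarith
  have h1 : ∑ d ∈ squarefrees Y, ((d.totient : ℝ) * Real.log d + (Λ * totientFunction) d) * ((d.totient : ℝ) ^ 2)⁻¹ ≤
      L * G - L ^ 2 / 2 + C * G := by
    calc _ = ∑ d ∈ squarefrees Y, Real.log d * (d.totient : ℝ)⁻¹ + ∑ d ∈ squarefrees Y, (Λ * totientFunction) d * ((d.totient : ℝ) ^ 2)⁻¹ := by
          rw [← sum_add_distrib]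
          refine sum_congr rfl fun d hd => ?_
          have : (d.totient : ℝ) ≠ 0 := by exact_mod_cast (Nat.totient_pos.mpr (mem_squarefrees.mp hd).1.1).ne'
          field_simp
      _ ≤ _ := add_le_add (sum_log_le_totientSum Y) (hsum Y)
  set u := L * G⁻¹ with hu
  have hu1 : u ≤ 1 := by
    rw [hu, ← div_eq_mul_inv, div_le_one hG0]
    exact hLG
  have hu0 : 0 ≤ u := by positivity
  have hlq : Real.log q * G⁻¹ ≤ θ⁻¹ * u := by
    rw [hu, ← mul_assoc]
    gcongr
    rw [inv_mul_eq_div, le_div_iff₀ hθ]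
    linarith
  have hGinv : G⁻¹ ≤ (θ * Real.log q)⁻¹ := by gcongr; linarith
  have hθ' : 0 < θ⁻¹ := by positivity
  calc _ ≤ (A * Real.log q + |k|) * G⁻¹ + 2 * A * ((G ^ 2)⁻¹ * (L * G - L ^ 2 / 2 + C * G)) := by
        gcongr
        exact le_abs_self k
    _ = A * (Real.log q * G⁻¹) + A * (2 * u - u ^ 2) + (|k| + 2 * A * C) * G⁻¹ := by
        rw [hu]
        field_simp
        ring
    _ ≤ A * (θ⁻¹ * u) + A * (2 * u - u ^ 2) + (|k| + 2 * A * C) * (θ * Real.log q)⁻¹ := by gcongr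
    _ = A * (θ⁻¹ * u + (2 * u - u ^ 2)) + (|k| + 2 * A * C) / (θ * Real.log q) := by ring
    _ ≤ _ := by
        gcongr
        · exact mul_le_of_le_one_right hθ'.le hu1
        · nlinarith [sq_nonneg (1 - u)]

end MollifierForm

section Conjugation

open Finset MeasureTheory ComplexConjugate

variable {q : ℕ} [hq : Fact q.Prime]

lemma conj_logTheta {χ : DirichletCharacter ℂ q} {a : ℕ} (h : HasParity χ a) (v : ℝ) :
    conj (logTheta a χ v) = logTheta a χ⁻¹ v := by
  have h₁ := (hasSum_logTheta h v).map (starRingEnd ℂ) Complex.continuous_conj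
  refine h₁.unique ((hasSum_logTheta h.inv v).congr_fun fun n => ?_)
  simp only [Function.comp_apply, map_mul, Complex.conj_ofReal]
  rw [← MulChar.star_apply']
  rfl

lemma conj_LFunction {χ : DirichletCharacter ℂ q} (hχ : χ ≠ 1) {a : ℕ} (h : HasParity χ a) :
    conj (χ.LFunction (1 / 2)) = χ⁻¹.LFunction (1 / 2) := by
  have hk : (kernelMass a : ℂ) ≠ 0 := by exact_mod_cast (kernelMass_pos a).ne'
  have h₁ := congrArg (starRingEnd ℂ) (integral_logTheta hχ h)
  rw [← integral_conj, map_mul, Complex.conj_ofReal] at h₁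
  simp_rw [conj_logTheta h] at h₁
  rw [integral_logTheta (inv_ne_one.mpr hχ) h.inv] at h₁
  exact (mul_left_cancel₀ hk h₁).symm

lemma conj_mollifier {q : ℕ} (Y : ℕ) (c : ℕ → ℝ) (χ : DirichletCharacter ℂ q) :
    conj (mollifier Y c χ) = mollifier Y c χ⁻¹ := by
  simp only [mollifier, map_sum, map_mul, Complex.conj_ofReal]
  refine sum_congr rfl fun m _ => ?_
  rw [← MulChar.star_apply']
  rfl

lemma mollified_normSq {χ : DirichletCharacter ℂ q} (hχ : χ ≠ 1) {a : ℕ} (h : HasParity χ a) (Y : ℕ)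
    (c : ℕ → ℝ) :
    (kernelMass a : ℂ) ^ 2 * (χ.LFunction (1 / 2) * χ⁻¹.LFunction (1 / 2)) *
        (mollifier Y c χ * mollifier Y c χ⁻¹) =
      (Complex.normSq ((kernelMass a : ℂ) * χ.LFunction (1 / 2) * mollifier Y c χ) : ℝ) := by
  rw [← conj_LFunction hχ h, ← conj_mollifier, Complex.normSq_eq_conj_mul_self, map_mul, map_mul,
    Complex.conj_ofReal]
  ring

end Conjugation

section CauchySchwarz

open Finset

lemma sq_re_sum_le {ι : Type*} (S : Finset ι) (f : ι → ℂ) (p : ι → Prop) [DecidablePred p]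
    (hp : ∀ i ∈ S, ¬ p i → f i = 0) :
    (∑ i ∈ S, f i).re ^ 2 ≤ (#{i ∈ S | p i} : ℝ) *
      (((∑ i ∈ S, (Complex.normSq (f i) : ℂ)).re + (∑ i ∈ S, f i ^ 2).re) / 2) := by
  have h₁ : (∑ i ∈ S, f i).re = ∑ i ∈ S with p i, (f i).re := by
    rw [Complex.re_sum, sum_filter]
    refine sum_congr rfl fun i hi => ?_
    split_ifs with h
    · rfl
    · simp [hp i hi h]
  have h₂ : ((∑ i ∈ S, (Complex.normSq (f i) : ℂ)).re + (∑ i ∈ S, f i ^ 2).re) / 2 = ∑ i ∈ S, (f i).re ^ 2 := by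
    rw [Complex.re_sum, Complex.re_sum, ← sum_add_distrib, sum_div]
    refine sum_congr rfl fun i _ => ?_
    rw [Complex.ofReal_re, Complex.normSq_apply, sq, Complex.mul_re]
    ring
  rw [h₁, h₂]
  refine sq_sum_le_card_mul_sum_sq.trans ?_
  gcongr
  exact filter_subset _ _

end CauchySchwarz

section Proportion

open Finset Filter Topology

lemma card_nonvanishing_mul_ge {q : ℕ} [hq : Fact q.Prime] (h2 : q ≠ 2) {a : ℕ} (ha : a ≤ 1) {Y : ℕ} {c : ℕ → ℝ}
    {A B D : ℝ} (hA : 0 ≤ A)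
    (h₁ : A ≤ (average a (fun χ : DirichletCharacter ℂ q =>
      (kernelMass a : ℂ) * χ.LFunction (1 / 2) * mollifier Y c χ)).re)
    (h₂ : (average a (fun χ : DirichletCharacter ℂ q => (kernelMass a : ℂ) ^ 2 *
      (χ.LFunction (1 / 2) * χ⁻¹.LFunction (1 / 2)) * (mollifier Y c χ * mollifier Y c χ⁻¹))).re ≤ B)
    (h₃ : (average a (fun χ : DirichletCharacter ℂ q =>
      ((kernelMass a : ℂ) * χ.LFunction (1 / 2) * mollifier Y c χ) ^ 2)).re ≤ D) :
    A ^ 2 * (((q : ℝ) - 1) / 2) ≤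
      (#{χ ∈ parityFamily q a | χ.LFunction (1 / 2) ≠ 0} : ℝ) * ((B + D) / 2) := by
  have hq2 := two_lt_cast h2
  set n : ℝ := ((q : ℝ) - 1) / 2 with hn
  have hn0 : 0 < n := by rw [hn]; linarith
  set f : DirichletCharacter ℂ q → ℂ := fun χ => (kernelMass a : ℂ) * χ.LFunction (1 / 2) * mollifier Y c χ
  have hav : ∀ g : DirichletCharacter ℂ q → ℂ, (average a g).re = n⁻¹ * (∑ χ ∈ parityFamily q a, g χ).re := by
    intro g
    rw [average, ← Complex.re_ofReal_mul]
    congr 2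
    rw [hn]
    push_cast
    rw [inv_div]
  have hsq := sq_re_sum_le (parityFamily q a) f (fun χ => χ.LFunction (1 / 2) ≠ 0) fun χ _ h => by
    rw [not_not] at h
    simp only [f]
    rw [h, mul_zero, zero_mul]
  rw [average_congr (g := fun χ => (Complex.normSq (f χ) : ℂ)) fun χ hχ =>
    mollified_normSq ((mem_parityFamily ha).mp hχ).1 ((mem_parityFamily ha).mp hχ).2 Y c, hav] at h₂
  rw [hav] at h₁ h₃
  have e₁ : n * A ≤ (∑ χ ∈ parityFamily q a, f χ).re := by
    rwa [inv_mul_eq_div, le_div_iff₀' hn0] at h₁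
  have e₂ : (∑ χ ∈ parityFamily q a, (Complex.normSq (f χ) : ℂ)).re ≤ n * B := by
    rwa [inv_mul_eq_div, div_le_iff₀' hn0] at h₂
  have e₃ : (∑ χ ∈ parityFamily q a, f χ ^ 2).re ≤ n * D := by
    rwa [inv_mul_eq_div, div_le_iff₀' hn0] at h₃
  have e₄ : (n * A) ^ 2 ≤ (#{χ ∈ parityFamily q a | χ.LFunction (1 / 2) ≠ 0} : ℝ) * ((n * B + n * D) / 2) := by
    calc (n * A) ^ 2 ≤ (∑ χ ∈ parityFamily q a, f χ).re ^ 2 := by gcongr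
      _ ≤ _ := hsq
      _ ≤ _ := by gcongr
  refine le_of_mul_le_mul_left ?_ hn0
  calc n * (A ^ 2 * n) = (n * A) ^ 2 := by ring
    _ ≤ _ := e₄
    _ = _ := by ring

lemma tendsto_rpow_neg_natCast (C : ℝ) {s : ℝ} (hs : 0 < s) :
    Tendsto (fun q : ℕ => C * (q : ℝ) ^ (-s)) atTop (𝓝 0) := by
  simpa using ((tendsto_rpow_neg_atTop hs).comp tendsto_natCast_atTop_atTop).const_mul C

lemma eventually_card_nonvanishing_ge {ε : ℝ} (hε : 0 < ε) {a : ℕ} (ha : a ≤ 1) :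
    ∀ᶠ q : ℕ in atTop, ∀ [Fact q.Prime], (3 / 8 - ε) * (((q : ℝ) - 1) / 2) ≤
      (#{χ ∈ parityFamily q a | χ.LFunction (1 / 2) ≠ 0} : ℝ) := by
  set δ : ℝ := min (1 / 20) (ε / 2) with hδdef
  have hδ : 0 < δ := by positivity
  have hδ1 : δ ≤ 1 / 20 := min_le_left _ _
  have hδε : δ ≤ ε / 2 := min_le_right _ _
  clear_value δ
  obtain ⟨C₁, hC₁, h₁⟩ := exists_first_moment
  obtain ⟨C₂, hC₂, k, h₂⟩ := exists_second_moment
  obtain ⟨C₃, hC₃, h₃⟩ := exists_square_moment_le hδ hδ1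
  obtain ⟨C₄, hC₄, h₄⟩ := exists_mollifier_form_le
  set κ := kernelMass a with hκdef
  have hκ : 0 < κ := kernelMass_pos a
  set θ : ℝ := 3 / 10 - δ with hθdef
  have hθ : 0 < θ := by linarith
  set A : ℕ → ℝ := fun q => κ - C₁ * (q : ℝ) ^ (-(1 / 16) : ℝ) with hA
  set B : ℕ → ℝ := fun q => κ ^ 2 * (θ⁻¹ + 1) + (|k a| + 2 * κ ^ 2 * C₄) / (θ * Real.log q) +
    C₂ * (q : ℝ) ^ (-(1 / 16) : ℝ) with hB
  set D : ℕ → ℝ := fun q => κ ^ 2 + C₃ * (q : ℝ) ^ (-(δ / 4)) with hD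
  have tA : Tendsto A atTop (𝓝 κ) := by
    simpa [hA] using (tendsto_const_nhds (x := κ)).sub (tendsto_rpow_neg_natCast C₁ (s := 1 / 16) (by norm_num))
  have tlog : Tendsto (fun q : ℕ => (|k a| + 2 * κ ^ 2 * C₄) / (θ * Real.log q)) atTop (𝓝 0) :=
    Tendsto.const_div_atTop
      ((Real.tendsto_log_atTop.comp tendsto_natCast_atTop_atTop).const_mul_atTop hθ) _
  have tB : Tendsto B atTop (𝓝 (κ ^ 2 * (θ⁻¹ + 1))) := by
    simpa [hB] using ((tendsto_const_nhds (x := κ ^ 2 * (θ⁻¹ + 1))).add tlog).add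
      (tendsto_rpow_neg_natCast C₂ (s := 1 / 16) (by norm_num))
  have tD : Tendsto D atTop (𝓝 (κ ^ 2)) := by
    simpa using (tendsto_const_nhds (x := κ ^ 2)).add (tendsto_rpow_neg_natCast C₃ (s := δ / 4) (by positivity))
  have tU : Tendsto (fun q => (B q + D q) / 2) atTop (𝓝 ((κ ^ 2 * (θ⁻¹ + 1) + κ ^ 2) / 2)) :=
    (tB.add tD).div_const 2
  have hlt : (3 / 8 - ε) * ((κ ^ 2 * (θ⁻¹ + 1) + κ ^ 2) / 2) < κ ^ 2 := by
    have : (3 / 8 - ε) * ((θ⁻¹ + 1 + 1) / 2) < 1 := by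
      rw [show (3 / 8 - ε) * ((θ⁻¹ + 1 + 1) / 2) = (3 / 8 - ε) * (1 + 2 * θ) / (2 * θ) by field_simp; ring,
        div_lt_one (by positivity)]
      nlinarith
    calc _ = κ ^ 2 * ((3 / 8 - ε) * ((θ⁻¹ + 1 + 1) / 2)) := by ring
      _ < κ ^ 2 * 1 := by gcongr
      _ = _ := mul_one _
  have hUpos : 0 < (κ ^ 2 * (θ⁻¹ + 1) + κ ^ 2) / 2 := by positivity
  filter_upwards [tA.eventually_const_lt hκ, tU.eventually_const_lt hUpos,
    (tU.const_mul (3 / 8 - ε)).eventually_lt (tA.pow 2) hlt, eventually_gt_atTop 2] with q hqA hqU hqlt hq2 hq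
  have h2 : q ≠ 2 := by omega
  have hq1 : (1 : ℝ) < q := by linarith [two_lt_cast h2]
  set Y : ℕ := ⌊(q : ℝ) ^ θ⌋₊ with hYdef
  have hY1 : 1 ≤ Y := by
    rw [hYdef, Nat.one_le_floor_iff]
    exact Real.one_le_rpow hq1.le hθ.le
  have hYθ : (Y : ℝ) ≤ (q : ℝ) ^ θ := Nat.floor_le (by positivity)
  have hY' : (q : ℝ) ^ θ ≤ Y + 1 := (Nat.lt_floor_add_one _).le
  have hle : ∀ s : ℝ, θ ≤ s → (Y : ℝ) ≤ (q : ℝ) ^ s := fun s hs =>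
    hYθ.trans (Real.rpow_le_rpow_of_exponent_le hq1.le hs)
  have hc := abs_mollifierCoeff_le hY1
  have m₁ := h₁ q h2 a ha Y hY1 (hle _ (by linarith)) _ hc
  have m₂ := h₂ q h2 a ha Y hY1 (hle _ (by linarith)) _ hc
  have m₃ := h₃ q h2 a ha Y hY1 hYθ _ hc
  have m₄ := h₄ Y hY1 θ hθ q hq1 hY' (κ ^ 2) (k a) (by positivity)
  rw [mollifierCoeff_one hY1] at m₁
  have r₁ := (Complex.abs_re_le_norm _).trans m₁
  have r₂ := (Complex.abs_re_le_norm _).trans m₂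
  have r₃ := (Complex.re_le_norm _).trans m₃
  rw [Complex.sub_re, abs_le] at r₁ r₂
  rw [Complex.ofReal_re] at r₂
  have r₁' := r₁.1
  rw [Complex.ofReal_one, mul_one, Complex.ofReal_re] at r₁'
  have key := card_nonvanishing_mul_ge h2 ha (Y := Y) (c := mollifierCoeff Y) (A := A q) (B := B q) (D := D q) hqA.le
    (by simp only [hA]; linarith) (by simp only [hB]; linarith [r₂.2]) r₃
  refine le_of_mul_le_mul_right ?_ hqU
  refine le_trans ?_ key
  have : 0 < ((q : ℝ) - 1) / 2 := by linarith
  calc _ = ((3 / 8 - ε) * ((B q + D q) / 2)) * (((q : ℝ) - 1) / 2) := by ring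
    _ ≤ _ := by gcongr

lemma sum_card_nonvanishing_le {q : ℕ} [hq : Fact q.Prime] :
    #{χ ∈ parityFamily q 0 | χ.LFunction (1 / 2) ≠ 0} + #{χ ∈ parityFamily q 1 | χ.LFunction (1 / 2) ≠ 0} ≤
      Nat.card {χ : DirichletCharacter ℂ q // χ.LFunction (1 / 2) ≠ 0} := by
  classical
  rw [Nat.card_eq_fintype_card, Fintype.card_subtype, ← card_union_of_disjoint]
  · refine card_le_card fun χ hχ => ?_
    simp only [mem_union, mem_filter] at hχ
    simp only [mem_filter, mem_univ, true_and]
    exact hχ.elim And.right And.right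
  · refine disjoint_filter_filter (disjoint_left.mpr fun χ h₀ h₁ => ?_)
    have e₀ := ((mem_parityFamily zero_le_one).mp h₀).2.2
    have e₁ := ((mem_parityFamily le_rfl).mp h₁).2.2
    rw [e₀] at e₁
    norm_num at e₁

end Proportion

end DirichletNonvanishing

/-- Khan–Ngo: at least a proportion `3/8 − o(1)` of the Dirichlet `L`-functions modulo
a prime `q` do not vanish at the central point `s = 1/2`: for every `ε > 0` there is
`Q` such that for every prime `q ≥ Q`, the number of Dirichlet characters `χ` mod `q`
with `L(χ, 1/2) ≠ 0` is at least `(3/8 − ε)(q − 1)`. -/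
theorem stmt_17 (ε : ℝ) (hε : 0 < ε) :
    ∃ Q : ℕ, ∀ (q : ℕ) (hq : q.Prime), Q ≤ q →
      (3 / 8 - ε) * ((q : ℝ) - 1) ≤
        (Nat.card {χ : DirichletCharacter ℂ q //
          @DirichletCharacter.LFunction q ⟨hq.ne_zero⟩ χ (1 / 2) ≠ 0} : ℝ) := by
  have h₀ := DirichletNonvanishing.eventually_card_nonvanishing_ge hε zero_le_one
  have h₁ := DirichletNonvanishing.eventually_card_nonvanishing_ge hε le_rfl
  obtain ⟨Q, hQ⟩ := Filter.eventually_atTop.mp (h₀.and h₁)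
  refine ⟨Q, fun q hq hqQ => ?_⟩
  have : Fact q.Prime := ⟨hq⟩
  obtain ⟨k₀, k₁⟩ := hQ q hqQ
  have key := Nat.cast_le (α := ℝ).mpr (DirichletNonvanishing.sum_card_nonvanishing_le (q := q))
  push_cast at key
  refine le_trans ?_ key
  linarith [@k₀ this, @k₁ this]
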